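/- The class of all finite simple graphs that do not contain K̂₄ as an induced minor is well-quasi-ordered by the induced minor relation. -/

import Mathlib

open SimpleGraph

namespace IMWQO

/-- `H` is an induced minor of `G`: there is a family of pairwise disjoint nonempty
connected subsets of `V(G)`, indexed by `V(H)`, such that distinct branch sets are
joined by an edge of `G` iff the corresponding vertices are adjacent in `H`. -/
def IsInducedMinor {α β : Type*} (H : SimpleGraph α) (G : SimpleGraph β) : Prop :=
  ∃ μ : α → Set β,
    (∀ a, (μ a).Nonempty) ∧
    (∀ a b, a ≠ b → Disjoint (μ a) (μ b)) ∧
    (∀ a, (G.induce (μ a)).Connected) ∧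
    (∀ a b, a ≠ b → ((∃ x ∈ μ a, ∃ y ∈ μ b, G.Adj x y) ↔ H.Adj a b))

/-- A bundled finite simple graph. -/
abbrev FinGraph := Σ n : ℕ, SimpleGraph (Fin n)

/-- The induced minor relation on bundled finite graphs. -/
def FinGraph.IM (H G : FinGraph) : Prop := IsInducedMinor H.2 G.2

/-- A class of finite graphs is well-quasi-ordered by the induced minor relation. -/
def WqoClass (P : FinGraph → Prop) : Prop :=
  ∀ f : ℕ → FinGraph, (∀ i, P (f i)) → ∃ i j, i < j ∧ FinGraph.IM (f i) (f j)

/-- `K̂₄`: `K₄` (on vertices `0,1,2,3`) plus a vertex `4` adjacent to `0` and `1`. -/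
def hatK4 : SimpleGraph (Fin 5) :=
  SimpleGraph.fromRel fun a b =>
    (a.val < 4 ∧ b.val < 4) ∨ (a.val = 4 ∧ (b.val = 0 ∨ b.val = 1))

/-- The gem: the path `0 - 1 - 2 - 3` plus a dominating vertex `4`. -/
def gem : SimpleGraph (Fin 5) :=
  SimpleGraph.fromRel fun a b =>
    (b.val = a.val + 1 ∧ b.val ≤ 3) ∨ a.val = 4

/-- The complete graph on four vertices. -/
def K4 : SimpleGraph (Fin 4) := ⊤

/-- The prism, i.e. the Cartesian (box) product `K₃ □ K₂`. -/
def prism : SimpleGraph (Fin 3 × Fin 2) :=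
  (⊤ : SimpleGraph (Fin 3)) □ (⊤ : SimpleGraph (Fin 2))

/-- The complete bipartite graph `K_{3,3}`. -/
def K33 : SimpleGraph (Fin 3 ⊕ Fin 3) := completeBipartiteGraph (Fin 3) (Fin 3)

/-- Subdivide the edge `{u,v}` of `G`, the new vertex being `Fin.last n`. -/
def subdivideEdge {n : ℕ} (G : SimpleGraph (Fin n)) (u v : Fin n) :
    SimpleGraph (Fin (n + 1)) :=
  SimpleGraph.fromRel fun a b =>
    (∃ a' b' : Fin n, a = a'.castSucc ∧ b = b'.castSucc ∧ G.Adj a' b' ∧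
      ¬(a' = u ∧ b' = v) ∧ ¬(a' = v ∧ b' = u))
    ∨ (a = Fin.last n ∧ (b = u.castSucc ∨ b = v.castSucc))

/-- One subdivision step on bundled graphs: the first graph is obtained from the
second one by subdividing one edge. -/
inductive SubdivStep : FinGraph → FinGraph → Prop
  | mk {n : ℕ} (G : SimpleGraph (Fin n)) (u v : Fin n) (h : G.Adj u v) :
      SubdivStep ⟨n + 1, subdivideEdge G u v⟩ ⟨n, G⟩

/-- `G` is (isomorphic to) a subdivision of `H`. -/
def IsSubdivision {α β : Type*} (G : SimpleGraph α) (H : SimpleGraph β) : Prop :=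
  ∃ A B : FinGraph, Nonempty (G ≃g A.2) ∧ Nonempty (H ≃g B.2) ∧
    Relation.ReflTransGen SubdivStep A B

/-- `G` contains a subdivision of `H` as a subgraph. -/
def ContainsSubdivAsSubgraph {α β : Type*} (G : SimpleGraph α) (H : SimpleGraph β) : Prop :=
  ∃ S : G.Subgraph, IsSubdivision S.coe H

/-- `G` has a proper `K₄`-subdivision: for some vertex `v`, `G - v` contains
a subdivision of `K₄` as a subgraph. -/
def HasProperK4Subdivision {α : Type*} (G : SimpleGraph α) : Prop :=
  ∃ v : α, ContainsSubdivAsSubgraph (G.induce {u | u ≠ v}) K4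

/-- `G` is 2-connected: at least 3 vertices, and removing any vertex leaves it connected. -/
def TwoConnected {α : Type*} [Fintype α] (G : SimpleGraph α) : Prop :=
  3 ≤ Fintype.card α ∧ ∀ v : α, (G.induce {u | u ≠ v}).Connected

/-- `G` is complete multipartite: two vertices are adjacent iff they lie in different
classes of some partition (equivalence relation). -/
def IsCompleteMultipartite {α : Type*} (G : SimpleGraph α) : Prop :=
  ∃ s : Setoid α, ∀ u v, G.Adj u v ↔ ¬ s.r u v

/-- `G` is a cograph: it has no induced path on four vertices. -/
def IsCograph {α : Type*} (G : SimpleGraph α) : Prop :=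
  ∀ f : Fin 4 → α, Function.Injective f →
    ¬ (∀ a b : Fin 4, G.Adj (f a) (f b) ↔ (pathGraph 4).Adj a b)

/-- `G` is a linear forest: acyclic with maximum degree at most 2,
i.e. a disjoint union of paths. -/
def IsLinearForest {α : Type*} (G : SimpleGraph α) : Prop :=
  G.IsAcyclic ∧ ∀ v, (G.neighborSet v).ncard ≤ 2

/-- The set `C` induces an (induced) cycle in `G`. -/
def InducesCycle {α : Type*} (G : SimpleGraph α) (C : Set α) : Prop :=
  ∃ n : ℕ, 3 ≤ n ∧ Nonempty ((G.induce C) ≃g cycleGraph n)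

/-- The set `S` induces a path in `G` all of whose internal vertices have degree two
in `G`. -/
def IsBasicPath {α : Type*} (G : SimpleGraph α) (S : Set α) : Prop :=
  ∃ (n : ℕ) (φ : (G.induce S) ≃g pathGraph n),
    ∀ v : S, (φ v).val ≠ 0 → (φ v).val ≠ n - 1 → (G.neighborSet v.val).ncard = 2

/-- The wheel with cycle `0, …, n-1` and center adjacent to the vertices of `T`. -/
def wheelGraph (n : ℕ) (T : Finset (Fin n)) : SimpleGraph (Fin n ⊕ Unit) :=
  SimpleGraph.fromRel fun a b =>
    (∃ x y : Fin n, a = Sum.inl x ∧ b = Sum.inl y ∧ (cycleGraph n).Adj x y)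
    ∨ (∃ x ∈ T, a = Sum.inr () ∧ b = Sum.inl x)

/-- `G` is a `k`-wheel: a cycle of order at least `max k 3` plus a center adjacent to
exactly `k` distinct vertices of the cycle. -/
def IsWheel {α : Type*} (k : ℕ) (G : SimpleGraph α) : Prop :=
  ∃ n : ℕ, 3 ≤ n ∧ k ≤ n ∧ ∃ T : Finset (Fin n), T.card = k ∧
    Nonempty (G ≃g wheelGraph n T)

/-- A 3-wheel subgraph of `G`: a cycle of `G` together with a center outside the cycle
joined to (at least) three distinct vertices of the cycle by edges of `G`. -/
structure ThreeWheelSub {α : Type*} (G : SimpleGraph α) where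
  base : α
  cyc : G.Walk base base
  cyc_isCycle : cyc.IsCycle
  center : α
  center_not_mem : center ∉ cyc.support
  spokes : Finset α
  spokes_card : spokes.card = 3
  spokes_sub : ∀ x ∈ spokes, x ∈ cyc.support
  spokes_adj : ∀ x ∈ spokes, G.Adj center x

/-- The number of vertices of a 3-wheel subgraph. -/
def ThreeWheelSub.order {α : Type*} [DecidableEq α] {G : SimpleGraph α}
    (W : ThreeWheelSub G) : ℕ :=
  W.cyc.support.toFinset.card + 1

/-- `G` has a cycle-multipartite decomposition. -/
def HasCycleMultipartiteDecomp {α : Type*} (G : SimpleGraph α) : Prop :=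
  ∃ C R : Set α, C ∪ R = Set.univ ∧ Disjoint C R ∧
    InducesCycle G C ∧ IsCompleteMultipartite (G.induce R) ∧
    ∀ u ∈ R, ∀ v ∈ R, ∀ c ∈ C, (G.Adj u c ↔ G.Adj v c)

/-- A bundled finite simple graph whose vertices are labeled by finite subsets of `S`. -/
structure LabGraph (S : Type*) where
  n : ℕ
  graph : SimpleGraph (Fin n)
  label : Fin n → Finset S

/-- The domination order on finite subsets of a quasi-order: `A ≤^P B` iff there is an
injection `φ : A → B` with `r a (φ a)` for all `a ∈ A`. -/
def FinsetLE {S : Type*} (r : S → S → Prop) (A B : Finset S) : Prop :=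
  ∃ φ : {x // x ∈ A} → {x // x ∈ B}, Function.Injective φ ∧ ∀ a, r a.val (φ a).val

/-- The union of the labels of the vertices in `A`. -/
noncomputable def labelUnion {S : Type*} {n : ℕ} (lab : Fin n → Finset S)
    (A : Finset (Fin n)) : Finset S :=
  letI := Classical.decEq S
  A.biUnion lab

/-- Label-respecting induced minor relation on labeled graphs. -/
def LabIM {S : Type*} (r : S → S → Prop) (H G : LabGraph S) : Prop :=
  ∃ μ : Fin H.n → Finset (Fin G.n),
    (∀ a, (μ a).Nonempty) ∧
    (∀ a b, a ≠ b → Disjoint (μ a) (μ b)) ∧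
    (∀ a, (G.graph.induce (↑(μ a) : Set (Fin G.n))).Connected) ∧
    (∀ a b, a ≠ b → ((∃ x ∈ μ a, ∃ y ∈ μ b, G.graph.Adj x y) ↔ H.graph.Adj a b)) ∧
    (∀ a, FinsetLE r (H.label a) (labelUnion G.label (μ a)))

/-- Label-respecting contraction relation on labeled graphs: an induced minor model
whose branch sets cover all vertices. -/
def LabContraction {S : Type*} (r : S → S → Prop) (H G : LabGraph S) : Prop :=
  ∃ μ : Fin H.n → Finset (Fin G.n),
    (∀ a, (μ a).Nonempty) ∧
    (∀ a b, a ≠ b → Disjoint (μ a) (μ b)) ∧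
    (∀ x : Fin G.n, ∃ a, x ∈ μ a) ∧
    (∀ a, (G.graph.induce (↑(μ a) : Set (Fin G.n))).Connected) ∧
    (∀ a b, a ≠ b → ((∃ x ∈ μ a, ∃ y ∈ μ b, G.graph.Adj x y) ↔ H.graph.Adj a b)) ∧
    (∀ a, FinsetLE r (H.label a) (labelUnion G.label (μ a)))

/-- Label-respecting induced subgraph relation on labeled graphs. -/
def LabISub {S : Type*} (r : S → S → Prop) (H G : LabGraph S) : Prop :=
  ∃ φ : Fin H.n → Fin G.n, Function.Injective φ ∧
    (∀ a b, H.graph.Adj a b ↔ G.graph.Adj (φ a) (φ b)) ∧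
    (∀ a, FinsetLE r (H.label a) (G.label (φ a)))

/-- A relation is a well-quasi-order: every infinite sequence contains a good pair. -/
def IsWqo {S : Type*} (r : S → S → Prop) : Prop :=
  ∀ g : ℕ → S, ∃ i j, i < j ∧ r (g i) (g j)

section Connectivity

variable {V : Type} {G : SimpleGraph V}

/-- The set `A` induces a connected subgraph of `G`. -/
def Cn (G : SimpleGraph V) (A : Set V) : Prop :=
  A.Nonempty ∧ ∀ X ⊆ A, X.Nonempty → (∀ x ∈ X, ∀ y ∈ A, G.Adj x y → y ∈ X) → A ⊆ X

/-- Some edge of `G` joins `A` to `B`. -/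
def Tch (G : SimpleGraph V) (A B : Set V) : Prop := ∃ x ∈ A, ∃ y ∈ B, G.Adj x y

lemma Tch.symm {A B : Set V} (h : Tch G A B) : Tch G B A := by
  obtain ⟨x, hx, y, hy, h⟩ := h
  exact ⟨y, hy, x, hx, h.symm⟩

lemma tch_comm {A B : Set V} : Tch G A B ↔ Tch G B A := ⟨Tch.symm, Tch.symm⟩

lemma Tch.mono {A B A' B' : Set V} (h : Tch G A B) (hA : A ⊆ A') (hB : B ⊆ B') :
    Tch G A' B' := by
  obtain ⟨x, hx, y, hy, h⟩ := h
  exact ⟨x, hA hx, y, hB hy, h⟩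

lemma tch_of_adj {A B : Set V} {x y : V} (h : G.Adj x y) (hx : x ∈ A) (hy : y ∈ B) :
    Tch G A B := ⟨x, hx, y, hy, h⟩

lemma Cn.nonempty {A : Set V} (h : Cn G A) : A.Nonempty := h.1

lemma Cn.exists_adj {A X : Set V} (h : Cn G A) (hX : X ⊆ A) (hne : X.Nonempty) {a : V}
    (ha : a ∈ A) (haX : a ∉ X) : ∃ x ∈ X, ∃ y ∈ A, y ∉ X ∧ G.Adj x y := by
  by_contra! hcon
  exact haX (h.2 X hX hne (fun x hx y hy hxy => by
    by_contra hyX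
    exact hcon x hx y hy hyX hxy) ha)

lemma cn_singleton (a : V) : Cn G {a} := by
  refine ⟨⟨a, rfl⟩, fun X hX hne _ => ?_⟩
  obtain ⟨x, hx⟩ := hne
  have : x = a := hX hx
  rintro _ rfl
  exact this ▸ hx

lemma Cn.union_of {B Z : Set V} (hB : Cn G B)
    (h : ∀ Y ⊆ Z, Y.Nonempty → Disjoint Y B → (∀ y ∈ Y, ∀ z ∈ Z, G.Adj y z → z ∈ Y) →
      Tch G Y B) : Cn G (B ∪ Z) := by
  refine ⟨hB.1.mono Set.subset_union_left, fun X hX hne hcl => ?_⟩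
  by_cases hXB : (X ∩ B).Nonempty
  · have hBX : B ⊆ X := (hB.2 (X ∩ B) Set.inter_subset_right hXB
      (fun x hx y hy hxy => ⟨hcl x hx.1 y (Or.inl hy) hxy, hy⟩)).trans Set.inter_subset_left
    intro a ha
    by_contra haX
    have haZ : a ∈ Z := ha.resolve_left fun h' => haX (hBX h')
    obtain ⟨y, hy, b, hb, hyb⟩ := h (Z \ X) Set.sdiff_subset ⟨a, haZ, haX⟩
      (Set.disjoint_left.2 fun y hy hyB => hy.2 (hBX hyB))
      (fun y hy z hz hyz => ⟨hz, fun hzX => hy.2 (hcl z hzX y (Or.inr hy.1) hyz.symm)⟩)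
    exact hy.2 (hcl b (hBX hb) y (Or.inr hy.1) hyb.symm)
  · exfalso
    rw [Set.not_nonempty_iff_eq_empty] at hXB
    have hd : Disjoint X B := Set.disjoint_iff_inter_eq_empty.2 hXB
    have hXZ : X ⊆ Z := fun x hx => (hX hx).resolve_left (Set.disjoint_left.1 hd hx)
    obtain ⟨y, hy, b, hb, hyb⟩ := h X hXZ hne hd
      (fun y hy z hz hyz => hcl y hy z (Or.inr hz) hyz)
    exact Set.disjoint_left.1 hd (hcl y hy b (Or.inl hb) hyb) hb

lemma Cn.star {B Z : Set V} (hB : Cn G B)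
    (h : ∀ a ∈ Z, ∃ A ⊆ B ∪ Z, Cn G A ∧ a ∈ A ∧ (A ∩ B).Nonempty) : Cn G (B ∪ Z) := by
  refine hB.union_of fun Y hYZ ⟨y, hy⟩ hd hcl => ?_
  obtain ⟨A, hA, hAc, hyA, b, hbA, hbB⟩ := h y (hYZ hy)
  obtain ⟨x, hx, z, hz, hzY, hxz⟩ := hAc.exists_adj (X := Y ∩ A) Set.inter_subset_right
    ⟨y, hy, hyA⟩ hbA (fun h' => Set.disjoint_left.1 hd h'.1 hbB)
  rcases hA hz with hzB | hzZ
  · exact ⟨x, hx.1, z, hzB, hxz⟩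
  · exact absurd ⟨hcl x hx.1 z hzZ hxz, hz⟩ hzY

lemma Cn.union {A B : Set V} (hA : Cn G A) (hB : Cn G B) (h : Tch G A B) : Cn G (A ∪ B) := by
  refine hA.union_of fun Y hY hne _ hcl => ?_
  exact h.symm.mono (hB.2 Y hY hne hcl) subset_rfl

lemma cn_pair {a b : V} (h : G.Adj a b) : Cn G {a, b} :=
  (cn_singleton a).union (cn_singleton b) ⟨a, rfl, b, rfl, h⟩

lemma Cn.insert_of_adj {A : Set V} (hA : Cn G A) {a b : V} (hb : b ∈ A) (h : G.Adj a b) :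
    Cn G (insert a A) :=
  (cn_singleton a).union hA ⟨a, rfl, b, hb, h⟩

lemma Cn.biUnion {W : Type} {H : SimpleGraph W} {A : Set W} {f : W → Set V} (hA : Cn H A)
    (hf : ∀ x ∈ A, Cn G (f x))
    (hadj : ∀ x ∈ A, ∀ y ∈ A, H.Adj x y → Tch G (f x) (f y)) :
    Cn G (⋃ x ∈ A, f x) := by
  obtain ⟨a, ha⟩ := hA.1
  obtain ⟨b, hb⟩ := (hf a ha).1
  refine ⟨⟨b, by simp only [Set.mem_iUnion]; exact ⟨a, ha, hb⟩⟩, fun X hX ⟨x, hx⟩ hcl => ?_⟩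
  have key : ∀ y ∈ A, ∀ z ∈ f y, z ∈ X → f y ⊆ X := fun y hy z hz hzX =>
    ((hf y hy).2 (X ∩ f y) Set.inter_subset_right ⟨z, hzX, hz⟩ (fun u hu v hv huv =>
      ⟨hcl u hu.1 v (by simp only [Set.mem_iUnion]; exact ⟨y, hy, hv⟩) huv, hv⟩)).trans
        Set.inter_subset_left
  obtain ⟨y, hy, hxy⟩ : ∃ y ∈ A, x ∈ f y := by simpa using hX hx
  have := hA.2 {y | y ∈ A ∧ f y ⊆ X} (fun _ h => h.1) ⟨y, hy, key y hy x hxy hx⟩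
    (fun u hu v hv huv => by
      obtain ⟨p, hp, q, hq, hpq⟩ := hadj u hu.1 v hv huv
      exact ⟨hv, key v hv q hq (hcl p (hu.2 hp) q
        (by simp only [Set.mem_iUnion]; exact ⟨v, hv, hq⟩) hpq)⟩)
  exact Set.iUnion₂_subset fun z hz => (this hz).2

lemma Cn.connected {A : Set V} (hA : Cn G A) : (G.induce A).Connected := by
  obtain ⟨a, ha⟩ := hA.1
  have : Nonempty A := ⟨⟨a, ha⟩⟩
  refine (connected_iff _).2 ⟨fun u v => ?_, inferInstance⟩
  have := hA.2 {v | ∃ h : v ∈ A, (G.induce A).Reachable u ⟨v, h⟩} (fun _ h => h.1)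
    ⟨u, u.2, Reachable.refl _⟩ (fun x ⟨hx, hr⟩ y hy hxy => ⟨hy, hr.trans
      (Adj.reachable (by simpa using hxy))⟩) v.2
  exact this.2

/-- The component of `a` in the subgraph induced by `Z`. -/
def cmp (G : SimpleGraph V) (Z : Set V) (a : V) : Set V :=
  {x | ∃ A ⊆ Z, Cn G A ∧ a ∈ A ∧ x ∈ A}

/-- `L` is (the vertex set of) a component of the subgraph induced by `Z`. -/
structure IsComp (G : SimpleGraph V) (Z L : Set V) : Prop where
  sub : L ⊆ Z
  cn : Cn G L
  closed : ∀ x ∈ L, ∀ z ∈ Z, G.Adj x z → z ∈ L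

lemma subset_cmp {Z A : Set V} {a : V} (h : A ⊆ Z) (hA : Cn G A) (ha : a ∈ A) :
    A ⊆ cmp G Z a := fun _ hx => ⟨A, h, hA, ha, hx⟩

lemma mem_cmp {Z : Set V} {a : V} (h : a ∈ Z) : a ∈ cmp G Z a :=
  subset_cmp (Set.singleton_subset_iff.2 h) (cn_singleton a) rfl rfl

lemma cmp_isComp {Z : Set V} {a : V} (h : a ∈ Z) : IsComp G Z (cmp G Z a) := by
  have hc : Cn G (cmp G Z a) := by
    have : cmp G Z a = {a} ∪ cmp G Z a := by
      rw [Set.union_eq_self_of_subset_left (Set.singleton_subset_iff.2 (mem_cmp h))]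
    rw [this]
    refine (cn_singleton a).star fun x ⟨A, hAZ, hA, haA, hxA⟩ =>
      ⟨A, ?_, hA, hxA, a, haA, rfl⟩
    exact (subset_cmp hAZ hA haA).trans Set.subset_union_right
  refine ⟨fun x ⟨A, hAZ, _, _, hx⟩ => hAZ hx, hc, fun x hx z hz hxz => ?_⟩
  obtain ⟨A, hAZ, hA, haA, hxA⟩ := hx
  exact ⟨insert z A, Set.insert_subset hz hAZ, hA.insert_of_adj hxA hxz.symm, Or.inr haA, Or.inl rfl⟩

lemma IsComp.subset {Z L A : Set V} (hL : IsComp G Z L) (hA : A ⊆ Z) (hc : Cn G A)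
    (h : (A ∩ L).Nonempty) : A ⊆ L :=
  (hc.2 (A ∩ L) Set.inter_subset_left h (fun x hx y hy hxy =>
    ⟨hy, hL.closed x hx.2 y (hA hy) hxy⟩)).trans Set.inter_subset_right

lemma IsComp.eq {Z L L' : Set V} (hL : IsComp G Z L) (hL' : IsComp G Z L')
    (h : (L ∩ L').Nonempty) : L = L' :=
  (hL'.subset hL.sub hL.cn h).antisymm (hL.subset hL'.sub hL'.cn (by rwa [Set.inter_comm]))

lemma IsComp.disjoint {Z L L' : Set V} (hL : IsComp G Z L) (hL' : IsComp G Z L')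
    (h : L ≠ L') : Disjoint L L' := by
  by_contra h'
  exact h (hL.eq hL' (Set.not_disjoint_iff_nonempty_inter.1 h'))

lemma IsComp.not_tch {Z L L' : Set V} (hL : IsComp G Z L) (hL' : IsComp G Z L')
    (h : L ≠ L') : ¬ Tch G L L' := by
  rintro ⟨x, hx, y, hy, hxy⟩
  exact Set.disjoint_left.1 (hL.disjoint hL' h) (hL.closed x hx y (hL'.sub hy) hxy) hy

lemma exists_isComp {Z : Set V} {a : V} (h : a ∈ Z) : ∃ L, IsComp G Z L ∧ a ∈ L :=
  ⟨_, cmp_isComp h, mem_cmp h⟩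

lemma exists_isComp_superset {Z A : Set V} (h : A ⊆ Z) (hA : Cn G A) :
    ∃ L, IsComp G Z L ∧ A ⊆ L := by
  obtain ⟨a, ha⟩ := hA.1
  exact ⟨_, cmp_isComp (h ha), subset_cmp h hA ha⟩

/-- A component of `K \ B` touches `B` when `K` is connected. -/
lemma IsComp.tch {K B L : Set V} (hL : IsComp G (K \ B) L) (hK : Cn G K)
    (h : (B ∩ K).Nonempty) : Tch G L (B ∩ K) := by
  obtain ⟨b, hb, hbK⟩ := h
  obtain ⟨x, hx, y, hy, hyL, hxy⟩ := hK.exists_adj (hL.sub.trans Set.sdiff_subset) hL.cn.1 hbK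
    (fun h' => (hL.sub h').2 hb)
  refine ⟨x, hx, y, ⟨?_, hy⟩, hxy⟩
  by_contra hyB
  exact hyL (hL.closed x hx y ⟨hy, hyB⟩ hxy)

lemma Cn.diff_closed {K B Y : Set V} (hK : Cn G K) (hB : Cn G B) (hBK : B ⊆ K)
    (hYK : Y ⊆ K \ B) (hY : ∀ y ∈ Y, ∀ z ∈ K \ B, G.Adj y z → z ∈ Y) : Cn G (K \ Y) := by
  have : K \ Y = B ∪ (K \ Y) := by
    rw [Set.union_eq_self_of_subset_left]
    exact fun b hb => ⟨hBK hb, fun h => (hYK h).2 hb⟩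
  rw [this]
  refine hB.union_of fun X hX hne hd hcl => ?_
  obtain ⟨b, hb⟩ := hB.1
  obtain ⟨x, hx, y, hy, hyX, hxy⟩ := hK.exists_adj (hX.trans Set.sdiff_subset) hne (hBK hb)
    (fun h => Set.disjoint_left.1 hd h hb)
  refine ⟨x, hx, y, ?_, hxy⟩
  by_contra hyB
  by_cases hyY : y ∈ Y
  · exact (hX hx).2 (hY y hyY x ⟨(hX hx).1, Set.disjoint_left.1 hd hx⟩ hxy.symm)
  · exact hyX (hcl x hx y ⟨hy, hyY⟩ hxy)

lemma Cn.diff_isComp {K B L : Set V} (hK : Cn G K) (hB : Cn G B) (hBK : B ⊆ K)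
    (hL : IsComp G (K \ B) L) : Cn G (K \ L) :=
  hK.diff_closed hB hBK hL.sub hL.closed

/-- Disjoint connected subsets of a connected set extend to a partition into two touching
connected sets. -/
lemma Cn.grow {K A B : Set V} (hK : Cn G K) (hA : Cn G A) (hB : Cn G B) (hAK : A ⊆ K)
    (hBK : B ⊆ K) (hd : Disjoint A B) : ∃ A' B', A ⊆ A' ∧ B ⊆ B' ∧ A' ∪ B' = K ∧
      Disjoint A' B' ∧ Cn G A' ∧ Cn G B' ∧ Tch G A' B' := by
  obtain ⟨L, hL, hAL⟩ := exists_isComp_superset (Z := K \ B)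
    (fun a ha => ⟨hAK ha, Set.disjoint_left.1 hd ha⟩) hA
  have hBL : B ⊆ K \ L := fun b hb => ⟨hBK hb, fun h => (hL.sub h).2 hb⟩
  refine ⟨L, K \ L, hAL, hBL, Set.union_sdiff_cancel (hL.sub.trans Set.sdiff_subset),
    Set.disjoint_sdiff_right, hL.cn, hK.diff_isComp hB hBK hL, ?_⟩
  exact (hL.tch hK (by rw [Set.inter_eq_left.2 hBK]; exact hB.1)).mono subset_rfl
    (Set.inter_subset_left.trans hBL)

lemma Cn.split {K : Set V} (hK : Cn G K) {s t : V} (hs : s ∈ K) (ht : t ∈ K) (hst : s ≠ t) :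
    ∃ A B, s ∈ A ∧ t ∈ B ∧ A ∪ B = K ∧ Disjoint A B ∧ Cn G A ∧ Cn G B ∧ Tch G A B := by
  obtain ⟨A, B, hA, hB, h⟩ := hK.grow (cn_singleton s) (cn_singleton t)
    (Set.singleton_subset_iff.2 hs) (Set.singleton_subset_iff.2 ht) (by simpa using hst)
  exact ⟨A, B, hA rfl, hB rfl, h⟩

lemma Cn.exists_noncut [Finite V] {A : Set V} (hA : Cn G A) {r a : V} (hr : r ∈ A) (ha : a ∈ A)
    (har : a ≠ r) : ∃ u ∈ A, u ≠ r ∧ Cn G (A \ {u}) := by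
  obtain ⟨B, ⟨hBA, hB, hrB, hne⟩, hmax⟩ := Set.Finite.exists_maximalFor id
    {B : Set V | B ⊆ A ∧ Cn G B ∧ r ∈ B ∧ B ≠ A} (Set.toFinite _)
    ⟨{r}, Set.singleton_subset_iff.2 hr, cn_singleton r, rfl, fun h => har (by
      rw [← h] at ha; exact ha)⟩
  obtain ⟨c, hc, hcB⟩ : ∃ c ∈ A, c ∉ B := by
    by_contra! h
    exact hne (hBA.antisymm h)
  obtain ⟨x, hx, u, hu, huB, hxu⟩ := hA.exists_adj hBA hB.1 hc hcB
  have hins : insert u B = A := by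
    by_contra h
    exact huB (hmax ⟨Set.insert_subset hu hBA, hB.insert_of_adj hx hxu.symm, Or.inr hrB, h⟩
      (Set.subset_insert u B) (Or.inl rfl))
  refine ⟨u, hu, fun h => huB (h ▸ hrB), ?_⟩
  have : A \ {u} = B := by
    rw [← hins]
    ext z
    simp only [Set.mem_sdiff, Set.mem_insert_iff, Set.mem_singleton_iff]
    constructor
    · tauto
    · exact fun hz => ⟨Or.inr hz, fun h => huB (h ▸ hz)⟩
  rwa [this]

/-- Menger's theorem for two disjoint connections. -/
lemma exists_two_disjoint [Finite V] (n : ℕ) : ∀ (K Ns Nt : Set V), K.ncard = n → K.Nonempty →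
    (∀ m ∈ K, ∃ L ⊆ K, m ∉ L ∧ Cn G L ∧ (L ∩ Ns).Nonempty ∧ (L ∩ Nt).Nonempty) →
    ∃ A B, A ⊆ K ∧ B ⊆ K ∧ Disjoint A B ∧ Cn G A ∧ Cn G B ∧ (A ∩ Ns).Nonempty ∧
      (A ∩ Nt).Nonempty ∧ (B ∩ Ns).Nonempty ∧ (B ∩ Nt).Nonempty := by
  induction n with
  | zero =>
    intro K Ns Nt hn hne _
    rw [Set.ncard_eq_zero] at hn
    exact absurd hn hne.ne_empty
  | succ n ih =>
    intro K Ns Nt hn ⟨m0, hm0⟩ h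
    obtain ⟨L0, hL0K, -, -, ⟨a, haL, haNs⟩, -⟩ := h m0 hm0
    have haK := hL0K haL
    obtain ⟨La, hLaK, haLa, hLa, hLas, hLat⟩ := h a haK
    by_cases haNt : a ∈ Nt
    · exact ⟨{a}, La, Set.singleton_subset_iff.2 haK, hLaK, by simpa using haLa,
        cn_singleton a, hLa, ⟨a, rfl, haNs⟩, ⟨a, rfl, haNt⟩, hLas, hLat⟩
    have hsub : ∀ {X : Set V}, X ⊆ K \ {a} → a ∉ X := fun hX hx => (hX hx).2 rfl
    obtain ⟨A, B, hAK, hBK, hd, hA, hB, hAs, hAt, hBs, hBt⟩ := ih (K \ {a})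
      (Ns ∪ {x | G.Adj a x}) Nt (by rw [Set.ncard_sdiff_singleton_of_mem haK, hn]; rfl)
      (hLa.1.mono fun x hx => ⟨hLaK hx, fun e => haLa (e ▸ hx)⟩) (by
        rintro m ⟨hmK, -⟩
        obtain ⟨L, hLK, hmL, hL, ⟨p, hpL, hps⟩, x, hxL, hxt⟩ := h m hmK
        by_cases haL : a ∈ L
        · have hxa : x ≠ a := fun e => haNt (e ▸ hxt)
          obtain ⟨C, hC, hxC⟩ := exists_isComp (G := G) (Z := L \ {a}) (a := x) ⟨hxL, hxa⟩
          obtain ⟨y, hy, _, ⟨rfl, -⟩, hya⟩ := hC.tch hL ⟨a, rfl, haL⟩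
          exact ⟨C, hC.sub.trans (Set.sdiff_subset_sdiff_left hLK),
            fun h' => hmL (hC.sub h').1, hC.cn, ⟨y, hy, Or.inr hya.symm⟩, x, hxC, hxt⟩
        · exact ⟨L, fun z hz => ⟨hLK hz, fun e => haL (e ▸ hz)⟩, hmL, hL, ⟨p, hpL, Or.inl hps⟩,
            x, hxL, hxt⟩)
    have hAK' := hAK.trans Set.sdiff_subset
    have hBK' := hBK.trans Set.sdiff_subset
    have haA := hsub hAK
    have haB := hsub hBK
    have insK : ∀ {X : Set V}, X ⊆ K → insert a X ⊆ K := Set.insert_subset haK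
    by_cases hA1 : (A ∩ Ns).Nonempty <;> by_cases hB1 : (B ∩ Ns).Nonempty
    · exact ⟨A, B, hAK', hBK', hd, hA, hB, hA1, hAt, hB1, hBt⟩
    · obtain ⟨y, hyB, hy | hy⟩ := hBs
      · exact absurd ⟨y, hyB, hy⟩ hB1
      exact ⟨A, insert a B, hAK', insK hBK', Set.disjoint_insert_right.2 ⟨haA, hd⟩, hA,
        hB.insert_of_adj hyB hy, hA1, hAt, ⟨a, Or.inl rfl, haNs⟩,
        hBt.mono (Set.inter_subset_inter_left _ (Set.subset_insert _ _))⟩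
    · obtain ⟨y, hyA, hy | hy⟩ := hAs
      · exact absurd ⟨y, hyA, hy⟩ hA1
      exact ⟨insert a A, B, insK hAK', hBK', Set.disjoint_insert_left.2 ⟨haB, hd⟩,
        hA.insert_of_adj hyA hy, hB, ⟨a, Or.inl rfl, haNs⟩,
        hAt.mono (Set.inter_subset_inter_left _ (Set.subset_insert _ _)), hB1, hBt⟩
    · obtain ⟨y, hyA, hy | hy⟩ := hAs
      · exact absurd ⟨y, hyA, hy⟩ hA1
      obtain ⟨z, hzB, hz | hz⟩ := hBs
      · exact absurd ⟨z, hzB, hz⟩ hB1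
      obtain ⟨p, hpL, hps⟩ := hLas
      obtain ⟨C, hC, hpC⟩ := exists_isComp (G := G) (Z := La \ (A ∪ B)) (a := p) ⟨hpL, by
        rintro (h' | h')
        · exact hA1 ⟨p, h', hps⟩
        · exact hB1 ⟨p, h', hps⟩⟩
      have hCK : C ⊆ K := (hC.sub.trans Set.sdiff_subset).trans hLaK
      have haC : a ∉ C := fun h' => haLa (hC.sub h').1
      have hCA : Disjoint C A := Set.disjoint_left.2 fun x hx hxA => (hC.sub hx).2 (Or.inl hxA)
      have hCB : Disjoint C B := Set.disjoint_left.2 fun x hx hxA => (hC.sub hx).2 (Or.inr hxA)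
      by_cases hCA' : Tch G C A
      · refine ⟨C ∪ A, insert a B, Set.union_subset hCK hAK', insK hBK', ?_, hC.cn.union hA hCA',
          hB.insert_of_adj hzB hz, ⟨p, Or.inl hpC, hps⟩,
          hAt.mono (Set.inter_subset_inter_left _ Set.subset_union_right),
          ⟨a, Or.inl rfl, haNs⟩,
          hBt.mono (Set.inter_subset_inter_left _ (Set.subset_insert _ _))⟩
        exact Set.disjoint_insert_right.2 ⟨by rintro (h' | h') <;> contradiction,
          Set.disjoint_union_left.2 ⟨hCB, hd⟩⟩
      by_cases hCB' : Tch G C B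
      · refine ⟨C ∪ B, insert a A, Set.union_subset hCK hBK', insK hAK', ?_, hC.cn.union hB hCB',
          hA.insert_of_adj hyA hy, ⟨p, Or.inl hpC, hps⟩,
          hBt.mono (Set.inter_subset_inter_left _ Set.subset_union_right),
          ⟨a, Or.inl rfl, haNs⟩,
          hAt.mono (Set.inter_subset_inter_left _ (Set.subset_insert _ _))⟩
        exact Set.disjoint_insert_right.2 ⟨by rintro (h' | h') <;> contradiction,
          Set.disjoint_union_left.2 ⟨hCA, hd.symm⟩⟩
      have hLC : La ⊆ C := hLa.2 C (hC.sub.trans Set.sdiff_subset) hC.cn.1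
        (fun x hx w hw hxw => by
          by_contra hwC
          by_cases hwAB : w ∈ A ∪ B
          · rcases hwAB with h' | h'
            · exact hCA' ⟨x, hx, w, h', hxw⟩
            · exact hCB' ⟨x, hx, w, h', hxw⟩
          · exact hwC (hC.closed x hx w ⟨hw, hwAB⟩ hxw))
      exact ⟨C, insert a A, hCK, insK hAK', Set.disjoint_insert_right.2 ⟨haC, hCA⟩, hC.cn,
        hA.insert_of_adj hyA hy, ⟨p, hpC, hps⟩, hLat.mono (Set.inter_subset_inter_left _ hLC),
        ⟨a, Or.inl rfl, haNs⟩,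
        hAt.mono (Set.inter_subset_inter_left _ (Set.subset_insert _ _))⟩

/-- `B` induces a connected subgraph with at least two vertices and no cut vertex. -/
structure NoCut (G : SimpleGraph V) (B : Set V) : Prop where
  cn : Cn G B
  two : ∃ a ∈ B, ∃ b ∈ B, a ≠ b
  del : ∀ b, Cn G (B \ {b})

lemma noCut_pair {a b : V} (h : G.Adj a b) : NoCut G {a, b} := by
  refine ⟨cn_pair h, ⟨a, Or.inl rfl, b, Or.inr rfl, h.ne⟩, fun c => ?_⟩
  by_cases hca : c = a
  · have : ({a, b} : Set V) \ {c} = {b} := by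
      ext x
      have := h.ne
      simp only [Set.mem_sdiff, Set.mem_insert_iff, Set.mem_singleton_iff]
      grind
    rw [this]
    exact cn_singleton b
  by_cases hcb : c = b
  · have : ({a, b} : Set V) \ {c} = {a} := by
      ext x
      have := h.ne
      simp only [Set.mem_sdiff, Set.mem_insert_iff, Set.mem_singleton_iff]
      grind
    rw [this]
    exact cn_singleton a
  · rw [Set.sdiff_singleton_eq_self (by simp [hca, hcb])]
    exact cn_pair h

end Connectivity

section Models

universe u

variable {Q : Type u} {k l : ℕ} {V V' V'' : Type}

/-- A labelled induced minor model `μ` of the part `K` of `G`, attached to the terminals `τ`,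
in the part `K'` of `G'` attached to `τ'`. When `b` is false, the only edges allowed
between bags of distinct terminals are edges between terminals. -/
structure Mod (r : Q → Q → Prop) (b : Bool) (G : SimpleGraph V) (lab : V → Q) (K : Set V)
    (τ : Fin k → V) (G' : SimpleGraph V') (lab' : V' → Q) (K' : Set V') (τ' : Fin k → V')
    (μ : V → Set V') : Prop where
  sub : ∀ a ∈ K, μ a ⊆ K'
  subT : ∀ i, μ (τ i) ⊆ K' ∪ {τ' i}
  memT : ∀ i, τ' i ∈ μ (τ i)
  cn : ∀ a ∈ K ∪ Set.range τ, Cn G' (μ a)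
  disj : ∀ a ∈ K ∪ Set.range τ, ∀ c ∈ K ∪ Set.range τ, a ≠ c → Disjoint (μ a) (μ c)
  adj : ∀ a ∈ K, ∀ c ∈ K ∪ Set.range τ, a ≠ c → (Tch G' (μ a) (μ c) ↔ G.Adj a c)
  adjT : b = false → ∀ i j, i ≠ j → ∀ x ∈ μ (τ i), ∀ y ∈ μ (τ j), G'.Adj x y →
    x = τ' i ∧ y = τ' j
  lab : ∀ a ∈ K, ∃ x ∈ μ a, r (lab a) (lab' x)

variable {r : Q → Q → Prop} {b : Bool} {G : SimpleGraph V} {lab : V → Q} {K : Set V}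
  {τ : Fin k → V} {G' : SimpleGraph V'} {lab' : V' → Q} {K' : Set V'} {τ' : Fin k → V'}
  {G'' : SimpleGraph V''} {lab'' : V'' → Q} {K'' : Set V''} {τ'' : Fin k → V''}
  {μ : V → Set V'} {μ' : V' → Set V''}

lemma Mod.mono_target {L : Set V'} (h : Mod r b G lab K τ G' lab' K' τ' μ) (hL : K' ⊆ L) :
    Mod r b G lab K τ G' lab' L τ' μ :=
  { h with
    sub := fun a ha => (h.sub a ha).trans hL
    subT := fun i => (h.subT i).trans (Set.union_subset_union_left _ hL) }

lemma Mod.lax (h : Mod r b G lab K τ G' lab' K' τ' μ) :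
    Mod r true G lab K τ G' lab' K' τ' μ :=
  { h with adjT := by simp }

lemma Mod.refl (hr : ∀ q, r q q) (G : SimpleGraph V) (lab : V → Q) (K : Set V)
    (τ : Fin k → V) : Mod r b G lab K τ G lab K τ (fun a => {a}) where
  sub a ha := Set.singleton_subset_iff.2 ha
  subT i := Set.subset_union_right
  memT i := rfl
  cn a _ := cn_singleton a
  disj a _ c _ h := by simpa using h
  adj a _ c _ _ := by simp [Tch]
  adjT _ i j _ x hx y hy _ := ⟨hx, hy⟩
  lab a _ := ⟨a, rfl, hr _⟩

lemma Mod.bag_sub (h : Mod r b G lab K τ G' lab' K' τ' μ) {a : V} (ha : a ∈ K ∪ Set.range τ) :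
    μ a ⊆ K' ∪ Set.range τ' := by
  rcases ha with ha | ⟨i, rfl⟩
  · exact (h.sub a ha).trans Set.subset_union_left
  · refine (h.subT i).trans (Set.union_subset_union_right _ ?_)
    rintro _ rfl
    exact ⟨i, rfl⟩

lemma Mod.eq_of_mem (h : Mod r b G lab K τ G' lab' K' τ' μ) {a c : V} (ha : a ∈ K ∪ Set.range τ)
    (hc : c ∈ K ∪ Set.range τ) {x : V'} (hx : x ∈ μ a) (hx' : x ∈ μ c) : a = c := by
  by_contra hne
  exact Set.disjoint_left.1 (h.disj a ha c hc hne) hx hx'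

lemma Mod.adj' (h : Mod r b G lab K τ G' lab' K' τ' μ) {a c : V} (ha : a ∈ K ∪ Set.range τ)
    (hc : c ∈ K ∪ Set.range τ) (hac : a ∈ K ∨ c ∈ K) (hne : a ≠ c) :
    Tch G' (μ a) (μ c) ↔ G.Adj a c := by
  rcases hac with h' | h'
  · exact h.adj a h' c hc hne
  · rw [tch_comm, h.adj c h' a ha hne.symm, G.adj_comm]

lemma Mod.trans (hr : ∀ p q s, r p q → r q s → r p s) (hτ : Function.Injective τ)
    (h : Mod r b G lab K τ G' lab' K' τ' μ) (h' : Mod r b G' lab' K' τ' G'' lab'' K'' τ'' μ') :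
    Mod r b G lab K τ G'' lab'' K'' τ'' (fun a => ⋃ x ∈ μ a, μ' x) where
  sub a ha := Set.iUnion₂_subset fun x hx => h'.sub x (h.sub a ha hx)
  subT i := Set.iUnion₂_subset fun x hx => by
    rcases h.subT i hx with hx | rfl
    · exact (h'.sub x hx).trans Set.subset_union_left
    · exact h'.subT i
  memT i := Set.mem_iUnion₂.2 ⟨_, h.memT i, h'.memT i⟩
  cn a ha := by
    refine (h.cn a ha).biUnion (fun x hx => h'.cn x (h.bag_sub ha hx)) fun x hx y hy hxy => ?_
    by_cases hxK : x ∈ K'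
    · exact (h'.adj x hxK y (h.bag_sub ha hy) hxy.ne).2 hxy
    by_cases hyK : y ∈ K'
    · exact ((h'.adj y hyK x (h.bag_sub ha hx) hxy.ne').2 hxy.symm).symm
    exfalso
    rcases ha with ha | ⟨i, rfl⟩
    · exact hxK (h.sub a ha hx)
    · rcases h.subT i hx with h1 | h1
      · exact hxK h1
      rcases h.subT i hy with h2 | h2
      · exact hyK h2
      exact hxy.ne (h1.trans h2.symm)
  disj a ha c hc hne := by
    rw [Set.disjoint_left]
    intro z hz hz'
    obtain ⟨x, hx, hzx⟩ := Set.mem_iUnion₂.1 hz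
    obtain ⟨y, hy, hzy⟩ := Set.mem_iUnion₂.1 hz'
    have := h'.eq_of_mem (h.bag_sub ha hx) (h.bag_sub hc hy) hzx hzy
    subst this
    exact hne (h.eq_of_mem ha hc hx hy)
  adj a ha c hc hne := by
    rw [← h.adj a ha c hc hne]
    constructor
    · rintro ⟨p, hp, q, hq, hpq⟩
      obtain ⟨x, hx, hpx⟩ := Set.mem_iUnion₂.1 hp
      obtain ⟨y, hy, hqy⟩ := Set.mem_iUnion₂.1 hq
      have hxy : x ≠ y := by
        rintro rfl
        exact hne (h.eq_of_mem (Or.inl ha) hc hx hy)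
      exact ⟨x, hx, y, hy, (h'.adj x (h.sub a ha hx) y (h.bag_sub hc hy) hxy).1
        ⟨p, hpx, q, hqy, hpq⟩⟩
    · rintro ⟨x, hx, y, hy, hxy⟩
      exact ((h'.adj x (h.sub a ha hx) y (h.bag_sub hc hy) hxy.ne).2 hxy).mono
        (Set.subset_biUnion_of_mem (u := μ') hx) (Set.subset_biUnion_of_mem (u := μ') hy)
  adjT hb i j hij p hp q hq hpq := by
    obtain ⟨x, hx, hpx⟩ := Set.mem_iUnion₂.1 hp
    obtain ⟨y, hy, hqy⟩ := Set.mem_iUnion₂.1 hq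
    have hx' := h.bag_sub (Or.inr ⟨i, rfl⟩) hx
    have hy' := h.bag_sub (Or.inr ⟨j, rfl⟩) hy
    have key : x = τ' i ∧ y = τ' j := by
      by_cases hxy : x = y
      · subst hxy
        exact absurd (hτ (h.eq_of_mem (Or.inr ⟨i, rfl⟩) (Or.inr ⟨j, rfl⟩) hx hy)) hij
      · by_cases hK : x ∈ K' ∨ y ∈ K'
        · exact h.adjT hb i j hij x hx y hy ((h'.adj' hx' hy' hK hxy).1 ⟨p, hpx, q, hqy, hpq⟩)
        · push Not at hK
          exact ⟨(h.subT i hx).resolve_left hK.1, (h.subT j hy).resolve_left hK.2⟩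
    obtain ⟨rfl, rfl⟩ := key
    exact h'.adjT hb i j hij p hpx q hqy hpq
  lab a ha := by
    obtain ⟨x, hx, h1⟩ := h.lab a ha
    obtain ⟨y, hy, h2⟩ := h'.lab x (h.sub a ha hx)
    exact ⟨y, Set.mem_iUnion₂.2 ⟨x, hx, hy⟩, hr _ _ _ h1 h2⟩

/-- The bags obtained by gluing the models `M i` to the core model `ν`. -/
def glueBag {I : Type} (X : Set V) (τ : Fin k → V) (ν : V → Set V') (KK : I → Set V)
    (T : I → Fin l → V) (KK' : I → Set V') (M : I → V → Set V') (a : V) : Set V' :=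
  {x | (a ∈ X ∪ Set.range τ ∧ x ∈ ν a) ∨
    ∃ i, a ∈ KK i ∪ Set.range (T i) ∧ x ∈ M i a ∧ x ∈ KK' i}

/-- Gluing models of pieces along the bags of a core model. -/
theorem Mod.glue {I : Type} {X : Set V} {X' : Set V'} {ν : V → Set V'} {KK : I → Set V}
    {T : I → Fin l → V} {KK' : I → Set V'} {T' : I → Fin l → V'} {M : I → V → Set V'}
    {bb : I → Bool} (hτ : Function.Injective τ)
    (hν : Mod r b G lab X τ G' lab' X' τ' ν)
    (hM : ∀ i, Mod r (bb i) G lab (KK i) (T i) G' lab' (KK' i) (T' i) (M i))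
    (hTX : ∀ i j, T i j ∈ X ∪ Set.range τ)
    (hKX : ∀ i, Disjoint (KK i) (X ∪ Set.range τ))
    (hKK : ∀ i j, i ≠ j → Disjoint (KK i) (KK j))
    (hout : ∀ i, ∀ x ∈ KK i, ∀ y ∈ X ∪ Set.range τ, G.Adj x y → y ∈ Set.range (T i))
    (hsep : ∀ i j, i ≠ j → ¬ Tch G (KK i) (KK j))
    (hTν : ∀ i j, T' i j ∈ ν (T i j))
    (hKX' : ∀ i, Disjoint (KK' i) (X' ∪ Set.range τ'))
    (hKK' : ∀ i j, i ≠ j → Disjoint (KK' i) (KK' j))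
    (hout' : ∀ i, ∀ x ∈ KK' i, ∀ y ∈ X' ∪ Set.range τ', G'.Adj x y → y ∈ Set.range (T' i))
    (hsep' : ∀ i j, i ≠ j → ¬ Tch G' (KK' i) (KK' j))
    (hlax : ∀ i, bb i = true → ∀ j j', j ≠ j' → G.Adj (T i j) (T i j') ∧
      (T i j ∉ Set.range τ ∨ T i j' ∉ Set.range τ)) :
    Mod r b G lab (X ∪ ⋃ i, KK i) τ G' lab' (X' ∪ ⋃ i, KK' i) τ'
      (glueBag X τ ν KK T KK' M) := by
  have hT'Y : ∀ i j, T' i j ∈ X' ∪ Set.range τ' := fun i j => hν.bag_sub (hTX i j) (hTν i j)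
  have hTK' : ∀ i j, T' i j ∉ KK' i := fun i j h =>
    Set.disjoint_left.1 (hKX' i) h (hT'Y i j)
  have sub_glue : ∀ i a, a ∈ KK i ∪ Set.range (T i) → M i a ⊆ glueBag X τ ν KK T KK' M a := by
    intro i a ha x hx
    by_cases hxK : x ∈ KK' i
    · exact Or.inr ⟨i, ha, hx, hxK⟩
    · rcases ha with ha | ⟨j, rfl⟩
      · exact absurd ((hM i).sub a ha hx) hxK
      · have : x = T' i j := ((hM i).subT j hx).resolve_left hxK
        subst this
        exact Or.inl ⟨hTX i j, hTν i j⟩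
  have bag_core : ∀ a ∈ X ∪ Set.range τ, ν a ⊆ glueBag X τ ν KK T KK' M a :=
    fun a ha x hx => Or.inl ⟨ha, hx⟩
  have same : ∀ i a c x y, a ∈ KK i ∪ Set.range (T i) → c ∈ KK i ∪ Set.range (T i) →
      a ≠ c → x ∈ M i a → y ∈ M i c → G'.Adj x y → (x ∈ KK' i ∨ y ∈ KK' i) →
      G.Adj a c ∧ (a ∉ Set.range τ ∨ c ∉ Set.range τ) := by
    intro i a c x y ha hc hac hx hy hxy hK
    by_cases haK : a ∈ KK i ∨ c ∈ KK i
    · refine ⟨((hM i).adj' ha hc haK hac).1 ⟨x, hx, y, hy, hxy⟩, ?_⟩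
      rcases haK with h | h
      · exact Or.inl fun h' => Set.disjoint_left.1 (hKX i) h (Or.inr h')
      · exact Or.inr fun h' => Set.disjoint_left.1 (hKX i) h (Or.inr h')
    · push Not at haK
      obtain ⟨j, rfl⟩ := ha.resolve_left haK.1
      obtain ⟨j', rfl⟩ := hc.resolve_left haK.2
      have hjj : j ≠ j' := fun e => hac (e ▸ rfl)
      cases hb : bb i with
      | true => exact hlax i hb j j' hjj
      | false =>
        obtain ⟨rfl, rfl⟩ := (hM i).adjT hb j j' hjj x hx y hy hxy
        rcases hK with h | h
        · exact absurd h (hTK' i j)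
        · exact absurd h (hTK' i j')
  have mixed : ∀ i a c x y, a ∈ X ∪ Set.range τ → x ∈ ν a → c ∈ KK i ∪ Set.range (T i) →
      y ∈ M i c → y ∈ KK' i → G'.Adj x y → a ∈ KK i ∪ Set.range (T i) ∧ x ∈ M i a := by
    intro i a c x y ha hx hc hy hyK hxy
    obtain ⟨j, rfl⟩ := hout' i y hyK x (hν.bag_sub ha hx) hxy.symm
    have : a = T i j := hν.eq_of_mem ha (hTX i j) hx (hTν i j)
    subst this
    exact ⟨Or.inr ⟨j, rfl⟩, (hM i).memT j⟩
  have edge : ∀ a c x y, a ≠ c → x ∈ glueBag X τ ν KK T KK' M a →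
      y ∈ glueBag X τ ν KK T KK' M c → G'.Adj x y →
      (a ∈ X ∪ Set.range τ ∧ c ∈ X ∪ Set.range τ ∧ x ∈ ν a ∧ y ∈ ν c) ∨
      (G.Adj a c ∧ (a ∉ Set.range τ ∨ c ∉ Set.range τ)) := by
    rintro a c x y hac (⟨ha, hx⟩ | ⟨i, ha, hx, hxK⟩) (⟨hc, hy⟩ | ⟨j, hc, hy, hyK⟩) hxy
    · exact Or.inl ⟨ha, hc, hx, hy⟩
    · obtain ⟨ha', hx'⟩ := mixed j a c x y ha hx hc hy hyK hxy
      exact Or.inr (same j a c x y ha' hc hac hx' hy hxy (Or.inr hyK))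
    · obtain ⟨hc', hy'⟩ := mixed i c a y x hc hy ha hx hxK hxy.symm
      exact Or.inr (same i a c x y ha hc' hac hx hy' hxy (Or.inl hxK))
    · have hij : i = j := by
        by_contra hij
        exact hsep' i j hij ⟨x, hxK, y, hyK, hxy⟩
      subst hij
      exact Or.inr (same i a c x y ha hc hac hx hy hxy (Or.inl hxK))
  have mem_cases : ∀ a ∈ (X ∪ ⋃ i, KK i) ∪ Set.range τ, a ∈ X ∪ Set.range τ ∨
      ∃ i, a ∈ KK i := by
    rintro a ((h | h) | h)
    · exact Or.inl (Or.inl h)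
    · exact Or.inr (Set.mem_iUnion.1 h)
    · exact Or.inl (Or.inr h)
  have bag_piece : ∀ i, ∀ a ∈ KK i, glueBag X τ ν KK T KK' M a = M i a := by
    intro i a ha
    refine Set.Subset.antisymm ?_ (sub_glue i a (Or.inl ha))
    rintro x (⟨ha', -⟩ | ⟨j, ha', hx, -⟩)
    · exact absurd ha' (Set.disjoint_left.1 (hKX i) ha)
    · have hij : i = j := by
        by_contra hij
        rcases ha' with h | ⟨j', rfl⟩
        · exact Set.disjoint_left.1 (hKK i j hij) ha h
        · exact Set.disjoint_left.1 (hKX i) ha (hTX j j')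
      subst hij
      exact hx
  have inK : ∀ i, KK' i ⊆ X' ∪ ⋃ i, KK' i := fun i =>
    (Set.subset_iUnion KK' i).trans Set.subset_union_right
  refine ⟨?_, ?_, fun i => bag_core _ (Or.inr ⟨i, rfl⟩) (hν.memT i), ?_, ?_, ?_, ?_, ?_⟩
  · rintro a (ha | ha)
    · rintro x (⟨-, hx⟩ | ⟨i, -, -, hx⟩)
      · exact Or.inl (hν.sub a ha hx)
      · exact inK i hx
    · obtain ⟨i, hi⟩ := Set.mem_iUnion.1 ha
      rw [bag_piece i a hi]
      exact ((hM i).sub a hi).trans (inK i)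
  · rintro i x (⟨-, hx⟩ | ⟨j, -, -, hx⟩)
    · rcases hν.subT i hx with h | h
      · exact Or.inl (Or.inl h)
      · exact Or.inr h
    · exact Or.inl (inK j hx)
  · intro a ha
    rcases mem_cases a ha with ha | ⟨i, ha⟩
    · have : glueBag X τ ν KK T KK' M a = ν a ∪ glueBag X τ ν KK T KK' M a :=
        (Set.union_eq_self_of_subset_left (bag_core a ha)).symm
      rw [this]
      refine (hν.cn a ha).star ?_
      rintro x (⟨-, hx⟩ | ⟨i, hai, hx, hxK⟩)
      · exact ⟨ν a, Set.subset_union_left, hν.cn a ha, hx, x, hx, hx⟩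
      · refine ⟨M i a, (sub_glue i a hai).trans Set.subset_union_right, (hM i).cn a hai, hx, ?_⟩
        rcases hai with h | ⟨j, rfl⟩
        · exact absurd ha (Set.disjoint_left.1 (hKX i) h)
        · exact ⟨T' i j, (hM i).memT j, hTν i j⟩
    · rw [bag_piece i a ha]
      exact (hM i).cn a (Or.inl ha)
  · intro a _ c _ hac
    rw [Set.disjoint_left]
    rintro x (⟨ha, hx⟩ | ⟨i, ha, hx, hxK⟩) (⟨hc, hy⟩ | ⟨j, hc, hy, hyK⟩)
    · exact hac (hν.eq_of_mem ha hc hx hy)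
    · exact Set.disjoint_left.1 (hKX' j) hyK (hν.bag_sub ha hx)
    · exact Set.disjoint_left.1 (hKX' i) hxK (hν.bag_sub hc hy)
    · have hij : i = j := by
        by_contra hij
        exact Set.disjoint_left.1 (hKK' i j hij) hxK hyK
      subst hij
      exact hac ((hM i).eq_of_mem ha hc hx hy)
  · intro a ha c hc hac
    constructor
    · rintro ⟨x, hx, y, hy, hxy⟩
      rcases edge a c x y hac hx hy hxy with ⟨ha', hc', hx', hy'⟩ | h
      · rcases ha with ha | ha
        · exact (hν.adj a ha c hc' hac).1 ⟨x, hx', y, hy', hxy⟩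
        · obtain ⟨i, hi⟩ := Set.mem_iUnion.1 ha
          exact absurd ha' (Set.disjoint_left.1 (hKX i) hi)
      · exact h.1
    · intro hadj
      rcases mem_cases a (Or.inl ha) with ha' | ⟨i, ha'⟩ <;>
        rcases mem_cases c hc with hc' | ⟨j, hc'⟩
      · rcases ha with ha | ha
        · exact ((hν.adj a ha c hc' hac).2 hadj).mono (bag_core a ha') (bag_core c hc')
        · obtain ⟨i, hi⟩ := Set.mem_iUnion.1 ha
          exact absurd ha' (Set.disjoint_left.1 (hKX i) hi)
      · have haT := hout j c hc' a ha' hadj.symm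
        exact (((hM j).adj' (Or.inr haT) (Or.inl hc') (Or.inr hc') hac).2 hadj).mono
          (sub_glue j a (Or.inr haT)) (sub_glue j c (Or.inl hc'))
      · have hcT := hout i a ha' c hc' hadj
        exact (((hM i).adj a ha' c (Or.inr hcT) hac).2 hadj).mono
          (sub_glue i a (Or.inl ha')) (sub_glue i c (Or.inr hcT))
      · have hij : i = j := by
          by_contra hij
          exact hsep i j hij ⟨a, ha', c, hc', hadj⟩
        subst hij
        exact (((hM i).adj a ha' c (Or.inl hc') hac).2 hadj).mono
          (sub_glue i a (Or.inl ha')) (sub_glue i c (Or.inl hc'))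
  · intro hb i j hij x hx y hy hxy
    rcases edge _ _ x y (hτ.ne hij) hx hy hxy with ⟨-, -, hx', hy'⟩ | h
    · exact hν.adjT hb i j hij x hx' y hy' hxy
    · exact absurd h.2 (by simp)
  · rintro a (ha | ha)
    · obtain ⟨x, hx, h⟩ := hν.lab a ha
      exact ⟨x, bag_core a (Or.inl ha) hx, h⟩
    · obtain ⟨i, hi⟩ := Set.mem_iUnion.1 ha
      rw [bag_piece i a hi]
      exact (hM i).lab a hi

/-- A part `K` of a finite labelled graph, together with terminals outside of `K`. -/
structure Piece (Q : Type u) (k : ℕ) where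
  V : Type
  fin : Finite V
  G : SimpleGraph V
  lab : V → Q
  K : Set V
  τ : Fin k → V
  inj : Function.Injective τ
  notMem : ∀ i, τ i ∉ K

/-- The labelled induced minor relation on pieces. -/
def PLE (r : Q → Q → Prop) (b : Bool) (P P' : Piece Q k) : Prop :=
  ∃ μ, Mod r b P.G P.lab P.K P.τ P'.G P'.lab P'.K P'.τ μ

lemma PLE.refl (hr : ∀ q, r q q) (P : Piece Q k) : PLE r b P P := ⟨_, Mod.refl hr _ _ _ _⟩

lemma PLE.trans (hr : ∀ p q s, r p q → r q s → r p s) {P P' P'' : Piece Q k}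
    (h : PLE r b P P') (h' : PLE r b P' P'') : PLE r b P P'' := by
  obtain ⟨μ, hμ⟩ := h
  obtain ⟨μ', hμ'⟩ := h'
  exact ⟨_, hμ.trans hr P.inj hμ'⟩

end Models

section WqoTools

universe u v

variable {α : Type u} {β : Type v}

lemma pwo_good {S : Set α} {r : α → α → Prop} (h : S.PartiallyWellOrderedOn r) (f : ℕ → α)
    (hf : ∀ i, f i ∈ S) : ∃ i j, i < j ∧ r (f i) (f j) := by
  obtain ⟨m, n, hmn, h⟩ := h.exists_lt hf
  exact ⟨m, n, hmn, h⟩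

lemma pwo_of_good {S : Set α} {r : α → α → Prop}
    (h : ∀ f : ℕ → α, (∀ i, f i ∈ S) → ∃ i j, i < j ∧ r (f i) (f j)) :
    S.PartiallyWellOrderedOn r := by
  rw [Set.partiallyWellOrderedOn_iff_exists_lt]
  intro f hf
  obtain ⟨i, j, hij, h⟩ := h f hf
  exact ⟨i, j, hij, h⟩

lemma pwo_of_map {S : Set α} {T : Set β} {r : α → α → Prop} {r' : β → β → Prop} (f : α → β)
    (hT : T.PartiallyWellOrderedOn r') (hf : ∀ p ∈ S, f p ∈ T)
    (h : ∀ p ∈ S, ∀ p' ∈ S, r' (f p) (f p') → r p p') : S.PartiallyWellOrderedOn r := by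
  refine pwo_of_good fun g hg => ?_
  obtain ⟨i, j, hij, h'⟩ := pwo_good hT (f ∘ g) fun i => hf _ (hg i)
  exact ⟨i, j, hij, h _ (hg i) _ (hg j) h'⟩

/-- A finite family of elements of `α`. -/
structure Fam (α : Type u) where
  I : Type
  fin : Finite I
  g : I → α

/-- Domination of finite families by an injection. -/
def FLE (r : α → α → Prop) (F F' : Fam α) : Prop :=
  ∃ φ : F.I → F'.I, Function.Injective φ ∧ ∀ i, r (F.g i) (F'.g (φ i))

instance (r : α → α → Prop) [IsPreorder α r] : IsPreorder (Fam α) (FLE r) where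
  refl F := ⟨id, Function.injective_id, fun i => refl_of r _⟩
  trans F F' F'' := by
    rintro ⟨φ, hφ, h⟩ ⟨ψ, hψ, h'⟩
    exact ⟨ψ ∘ φ, hψ.comp hφ, fun i => trans_of r (h i) (h' (φ i))⟩

/-- Higman's lemma for finite families. -/
lemma fam_pwo {S : Set α} {r : α → α → Prop} [IsPreorder α r] (h : S.PartiallyWellOrderedOn r) :
    {F : Fam α | ∀ i, F.g i ∈ S}.PartiallyWellOrderedOn (FLE r) := by
  have key : ∀ F : Fam α, ∃ n : ℕ, Nonempty (Fin n ≃ F.I) := fun F => by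
    have := F.fin
    exact ⟨Nat.card F.I, ⟨(Finite.equivFin F.I).symm⟩⟩
  choose n e using key
  have e' := fun F => (e F).some
  refine pwo_of_map (fun F => List.ofFn (F.g ∘ e' F))
    (Set.PartiallyWellOrderedOn.partiallyWellOrderedOn_sublistForall₂ r h) ?_ ?_
  · intro F hF x hx
    obtain ⟨i, rfl⟩ := (List.mem_ofFn' _ _).1 hx
    exact hF _
  · intro F _ F' _ hl
    obtain ⟨l, h1, h2⟩ := List.sublistForall₂_iff.1 hl
    obtain ⟨hlen, hget⟩ := List.forall₂_iff_get.1 h1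
    obtain ⟨f, hf⟩ := List.sublist_iff_exists_fin_orderEmbedding_get_eq.1 h2
    have l1 : (List.ofFn (F.g ∘ e' F)).length = n F := List.length_ofFn
    have l2 : (List.ofFn (F'.g ∘ e' F')).length = n F' := List.length_ofFn
    let c : Fin (n F) → Fin l.length := Fin.cast (by omega)
    let d : Fin (List.ofFn (F'.g ∘ e' F')).length → Fin (n F') := Fin.cast l2
    refine ⟨fun i => e' F' (d (f (c ((e' F).symm i)))), ?_, fun i => ?_⟩
    · intro i j hij
      have h1 := (e' F').injective hij
      have h2 := f.injective (Fin.cast_injective _ h1)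
      exact (e' F).symm.injective (Fin.cast_injective _ h2)
    · obtain ⟨j, rfl⟩ := (e' F).surjective i
      have h3 := hget j (by omega) (by omega)
      have h4 := hf (c j)
      have h5 : l.get ⟨j, by omega⟩ = l.get (c j) := rfl
      rw [h5, h4] at h3
      simpa [d, Fin.cast] using h3

/-- The minimal bad sequence argument of Nash-Williams. -/
lemma pwo_of_sub {R : α → α → Prop} (htr : ∀ a b c, R a b → R b c → R a c) {S : Set α}
    (rank : α → ℕ) (sub : α → α → Prop)
    (hsub : ∀ p ∈ S, ∀ c, sub c p → c ∈ S ∧ rank c < rank p ∧ R c p)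
    (h : ∀ f : ℕ → α, (∀ i, f i ∈ S) → {c | ∃ i, sub c (f i)}.PartiallyWellOrderedOn R →
      ∃ i j, i < j ∧ R (f i) (f j)) : S.PartiallyWellOrderedOn R := by
  rw [Set.PartiallyWellOrderedOn.iff_not_exists_isMinBadSeq rank]
  rintro ⟨f, ⟨hfS, hbad⟩, hmin⟩
  obtain ⟨i, j, hij, hR⟩ := h f hfS (by
    by_contra hD
    rw [Set.partiallyWellOrderedOn_iff_exists_lt] at hD
    push Not at hD
    obtain ⟨c, hc, hcbad⟩ := hD
    choose ix hix using hc
    obtain ⟨n0, hn0⟩ : ∃ n0, ∀ n, ix n0 ≤ ix n := by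
      have hne : (Set.range ix).Nonempty := ⟨_, 0, rfl⟩
      obtain ⟨n0, h0⟩ := Nat.sInf_mem hne
      exact ⟨n0, fun n => h0 ▸ Nat.sInf_le ⟨n, rfl⟩⟩
    have hcS := fun n => hsub _ (hfS (ix n)) _ (hix n)
    refine hmin (ix n0) (fun n => if n < ix n0 then f n else c (n0 + (n - ix n0)))
      (fun m hm => by simp [hm]) (by simpa using (hcS n0).2.1) ⟨fun n => ?_, fun m n hmn => ?_⟩
    · dsimp only
      split_ifs
      · exact hfS n
      · exact (hcS _).1
    · dsimp only
      split_ifs with h1 h2 h2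
      · exact hbad m n hmn
      · intro hR
        exact hbad m (ix (n0 + (n - ix n0))) (h1.trans_le (hn0 _))
          (htr _ _ _ hR (hcS _).2.2)
      · omega
      · exact hcbad _ _ (by omega))
  exact hbad i j hij hR

/-- Families tagged by a Boolean, compared by the relation selected by the tag. -/
def BLE (R : Bool → α → α → Prop) (x y : Bool × Fam α) : Prop :=
  x.1 = y.1 ∧ FLE (R x.1) x.2 y.2

instance (R : Bool → α → α → Prop) [∀ b, IsPreorder α (R b)] :
    IsPreorder (Bool × Fam α) (BLE R) where
  refl x := ⟨rfl, refl_of (FLE (R x.1)) _⟩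
  trans := by
    rintro ⟨b, F⟩ ⟨b', F'⟩ ⟨b'', F''⟩ ⟨h1, h2⟩ ⟨h3, h4⟩
    dsimp only at h1 h2 h3 h4
    subst h1 h3
    exact ⟨rfl, trans_of (FLE (R b)) h2 h4⟩

lemma boolFam_pwo {R : Bool → α → α → Prop} [∀ b, IsPreorder α (R b)] {D : Bool → Set α}
    (hD : ∀ b, (D b).PartiallyWellOrderedOn (R b)) :
    {x : Bool × Fam α | ∀ i, x.2.g i ∈ D x.1}.PartiallyWellOrderedOn (BLE R) := by
  have key : ∀ b, {x : Bool × Fam α | x.1 = b ∧ ∀ i, x.2.g i ∈ D b}.PartiallyWellOrderedOn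
      (BLE R) := fun b => by
    refine pwo_of_map Prod.snd (fam_pwo (hD b)) (fun p hp => hp.2) ?_
    rintro ⟨_, F⟩ ⟨rfl, _⟩ ⟨_, F'⟩ ⟨rfl, _⟩ h
    exact ⟨rfl, h⟩
  refine ((key true).union (key false)).mono ?_
  rintro ⟨b, F⟩ h
  cases b
  · exact Or.inr ⟨rfl, h⟩
  · exact Or.inl ⟨rfl, h⟩

/-- Well-quasi-ordering of structures recursively decomposed into two families of substructures,
for a strict relation `R false` and a lax relation `R true`. -/
theorem pwo_of_decomp {R : Bool → α → α → Prop} [∀ b, IsPreorder α (R b)]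
    (hR : ∀ p p', R false p p' → R true p p') {S : Set α} (rank : α → ℕ) {T : Set β}
    {rq : β → β → Prop} (hT : T.PartiallyWellOrderedOn rq)
    (d : α → Bool → Bool × Fam α) (q : α → β) (hq : ∀ p ∈ S, q p ∈ T)
    (hchild : ∀ p ∈ S, ∀ s i, (d p s).2.g i ∈ S ∧ rank ((d p s).2.g i) < rank p ∧
      R true ((d p s).2.g i) p ∧ ((d p s).1 = false → R false ((d p s).2.g i) p))
    (hcomp : ∀ p ∈ S, ∀ p' ∈ S, rq (q p) (q p') → (∀ s, BLE R (d p s) (d p' s)) →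
      R false p p') : S.PartiallyWellOrderedOn (R false) := by
  have tuple : ∀ (D : Bool → Set α), (∀ b, (D b).PartiallyWellOrderedOn (R b)) →
      ∀ S' ⊆ S, (∀ p ∈ S', ∀ s i, (d p s).2.g i ∈ D (d p s).1) →
      S'.PartiallyWellOrderedOn (R false) := by
    intro D hD S' hS' h
    have hB := boolFam_pwo hD
    refine pwo_of_map (fun p => ((d p true), (d p false), q p)) (hB.prod (hB.prod hT))
      (fun p hp => ⟨h p hp true, h p hp false, hq p (hS' hp)⟩) ?_
    rintro p hp p' hp' ⟨h1, h2, h3⟩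
    refine hcomp p (hS' hp) p' (hS' hp') h3 fun s => ?_
    cases s
    · exact h2
    · exact h1
  have inner : ∀ D ⊆ S, (∀ p ∈ D, ∀ s i, (d p s).2.g i ∈ D) →
      D.PartiallyWellOrderedOn (R true) → D.PartiallyWellOrderedOn (R false) := by
    intro D hDS hcl hD
    refine pwo_of_sub (R := R false) (fun _ _ _ h h' => trans_of (R false) h h') rank
      (fun c p => ∃ s i, (d p s).1 = false ∧ c = (d p s).2.g i) ?_ ?_
    · rintro p hp _ ⟨s, i, hs, rfl⟩
      obtain ⟨h1, h2, h3, h4⟩ := hchild p (hDS hp) s i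
      exact ⟨hcl p hp s i, h2, h4 hs⟩
    · intro f hf hc
      refine pwo_good (tuple (fun b => if b then D else
        {c | ∃ i s j, (d (f i) s).1 = false ∧ c = (d (f i) s).2.g j}) ?_ (Set.range f) ?_ ?_) f
        fun i => ⟨i, rfl⟩
      · rintro (_ | _)
        · exact hc
        · exact hD
      · rintro _ ⟨i, rfl⟩
        exact hDS (hf i)
      · rintro _ ⟨i, rfl⟩ s j
        cases hb : (d (f i) s).1
        · exact ⟨i, s, j, hb, rfl⟩
        · exact hcl _ (hf i) s j
  refine inner S subset_rfl (fun p hp s i => (hchild p hp s i).1) ?_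
  have desc : ∀ c p, Relation.TransGen (fun c p => p ∈ S ∧ ∃ s i, c = (d p s).2.g i) c p →
      p ∈ S → c ∈ S ∧ rank c < rank p ∧ R true c p := by
    intro c p h
    induction h with
    | single h =>
      obtain ⟨hp, s, i, rfl⟩ := h
      obtain ⟨h1, h2, h3, -⟩ := hchild _ hp s i
      exact fun _ => ⟨h1, h2, h3⟩
    | tail _ h ih =>
      obtain ⟨hp, s, i, rfl⟩ := h
      obtain ⟨h1, h2, h3, -⟩ := hchild _ hp s i
      obtain ⟨h4, h5, h6⟩ := ih h1
      exact fun _ => ⟨h4, h5.trans h2, trans_of (R true) h6 h3⟩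
  refine pwo_of_sub (R := R true) (fun _ _ _ h h' => trans_of (R true) h h') rank
    (Relation.TransGen (fun c p => p ∈ S ∧ ∃ s i, c = (d p s).2.g i))
    (fun p hp c hc => desc c p hc hp) ?_
  intro f hf hD
  have hDS : {c | ∃ i, Relation.TransGen (fun c p => p ∈ S ∧ ∃ s i, c = (d p s).2.g i) c (f i)}
      ⊆ S := by
    rintro c ⟨i, hc⟩
    exact (desc c _ hc (hf i)).1
  have hD0 := inner _ hDS (by
    rintro p ⟨i, hp⟩ s j
    exact ⟨i, .head ⟨hDS ⟨i, hp⟩, s, j, rfl⟩ hp⟩) hD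
  obtain ⟨i, j, hij, h⟩ := pwo_good (tuple (fun _ =>
      {c | ∃ i, Relation.TransGen (fun c p => p ∈ S ∧ ∃ s i, c = (d p s).2.g i) c (f i)})
    (by rintro (_ | _) <;> assumption) (Set.range f) (by rintro _ ⟨i, rfl⟩; exact hf i)
    (by rintro _ ⟨i, rfl⟩ s j; exact ⟨i, .single ⟨hf i, s, j, rfl⟩⟩)) f fun i => ⟨i, rfl⟩
  exact ⟨i, j, hij, hR _ _ h⟩

end WqoTools

section PieceOrder

universe u

variable {Q : Type u} {k : ℕ}

instance (r : Q → Q → Prop) [IsPreorder Q r] (b : Bool) :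
    IsPreorder (Piece Q k) (PLE r b) where
  refl P := PLE.refl (fun q => refl_of r q) P
  trans _ _ _ := PLE.trans (r := r) fun _ _ _ h h' => trans_of r h h'

lemma PLE.lax {r : Q → Q → Prop} {b : Bool} {P P' : Piece Q k} (h : PLE r b P P') :
    PLE r true P P' :=
  ⟨_, h.choose_spec.lax⟩

end PieceOrder

section Ears

variable {V : Type} {G : SimpleGraph V}

/-- `L` is connected, disjoint from `B` and has at least two neighbours in `B`. -/
structure IsEar (G : SimpleGraph V) (B L : Set V) : Prop where
  cn : Cn G L
  disj : Disjoint L B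
  two : ∃ b ∈ B, ∃ b' ∈ B, b ≠ b' ∧ Tch G L {b} ∧ Tch G L {b'}

lemma tch_singleton_right {A : Set V} {b : V} : Tch G A {b} ↔ ∃ x ∈ A, G.Adj x b := by
  simp [Tch]

lemma IsEar.exists_minimal [Finite V] {B L : Set V} (h : IsEar G B L) :
    ∃ L' ⊆ L, Minimal (IsEar G B) L' := by
  obtain ⟨L', h1, h2⟩ := (Set.toFinite {L | IsEar G B L}).exists_le_minimal h
  exact ⟨L', h1, h2⟩

lemma IsEar.noCut {B L : Set V} (hB : NoCut G B) (h : Minimal (IsEar G B) L) :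
    NoCut G (B ∪ L) := by
  obtain ⟨b, hb, b', hb', hbb, h1, h2⟩ := h.1.two
  obtain ⟨p, hp, q, hq, hpq⟩ := hB.two
  have hd := h.1.disj
  refine ⟨hB.cn.union h.1.cn (h1.symm.mono (Set.singleton_subset_iff.2 hb) subset_rfl),
    ⟨p, Or.inl hp, q, Or.inl hq, hpq⟩, fun c => ?_⟩
  by_cases hcB : c ∈ B
  · have : (B ∪ L) \ {c} = (B \ {c}) ∪ L := by
      rw [Set.union_sdiff_distrib, Set.sdiff_singleton_eq_self (Set.disjoint_right.1 hd hcB)]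
    rw [this]
    refine (hB.del c).union h.1.cn ?_
    by_cases hcb : c = b
    · exact h2.symm.mono (Set.singleton_subset_iff.2 ⟨hb', fun e => hbb (hcb ▸ e.symm)⟩) subset_rfl
    · exact h1.symm.mono (Set.singleton_subset_iff.2 ⟨hb, fun e => hcb e.symm⟩) subset_rfl
  by_cases hcL : c ∈ L
  · have : (B ∪ L) \ {c} = B ∪ (L \ {c}) := by
      rw [Set.union_sdiff_distrib, Set.sdiff_singleton_eq_self hcB]
    rw [this]
    refine hB.cn.union_of fun Y hY ⟨y, hy⟩ _ hcl => ?_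
    by_contra hYB
    have hcn : Cn G (L \ Y) := h.1.cn.diff_closed (cn_singleton c)
      (Set.singleton_subset_iff.2 hcL) hY hcl
    have keep : ∀ d ∈ B, Tch G L {d} → Tch G (L \ Y) {d} := by
      intro d hd' hLd
      obtain ⟨x, hx, hxd⟩ := tch_singleton_right.1 hLd
      exact tch_singleton_right.2 ⟨x, ⟨hx, fun hxY => hYB ⟨x, hxY, d, hd', hxd⟩⟩, hxd⟩
    exact (h.2 ⟨hcn, hd.mono_left Set.sdiff_subset, b, hb, b', hb', hbb, keep b hb h1,
      keep b' hb' h2⟩ Set.sdiff_subset (hY hy).1).2 hy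
  · rw [Set.sdiff_singleton_eq_self (by simp [hcB, hcL])]
    exact hB.cn.union h.1.cn (h1.symm.mono (Set.singleton_subset_iff.2 hb) subset_rfl)

/-- The part of `U \ B` attached at the vertex `b`. -/
def hang (G : SimpleGraph V) (U B : Set V) (b : V) : Set V :=
  {x | x ∈ U \ B ∧ Tch G (cmp G (U \ B) x) {b}}

lemma hang_sub {U B : Set V} {b : V} : hang G U B b ⊆ U \ B := fun _ h => h.1

lemma hang_closed {U B : Set V} {b x y : V} (hx : x ∈ hang G U B b) (hy : y ∈ U \ B)
    (h : G.Adj x y) : y ∈ hang G U B b := by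
  refine ⟨hy, ?_⟩
  have : cmp G (U \ B) y = cmp G (U \ B) x := (cmp_isComp hy).eq (cmp_isComp hx.1)
    ⟨y, mem_cmp hy, (cmp_isComp hx.1).closed x (mem_cmp hx.1) y hy h⟩
  rw [this]
  exact hx.2

lemma exists_hang {U B : Set V} (hU : Cn G U) (hB : B.Nonempty) (hBU : B ⊆ U) {x : V}
    (hx : x ∈ U \ B) : ∃ b ∈ B, x ∈ hang G U B b := by
  obtain ⟨b, hb⟩ := hB
  obtain ⟨y, hy, c, hc, hyc⟩ := (cmp_isComp (G := G) hx).tch hU ⟨b, hb, hBU hb⟩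
  exact ⟨c, hc.1, hx, tch_singleton_right.2 ⟨y, hy, hyc⟩⟩

variable {U B : Set V}

lemma hang_unique [Finite V] (hB : Maximal (fun B => NoCut G B ∧ B ⊆ U) B)
    {b b' x : V} (hb : b ∈ B) (hb' : b' ∈ B) (h : x ∈ hang G U B b)
    (h' : x ∈ hang G U B b') : b = b' := by
  by_contra hbb
  have hc := cmp_isComp (G := G) h.1
  have hear : IsEar G B (cmp G (U \ B) x) := ⟨hc.cn, Set.disjoint_left.2 fun y hy => (hc.sub hy).2,
    b, hb, b', hb', hbb, h.2, h'.2⟩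
  obtain ⟨L, hL, hmin⟩ := hear.exists_minimal
  obtain ⟨y, hy⟩ := hmin.1.cn.nonempty
  have := hB.2 ⟨IsEar.noCut hB.1.1 hmin, Set.union_subset hB.1.2
    (hL.trans (hc.sub.trans Set.sdiff_subset))⟩ Set.subset_union_left (Or.inr hy)
  exact (hc.sub (hL hy)).2 this

lemma hang_adj [Finite V] (hB : Maximal (fun B => NoCut G B ∧ B ⊆ U) B)
    {b b' x : V} (hb : b ∈ B) (h : x ∈ hang G U B b) (hb' : b' ∈ B)
    (hadj : G.Adj x b') : b' = b :=
  hang_unique hB hb' hb ⟨h.1, tch_singleton_right.2 ⟨x, mem_cmp h.1, hadj⟩⟩ h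

lemma hang_cn {b : V} : Cn G (hang G U B b ∪ {b}) := by
  rw [Set.union_comm]
  refine (cn_singleton b).star fun x hx => ⟨{b} ∪ cmp G (U \ B) x, ?_, ?_, Or.inr (mem_cmp hx.1),
    b, Or.inl rfl, rfl⟩
  · refine Set.union_subset_union_right _ fun y hy => ?_
    have hc := cmp_isComp (G := G) hx.1
    have hyU := hc.sub hy
    refine ⟨hyU, ?_⟩
    rw [(cmp_isComp hyU).eq hc ⟨y, mem_cmp hyU, hy⟩]
    exact hx.2
  · exact (cn_singleton b).union (cmp_isComp hx.1).cn hx.2.symm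

lemma hang_compl_cn [Finite V] (hB : Maximal (fun B => NoCut G B ∧ B ⊆ U) B)
    (hU : Cn G U) {b : V} (hb : b ∈ B) :
    Cn G (U \ hang G U B b) := by
  refine hU.diff_closed (cn_singleton b) (Set.singleton_subset_iff.2 (hB.1.2 hb))
    (fun x hx => ⟨hx.1.1, fun e => hx.1.2 (e ▸ hb)⟩) fun y hy z hz hyz => ?_
  by_cases hzB : z ∈ B
  · exact absurd (hang_adj hB hb hy hzB hyz) hz.2
  · exact hang_closed hy ⟨hz.1, hzB⟩ hyz

end Ears

section Blocks

variable {Q : Type 1} {r : Q → Q → Prop}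

/-- Turning terminals into ordinary vertices. -/
lemma Mod.forget {V V' : Type} {b b' : Bool} {G : SimpleGraph V} {lab : V → Q} {K : Set V}
    {τ : Fin 1 → V} {G' : SimpleGraph V'} {lab' : V' → Q} {K' : Set V'} {τ' : Fin 1 → V'}
    {μ : V → Set V'} (h : Mod r b G lab K τ G' lab' K' τ' μ) (hl : r (lab (τ 0)) (lab' (τ' 0)))
    (σ : Fin 0 → V) (σ' : Fin 0 → V') :
    Mod r b' G lab (K ∪ {τ 0}) σ G' lab' (K' ∪ {τ' 0}) σ' μ := by
  have hr : Set.range τ = {τ 0} := by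
    ext x
    simp [Fin.exists_fin_one, eq_comm]
  have hσ : Set.range σ = ∅ := Set.range_eq_empty σ
  have hc := h.cn
  have hd := h.disj
  rw [hr] at hc hd
  refine ⟨?_, fun i => i.elim0, fun i => i.elim0, ?_, ?_, ?_, fun _ i => i.elim0, ?_⟩
  · rintro a (ha | rfl)
    · exact (h.sub a ha).trans Set.subset_union_left
    · exact h.subT 0
  · simpa [hσ] using hc
  · simpa [hσ] using hd
  · intro a ha c hc hac
    rw [hσ, Set.union_empty] at hc
    rw [← hr] at ha hc
    by_cases hK : a ∈ K ∨ c ∈ K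
    · exact h.adj' ha hc hK hac
    · exfalso
      push Not at hK
      obtain ⟨i, rfl⟩ := ha.resolve_left hK.1
      obtain ⟨j, rfl⟩ := hc.resolve_left hK.2
      exact hac (by rw [Subsingleton.elim i j])
  · rintro a (ha | rfl)
    · exact h.lab a ha
    · exact ⟨_, h.memT 0, hl⟩

/-- The piece hanging at the vertex `b` of `B`. -/
def hangPiece (P : Piece Q 1) (B : Set P.V) (b : P.V) : Piece Q 1 where
  V := P.V
  fin := P.fin
  G := P.G
  lab := P.lab
  K := hang P.G (P.K ∪ {P.τ 0}) B b \ {b}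
  τ := fun _ => b
  inj := Function.injective_of_subsingleton _
  notMem := fun _ h => h.2 rfl

lemma hangPiece_K {P : Piece Q 1} {B : Set P.V} {b : P.V} (hb : b ∈ B) :
    (hangPiece P B b).K = hang P.G (P.K ∪ {P.τ 0}) B b :=
  Set.sdiff_singleton_eq_self fun h => h.1.2 hb

lemma range_fin_one {α : Type*} (τ : Fin 1 → α) : Set.range τ = {τ 0} := by
  ext x
  simp [Fin.exists_fin_one, eq_comm]

lemma hang_mod [IsPreorder Q r] {V : Type} [Finite V] {G : SimpleGraph V} {lab : V → Q} {K : Set V}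
    {τ : Fin 1 → V} (hU : Cn G (K ∪ {τ 0})) {B : Set V}
    (hB : Maximal (fun B => NoCut G B ∧ B ⊆ K ∪ {τ 0}) B) (hτ : τ 0 ∈ B) {b : V}
    (hb : b ∈ B) : ∃ μ, Mod r false G lab (hang G (K ∪ {τ 0}) B b) (fun _ : Fin 1 => b)
      G lab K τ μ := by
  classical
  have hbh : b ∉ hang G (K ∪ {τ 0}) B b := fun h => h.1.2 hb
  have hτh : τ 0 ∉ hang G (K ∪ {τ 0}) B b := fun h => h.1.2 hτ
  refine ⟨fun a => if a = b then (K ∪ {τ 0}) \ hang G (K ∪ {τ 0}) B b else {a}, ?_⟩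
  have hr : Set.range (fun _ : Fin 1 => b) = {b} := range_fin_one _
  have hne : ∀ a ∈ hang G (K ∪ {τ 0}) B b, a ≠ b := fun a ha e => hbh (e ▸ ha)
  refine ⟨?_, ?_, ?_, ?_, ?_, ?_, ?_, ?_⟩
  all_goals try rw [hr]
  · intro a ha
    rw [if_neg (hne a ha)]
    rintro _ rfl
    exact ha.1.1.resolve_right fun e => hτh (e ▸ ha)
  · intro i
    rw [Subsingleton.elim i 0, if_pos rfl]
    exact Set.sdiff_subset
  · intro i
    rw [Subsingleton.elim i 0, if_pos rfl]
    exact ⟨Or.inr rfl, hτh⟩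
  · intro a ha
    split_ifs with h
    · exact hang_compl_cn hB hU hb
    · exact cn_singleton a
  · intro a ha c hc hac
    split_ifs with h1 h2 h2
    · exact absurd (h1.trans h2.symm) hac
    · rw [Set.disjoint_singleton_right]
      exact fun h => h.2 (hc.resolve_right h2)
    · rw [Set.disjoint_singleton_left]
      exact fun h => h.2 (ha.resolve_right h1)
    · simpa using hac
  · intro a ha c hc hac
    rw [if_neg (hne a ha)]
    split_ifs with h1
    · subst h1
      constructor
      · rintro ⟨_, rfl, y, hy, hxy⟩
        by_cases hyB : y ∈ B
        · rw [← hang_adj hB hb ha hyB hxy]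
          exact hxy
        · exact absurd (hang_closed ha ⟨hy.1, hyB⟩ hxy) hy.2
      · exact fun h => ⟨a, rfl, c, ⟨hB.1.2 hb, hbh⟩, h⟩
    · simp [Tch]
  · intro _ i j hij
    exact absurd (Subsingleton.elim i j) hij
  · intro a ha
    rw [if_neg (hne a ha)]
    exact ⟨a, rfl, refl_of r _⟩

lemma hangPiece_le [IsPreorder Q r] (P : Piece Q 1) (hU : Cn P.G (P.K ∪ {P.τ 0})) {B : Set P.V}
    (hB : Maximal (fun B => NoCut P.G B ∧ B ⊆ P.K ∪ {P.τ 0}) B) (hτ : P.τ 0 ∈ B) {b : P.V}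
    (hb : b ∈ B) : PLE r false (hangPiece P B b) P := by
  have := P.fin
  obtain ⟨μ, h⟩ := hang_mod (r := r) (lab := P.lab) hU hB hτ hb
  refine ⟨μ, ?_⟩
  rw [hangPiece_K hb]
  exact h

lemma exists_block {V : Type} [Finite V] {G : SimpleGraph V} {U : Set V} (hU : Cn G U)
    {p a : V} (hp : p ∈ U) (ha : a ∈ U) (hap : a ≠ p) :
    ∃ B, Maximal (fun B => NoCut G B ∧ B ⊆ U) B ∧ p ∈ B := by
  obtain ⟨p', hp', y, hy, -, hpy⟩ := hU.exists_adj (X := {p}) (Set.singleton_subset_iff.2 hp)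
    ⟨p, rfl⟩ ha hap
  rw [Set.mem_singleton_iff.1 hp'] at hpy
  obtain ⟨B, h1, h2⟩ := (Set.toFinite {B : Set V | NoCut G B ∧ B ⊆ U}).exists_le_maximal
    (a := {p, y}) ⟨noCut_pair hpy, Set.insert_subset hp (Set.singleton_subset_iff.2 hy)⟩
  exact ⟨B, h2, h1 (Or.inl rfl)⟩

/-- The label of a vertex of a block: a root mark, the original label and the hanging piece. -/
noncomputable def blockLab (P : Piece Q 1) (B : Set P.V) (b : P.V) : Bool × Q × Piece Q 1 :=
  open Classical in (decide (b = P.τ 0), P.lab b, hangPiece P B b)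

/-- The order on block labels. -/
def BlockLE (r : Q → Q → Prop) (x y : Bool × Q × Piece Q 1) : Prop :=
  x.1 = y.1 ∧ r x.2.1 y.2.1 ∧ PLE r false x.2.2 y.2.2

instance [IsPreorder Q r] : IsPreorder (Bool × Q × Piece Q 1) (BlockLE r) where
  refl _ := ⟨rfl, refl_of r _, refl_of (PLE r false) _⟩
  trans _ _ _ h h' := ⟨h.1.trans h'.1, trans_of r h.2.1 h'.2.1,
    trans_of (PLE r false) h.2.2 h'.2.2⟩

lemma block_compose {P P' : Piece Q 1} (hU : Cn P.G (P.K ∪ {P.τ 0})) {B : Set P.V}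
    (hB : Maximal (fun B => NoCut P.G B ∧ B ⊆ P.K ∪ {P.τ 0}) B) (hτ : P.τ 0 ∈ B) {B' : Set P'.V}
    (hB' : Maximal (fun B => NoCut P'.G B ∧ B ⊆ P'.K ∪ {P'.τ 0}) B') (hτ' : P'.τ 0 ∈ B')
    {σ : Fin 0 → P.V} {σ' : Fin 0 → P'.V} {ν : P.V → Set P'.V}
    (hν : Mod (BlockLE r) false P.G (blockLab P B) B σ P'.G (blockLab P' B') B' σ' ν) :
    PLE r false P P' := by
  have := P.fin
  have := P'.fin
  have hσ : Set.range σ = ∅ := Set.range_eq_empty σ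
  have hXB : (B \ {P.τ 0}) ∪ Set.range P.τ = B := by
    rw [range_fin_one]
    exact Set.sdiff_union_of_subset (Set.singleton_subset_iff.2 hτ)
  have hXB' : (B' \ {P'.τ 0}) ∪ Set.range P'.τ = B' := by
    rw [range_fin_one]
    exact Set.sdiff_union_of_subset (Set.singleton_subset_iff.2 hτ')
  have hcn := hν.cn
  have hdisj := hν.disj
  have hadj := hν.adj
  rw [hσ, Set.union_empty] at hcn hdisj hadj
  have : Nonempty P'.V := ⟨P'.τ 0⟩
  choose! x hx hxl using hν.lab
  have hroot : x (P.τ 0) = P'.τ 0 := by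
    have := (hxl _ hτ).1
    simpa [blockLab, eq_comm] using this
  have hxr : P'.τ 0 ∈ ν (P.τ 0) := hroot ▸ hx _ hτ
  have hcore : Mod r false P.G P.lab (B \ {P.τ 0}) P.τ P'.G P'.lab (B' \ {P'.τ 0}) P'.τ ν := by
    refine ⟨?_, ?_, ?_, ?_, ?_, ?_, ?_, ?_⟩
    · intro a ha y hy
      refine ⟨hν.sub a ha.1 hy, fun e => ?_⟩
      rw [Set.mem_singleton_iff] at e
      subst e
      exact Set.disjoint_left.1 (hdisj a ha.1 _ hτ ha.2) hy hxr
    · intro i y hy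
      rw [Subsingleton.elim i 0] at hy ⊢
      rw [Set.sdiff_union_of_subset (Set.singleton_subset_iff.2 hτ')]
      exact hν.sub _ hτ hy
    · intro i
      rw [Subsingleton.elim i 0]
      exact hxr
    · rwa [hXB]
    · rwa [hXB]
    · rw [hXB]
      exact fun a ha => hadj a ha.1
    · exact fun _ i j hij => absurd (Subsingleton.elim i j) hij
    · exact fun a ha => ⟨x a, hx a ha.1, (hxl a ha.1).2.1⟩
  have hxB : ∀ a ∈ B, x a ∈ B' := fun a ha => hν.sub a ha (hx a ha)
  have hxinj : ∀ a ∈ B, ∀ c ∈ B, a ≠ c → x a ≠ x c := fun a ha c hc hac e =>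
    Set.disjoint_left.1 (hdisj a ha c hc hac) (hx a ha) (e ▸ hx c hc)
  choose! M hM using fun a (ha : a ∈ B) => (hxl a ha).2.2
  let U := P.K ∪ {P.τ 0}
  let U' := P'.K ∪ {P'.τ 0}
  have hglue := Mod.glue (I := B) (KK := fun a => hang P.G U B a) (T := fun a _ => (a : P.V))
    (KK' := fun a => hang P'.G U' B' (x a)) (T' := fun a (_ : Fin 1) => x a) (M := fun a => M a)
    (bb := fun _ => false) P.inj hcore
    (fun a => by
      have := hM a a.2
      simp only [blockLab] at this
      rw [hangPiece_K a.2, hangPiece_K (hxB a a.2)] at this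
      exact this)
    (by rw [hXB]; exact fun a _ => a.2)
    (by rw [hXB]; exact fun a => Set.disjoint_left.2 fun y hy => hy.1.2)
    (fun a c hac => Set.disjoint_left.2 fun y hy hy' =>
      hac (Subtype.ext (hang_unique hB a.2 c.2 hy hy')))
    (by
      rw [hXB]
      exact fun a y hy z hz hyz => ⟨0, (hang_adj hB a.2 hy hz hyz).symm⟩)
    (by
      rintro a c hac ⟨y, hy, z, hz, hyz⟩
      exact hac (Subtype.ext (hang_unique hB a.2 c.2 (hang_closed hy hz.1 hyz) hz)))
    (fun a _ => hx a a.2)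
    (by rw [hXB']; exact fun a => Set.disjoint_left.2 fun y hy => hy.1.2)
    (fun a c hac => Set.disjoint_left.2 fun y hy hy' =>
      hxinj a a.2 c c.2 (fun e => hac (Subtype.ext e))
        (hang_unique hB' (hxB a a.2) (hxB c c.2) hy hy'))
    (by
      rw [hXB']
      exact fun a y hy z hz hyz => ⟨0, (hang_adj hB' (hxB a a.2) hy hz hyz).symm⟩)
    (by
      rintro a c hac ⟨y, hy, z, hz, hyz⟩
      exact hxinj a a.2 c c.2 (fun e => hac (Subtype.ext e))
        (hang_unique hB' (hxB a a.2) (hxB c c.2) (hang_closed hy hz.1 hyz) hz))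
    (by simp)
  have hK : (B \ {P.τ 0}) ∪ ⋃ a : B, hang P.G U B a = P.K := by
    ext y
    constructor
    · rintro (hy | hy)
      · exact (hB.1.2 hy.1).resolve_right hy.2
      · obtain ⟨a, ha⟩ := Set.mem_iUnion.1 hy
        exact ha.1.1.resolve_right fun e => ha.1.2 (by rw [e]; exact hτ)
    · intro hy
      by_cases hyB : y ∈ B
      · exact Or.inl ⟨hyB, fun e => P.notMem 0 (e ▸ hy)⟩
      · obtain ⟨a, ha, hya⟩ := exists_hang hU ⟨_, hτ⟩ hB.1.2 ⟨Or.inl hy, hyB⟩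
        exact Or.inr (Set.mem_iUnion.2 ⟨⟨a, ha⟩, hya⟩)
  rw [hK] at hglue
  refine ⟨_, hglue.mono_target ?_⟩
  rintro y (hy | hy)
  · exact (hB'.1.2 hy.1).resolve_right hy.2
  · obtain ⟨a, ha⟩ := Set.mem_iUnion.1 hy
    exact ha.1.1.resolve_right fun e => ha.1.2 (by rw [e]; exact hτ')

/-- A predicate on vertex sets of graphs whose labelled members are well-quasi-ordered. -/
def LabelledPwo (ℬ : ∀ V : Type, SimpleGraph V → Set V → Prop) : Prop :=
  ∀ (Q : Type 1) (r : Q → Q → Prop) [IsPreorder Q r] (S : Set Q), S.PartiallyWellOrderedOn r →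
    {P : Piece Q 0 | (ℬ P.V P.G P.K) ∧ ∀ a ∈ P.K, P.lab a ∈ S}.PartiallyWellOrderedOn
      (PLE r false)

/-- Connected rooted pieces all of whose blocks satisfy `ℬ`. -/
def Rooted (ℬ : ∀ V : Type, SimpleGraph V → Set V → Prop) (S : Set Q) : Set (Piece Q 1) :=
  {P | Cn P.G (P.K ∪ {P.τ 0}) ∧ (∀ B ⊆ P.K ∪ {P.τ 0}, NoCut P.G B → ℬ P.V P.G B) ∧
    ∀ a ∈ P.K ∪ {P.τ 0}, P.lab a ∈ S}

lemma rooted_pwo [IsPreorder Q r] {ℬ : ∀ V : Type, SimpleGraph V → Set V → Prop}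
    (hℬ : LabelledPwo ℬ) {S : Set Q} (hS : S.PartiallyWellOrderedOn r) :
    (Rooted ℬ S).PartiallyWellOrderedOn (PLE r false) := by
  refine pwo_of_sub (R := PLE r false) (S := Rooted ℬ S) (fun _ _ _ h h' => trans_of (PLE r false) h h') (fun P => P.K.ncard)
    (fun c p => c ∈ Rooted ℬ S ∧ c.K.ncard < p.K.ncard ∧ PLE r false c p)
    (fun _ _ _ h => h) fun f hf hD => ?_
  by_cases hemp : ∃ i, (f i).K = ∅
  · obtain ⟨i, hi⟩ := hemp
    refine ⟨i, i + 1, by omega, fun _ => {(f (i + 1)).τ 0}, ?_⟩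
    have hs : ∀ a ∈ (f i).K ∪ Set.range (f i).τ, a = (f i).τ 0 := by
      rw [hi, range_fin_one]
      rintro a (ha | ha)
      · exact ha.elim
      · exact ha
    refine ⟨?_, ?_, ?_, fun a _ => cn_singleton _, ?_, ?_, ?_, ?_⟩
    · simp [hi]
    · intro j
      rw [Subsingleton.elim j 0]
      exact Set.subset_union_right
    · intro j
      rw [Subsingleton.elim j 0]
      rfl
    · exact fun a ha c hc hac => absurd ((hs a ha).trans (hs c hc).symm) hac
    · simp [hi]
    · exact fun _ i j hij => absurd (Subsingleton.elim i j) hij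
    · simp [hi]
  push Not at hemp
  have hblock : ∀ i, ∃ B, Maximal (fun B => NoCut (f i).G B ∧ B ⊆ (f i).K ∪ {(f i).τ 0}) B ∧
      (f i).τ 0 ∈ B := by
    intro i
    have := (f i).fin
    obtain ⟨a, ha⟩ := hemp i
    exact exists_block (hf i).1 (Or.inr rfl) (Or.inl ha) fun e => (f i).notMem 0 (e ▸ ha)
  choose B hB hτ using hblock
  let D := {c | ∃ i, c ∈ Rooted ℬ S ∧ c.K.ncard < (f i).K.ncard ∧ PLE r false c (f i)}
  have hBool : (Set.univ : Set Bool).PartiallyWellOrderedOn Eq :=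
    Set.finite_univ.partiallyWellOrderedOn
  have hS' : (Set.univ ×ˢ (S ×ˢ D)).PartiallyWellOrderedOn (BlockLE r) :=
    hBool.prod (hS.prod hD)
  let g : ℕ → Piece (Bool × Q × Piece Q 1) 0 := fun i =>
    ⟨(f i).V, (f i).fin, (f i).G, blockLab (f i) (B i), B i, Fin.elim0, fun i => i.elim0,
      fun i => i.elim0⟩
  have hD : ∀ i, ∀ b ∈ B i, hangPiece (f i) (B i) b ∈ D := by
    intro i b hb
    have := (f i).fin
    have hU : (hangPiece (f i) (B i) b).K ∪ {b} ⊆ (f i).K ∪ {(f i).τ 0} := by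
      rw [hangPiece_K hb]
      exact Set.union_subset (hang_sub.trans Set.sdiff_subset)
        (Set.singleton_subset_iff.2 ((hB i).1.2 hb))
    refine ⟨i, ⟨?_, fun C hC => (hf i).2.1 C (hC.trans hU), fun a ha => (hf i).2.2 a (hU ha)⟩, ?_,
      hangPiece_le _ (hf i).1 (hB i) (hτ i) hb⟩
    · change Cn _ ((hangPiece (f i) (B i) b).K ∪ {b})
      rw [hangPiece_K hb]
      exact hang_cn
    · obtain ⟨p, hp, q, hq, hpq⟩ := (hB i).1.1.two
      obtain ⟨c, hc, hcτ⟩ : ∃ c ∈ B i, c ≠ (f i).τ 0 := by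
        by_cases h : p = (f i).τ 0
        · exact ⟨q, hq, fun e => hpq (h.trans e.symm)⟩
        · exact ⟨p, hp, h⟩
      rw [hangPiece_K hb]
      refine Set.ncard_lt_ncard ⟨fun y hy => hy.1.1.resolve_right fun e =>
        hy.1.2 (by rw [e]; exact hτ i), fun h => ?_⟩ (Set.toFinite (f i).K)
      exact (h (((hB i).1.2 hc).resolve_right hcτ)).1.2 hc
  obtain ⟨i, j, hij, ν, hν⟩ := pwo_good (hℬ _ (BlockLE r) _ hS') g fun i => ⟨(hf i).2.1 (B i)
    (hB i).1.2 (hB i).1.1, fun b hb => ⟨trivial, (hf i).2.2 b ((hB i).1.2 hb), hD i b hb⟩⟩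
  exact ⟨i, j, hij, block_compose (hf i).1 (hB i) (hτ i) (hB j) (hτ j) hν⟩

/-- Labelled connected graphs are well-quasi-ordered when their labelled blocks are. -/
theorem connected_pwo_of_blocks {ℬ : ∀ V : Type, SimpleGraph V → Set V → Prop}
    (hℬ : LabelledPwo ℬ) :
    LabelledPwo fun _ G K => Cn G K ∧ ∀ B ⊆ K, NoCut G B → ℬ _ G B := by
  intro Q r _ S hS
  refine pwo_of_good fun f hf => ?_
  have key : ∀ i, ∃ p : (f i).V, p ∈ (f i).K := fun i => (hf i).1.1.nonempty
  choose p hp using key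
  let g : ℕ → Piece Q 1 := fun i => ⟨(f i).V, (f i).fin, (f i).G, (f i).lab,
    (f i).K \ {p i}, fun _ => p i, Function.injective_of_subsingleton _,
    fun _ h => h.2 rfl⟩
  have hgK : ∀ i, (f i).K \ {p i} ∪ {p i} = (f i).K := fun i =>
    Set.sdiff_union_of_subset (Set.singleton_subset_iff.2 (hp i))
  have hg : ∀ i, g i ∈ Rooted ℬ S := by
    intro i
    change Cn _ ((f i).K \ {p i} ∪ {p i}) ∧ (∀ B ⊆ (f i).K \ {p i} ∪ {p i}, _) ∧
      ∀ a ∈ (f i).K \ {p i} ∪ {p i}, _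
    rw [hgK]
    exact ⟨(hf i).1.1, (hf i).1.2, (hf i).2⟩
  obtain ⟨i, j, hij, h1, μ, h2⟩ := pwo_good (hS.prod (rooted_pwo hℬ hS))
    (fun i => ((f i).lab (p i), g i)) fun i => ⟨(hf i).2 _ (hp i), hg i⟩
  refine ⟨i, j, hij, μ, ?_⟩
  have := h2.forget (b' := false) h1 (f i).τ (f j).τ
  change Mod r _ _ _ ((f i).K \ {p i} ∪ {p i}) _ _ _ ((f j).K \ {p j} ∪ {p j}) _ _
    at this
  rwa [hgK, hgK] at this

end Blocks

section SeriesParallel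

variable {V : Type} {G : SimpleGraph V}

/-- `U` contains a model of `K₄` as a minor. -/
def HasK4 (G : SimpleGraph V) (U : Set V) : Prop :=
  ∃ A : Fin 4 → Set V, (∀ i, A i ⊆ U) ∧ (∀ i, Cn G (A i)) ∧
    ∀ i j, i ≠ j → Disjoint (A i) (A j) ∧ Tch G (A i) (A j)

lemma HasK4.mono {U U' : Set V} (h : HasK4 G U) (hU : U ⊆ U') : HasK4 G U' := by
  obtain ⟨A, h1, h2, h3⟩ := h
  exact ⟨A, fun i => (h1 i).trans hU, h2, h3⟩

/-- Four sets forming a model of `K₄`. -/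
structure K4M (G : SimpleGraph V) (A B C D : Set V) : Prop where
  a : Cn G A
  b : Cn G B
  c : Cn G C
  d : Cn G D
  ab : Disjoint A B
  ac : Disjoint A C
  ad : Disjoint A D
  bc : Disjoint B C
  bd : Disjoint B D
  cd : Disjoint C D
  tab : Tch G A B
  tac : Tch G A C
  tad : Tch G A D
  tbc : Tch G B C
  tbd : Tch G B D
  tcd : Tch G C D

lemma K4M.hasK4 {A B C D U : Set V} (h : K4M G A B C D) (hA : A ⊆ U) (hB : B ⊆ U) (hC : C ⊆ U)
    (hD : D ⊆ U) : HasK4 G U := by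
  refine ⟨![A, B, C, D], ?_, ?_, ?_⟩
  · intro i
    fin_cases i
    exacts [hA, hB, hC, hD]
  · intro i
    fin_cases i
    exacts [h.a, h.b, h.c, h.d]
  · intro i j hij
    fin_cases i <;> fin_cases j
    exacts [absurd rfl hij, ⟨h.ab, h.tab⟩, ⟨h.ac, h.tac⟩, ⟨h.ad, h.tad⟩,
      ⟨h.ab.symm, h.tab.symm⟩, absurd rfl hij, ⟨h.bc, h.tbc⟩, ⟨h.bd, h.tbd⟩,
      ⟨h.ac.symm, h.tac.symm⟩, ⟨h.bc.symm, h.tbc.symm⟩, absurd rfl hij, ⟨h.cd, h.tcd⟩,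
      ⟨h.ad.symm, h.tad.symm⟩, ⟨h.bd.symm, h.tbd.symm⟩, ⟨h.cd.symm, h.tcd.symm⟩, absurd rfl hij]

/-- `K` is a connected part of the `K₄`-minor-free `2`-connected set `U`, attached to the rest of
`U` at two terminals. -/
structure SP (G : SimpleGraph V) (U K : Set V) (τ : Fin 2 → V) : Prop where
  noCut : NoCut G U
  k4 : ¬ HasK4 G U
  sub : K ⊆ U
  mem : ∀ i, τ i ∈ U \ K
  inj : Function.Injective τ
  cn : Cn G K
  tch : ∀ i, Tch G K {τ i}
  out : ∀ x ∈ K, ∀ y ∈ U \ K, G.Adj x y → y ∈ Set.range τ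
  co : Cn G (U \ K)

/-- `m` separates the two terminals inside `K`. -/
structure Mid (G : SimpleGraph V) (K : Set V) (τ : Fin 2 → V) (m : V) : Prop where
  mem : m ∈ K
  sep : ∀ L ⊆ K, m ∉ L → Cn G L → ∀ i j, i ≠ j → Tch G L {τ i} → ¬ Tch G L {τ j}

variable {U K : Set V} {τ : Fin 2 → V} {m : V}

lemma SP.exists_mid [Finite V] (h : SP G U K τ) : ∃ m, Mid G K τ m := by
  by_contra hno
  have key : ∀ m ∈ K, ∃ L ⊆ K, m ∉ L ∧ Cn G L ∧ (L ∩ {x | G.Adj x (τ 0)}).Nonempty ∧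
      (L ∩ {x | G.Adj x (τ 1)}).Nonempty := by
    intro m hm
    by_contra hm'
    refine hno ⟨m, hm, fun L hL hmL hcn => ?_⟩
    have hL' : ¬ (Tch G L {τ 0} ∧ Tch G L {τ 1}) := by
      rintro ⟨h0, h1⟩
      obtain ⟨x, hx, hx'⟩ := tch_singleton_right.1 h0
      obtain ⟨y, hy, hy'⟩ := tch_singleton_right.1 h1
      exact hm' ⟨L, hL, hmL, hcn, ⟨x, hx, hx'⟩, ⟨y, hy, hy'⟩⟩
    intro i j hij h1 h2
    fin_cases i <;> fin_cases j
    exacts [hij rfl, hL' ⟨h1, h2⟩, hL' ⟨h2, h1⟩, hij rfl]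
  obtain ⟨A, B, hA, hB, hd, hAc, hBc, ⟨a0, ha0⟩, ⟨a1, ha1⟩, ⟨b0, hb0⟩, ⟨b1, hb1⟩⟩ :=
    exists_two_disjoint _ K _ _ rfl h.cn.nonempty key
  obtain ⟨A', B', hAA, hBB, hK, hd', hAc', hBc', hAB⟩ := h.cn.grow hAc hBc hA hB hd
  obtain ⟨C, D, hC, hD, hCD, hd'', hCc, hDc, htCD⟩ := h.co.split (h.mem 0) (h.mem 1)
    (h.inj.ne (by decide))
  have hA'K : A' ⊆ K := hK ▸ Set.subset_union_left
  have hB'K : B' ⊆ K := hK ▸ Set.subset_union_right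
  have hC' : C ⊆ U \ K := hCD ▸ Set.subset_union_left
  have hD' : D ⊆ U \ K := hCD ▸ Set.subset_union_right
  have disj : ∀ {X Y : Set V}, X ⊆ K → Y ⊆ U \ K → Disjoint X Y := fun hX hY =>
    Set.disjoint_left.2 fun x hx hx' => (hY hx').2 (hX hx)
  exact h.k4 (K4M.hasK4 (A := A') (B := B') (C := C) (D := D)
    ⟨hAc', hBc', hCc, hDc, hd', disj hA'K hC', disj hA'K hD', disj hB'K hC', disj hB'K hD', hd'',
      hAB, tch_of_adj ha0.2 (hAA ha0.1) hC, tch_of_adj ha1.2 (hAA ha1.1) hD,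
      tch_of_adj hb0.2 (hBB hb0.1) hC, tch_of_adj hb1.2 (hBB hb1.1) hD, htCD⟩
    (hA'K.trans h.sub) (hB'K.trans h.sub) (hC'.trans Set.sdiff_subset)
    (hD'.trans Set.sdiff_subset))

lemma fin_two_cases (i j : Fin 2) : j = i ∨ j = i.rev := by
  fin_cases i <;> fin_cases j <;> simp [Fin.rev]

lemma fin_two_rev_ne (i : Fin 2) : i.rev ≠ i := by
  fin_cases i <;> simp [Fin.rev]

/-- The terminals of the parts of `K \ {m}` attached to `τ i`. -/
def subT (τ : Fin 2 → V) (m : V) (i : Fin 2) : Fin 2 → V := fun j => if j = i then τ i else m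

@[simp] lemma subT_self (i : Fin 2) : subT τ m i i = τ i := if_pos rfl

@[simp] lemma subT_rev (i : Fin 2) : subT τ m i i.rev = m := if_neg (fin_two_rev_ne i)

lemma range_subT (i : Fin 2) : Set.range (subT τ m i) = {τ i, m} := by
  ext x
  constructor
  · rintro ⟨j, rfl⟩
    rcases fin_two_cases i j with rfl | rfl <;> simp
  · rintro (rfl | rfl)
    exacts [⟨i, by simp⟩, ⟨i.rev, by simp⟩]

lemma SP.exists_tch (h : SP G U K τ) (hm : Mid G K τ m) {L : Set V} (hL : IsComp G (K \ {m}) L) :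
    ∃ i, Tch G L {τ i} := by
  obtain ⟨x, hx⟩ := hL.cn.nonempty
  have hne : τ 0 ≠ m := fun e => (h.mem 0).2 (e ▸ hm.mem)
  obtain ⟨y, hy, z, hz, hzL, hyz⟩ := (h.noCut.del m).exists_adj (X := L)
    (fun y hy => ⟨h.sub (hL.sub hy).1, (hL.sub hy).2⟩) ⟨x, hx⟩ (a := τ 0) ⟨(h.mem 0).1, hne⟩
    fun h' => (h.mem 0).2 (hL.sub h').1
  by_cases hzK : z ∈ K
  · exact absurd (hL.closed y hy z ⟨hzK, hz.2⟩ hyz) hzL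
  · obtain ⟨i, rfl⟩ := h.out y (hL.sub hy).1 z ⟨hz.1, hzK⟩ hyz
    exact ⟨i, tch_singleton_right.2 ⟨y, hy, hyz⟩⟩

lemma SP.sub_piece (h : SP G U K τ) (hm : Mid G K τ m) {L : Set V} (hL : IsComp G (K \ {m}) L)
    {i : Fin 2} (hi : Tch G L {τ i}) : SP G U L (subT τ m i) where
  noCut := h.noCut
  k4 := h.k4
  sub := hL.sub.trans (Set.sdiff_subset.trans h.sub)
  mem j := by
    rcases fin_two_cases i j with rfl | rfl
    · simp only [subT_self]
      exact ⟨(h.mem _).1, fun h' => (h.mem _).2 (hL.sub h').1⟩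
    · simp only [subT_rev]
      exact ⟨h.sub hm.mem, fun h' => (hL.sub h').2 rfl⟩
  inj j k hjk := by
    have hne : τ i ≠ m := fun e => (h.mem i).2 (e ▸ hm.mem)
    rcases fin_two_cases i j with hj | hj <;> rcases fin_two_cases i k with hk | hk <;>
      subst hj hk
    · rfl
    · simp [hne] at hjk
    · simp [hne.symm] at hjk
    · rfl
  cn := hL.cn
  tch j := by
    rcases fin_two_cases i j with rfl | rfl
    · simpa using hi
    · simpa using (hL.tch h.cn ⟨m, rfl, hm.mem⟩).mono subset_rfl Set.inter_subset_left
  out x hx y hy hxy := by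
    rw [range_subT]
    by_cases hyK : y ∈ K
    · by_cases hym : y = m
      · exact Or.inr hym
      · exact absurd (hL.closed x hx y ⟨hyK, hym⟩ hxy) hy.2
    · obtain ⟨j, rfl⟩ := h.out x (hL.sub hx).1 y ⟨hy.1, hyK⟩ hxy
      rcases fin_two_cases i j with rfl | rfl
      · exact Or.inl rfl
      · exact absurd (tch_singleton_right.2 ⟨x, hx, hxy⟩) (hm.sep L
          (hL.sub.trans Set.sdiff_subset) (fun h' => (hL.sub h').2 rfl) hL.cn i _
          (fin_two_rev_ne i).symm hi)
  co := by
    have hU : U \ L = (U \ K) ∪ (K \ L) := by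
      ext x
      have h1 := @h.sub x
      have h2 : x ∈ L → x ∈ K := fun h => (hL.sub h).1
      simp only [Set.mem_sdiff, Set.mem_union]
      tauto
    rw [hU]
    obtain ⟨x, hx, hxy⟩ := tch_singleton_right.1 (h.tch i.rev)
    refine h.co.union (h.cn.diff_isComp (cn_singleton m) (Set.singleton_subset_iff.2 hm.mem) hL)
      (tch_of_adj hxy.symm (h.mem _) ⟨hx, fun hxL => ?_⟩)
    exact hm.sep L (hL.sub.trans Set.sdiff_subset) (fun h' => (hL.sub h').2 rfl) hL.cn i _
          (fin_two_rev_ne i).symm hi (tch_singleton_right.2 ⟨x, hxL, hxy⟩)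

lemma SP.sub_mod {Q : Type 1} {r : Q → Q → Prop} [IsPreorder Q r] {lab : V → Q}
    (h : SP G U K τ) (hm : Mid G K τ m) {L : Set V} (hL : IsComp G (K \ {m}) L)
    {i : Fin 2} (hi : Tch G L {τ i}) {b : Bool} (hb : b = false → ¬ G.Adj m (τ i)) :
    ∃ μ, Mod r b G lab L (subT τ m i) G lab K τ μ := by
  classical
  let Z : Set V := {x | x ∈ K \ {m} ∧ Tch G (cmp G (K \ {m}) x) {τ i}}
  have hZcl : ∀ y ∈ Z, ∀ z ∈ K \ {m}, G.Adj y z → z ∈ Z := by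
    intro y hy z hz hyz
    refine ⟨hz, ?_⟩
    have : cmp G (K \ {m}) z = cmp G (K \ {m}) y := (cmp_isComp hz).eq (cmp_isComp hy.1)
      ⟨z, mem_cmp hz, (cmp_isComp hy.1).closed y (mem_cmp hy.1) z hz hyz⟩
    rw [this]
    exact hy.2
  have hLZ : L ⊆ Z := fun x hx => by
    refine ⟨hL.sub hx, ?_⟩
    rw [(cmp_isComp (hL.sub hx)).eq hL ⟨x, mem_cmp (hL.sub hx), hx⟩]
    exact hi
  have hZt : ∀ x ∈ Z, ¬ G.Adj x (τ i.rev) := fun x hx hadj => by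
    have hc := cmp_isComp (G := G) hx.1
    exact hm.sep _ (hc.sub.trans Set.sdiff_subset) (fun h' => (hc.sub h').2 rfl) hc.cn i _
      (fin_two_rev_ne i).symm hx.2 (tch_singleton_right.2 ⟨x, mem_cmp hx.1, hadj⟩)
  have hZs : ∀ x ∈ K, x ≠ m → G.Adj x (τ i) → x ∈ Z := fun x hx hxm hadj =>
    ⟨⟨hx, hxm⟩, tch_singleton_right.2 ⟨x, mem_cmp ⟨hx, hxm⟩, hadj⟩⟩
  have hcn : Cn G (K \ Z ∪ {τ i.rev}) := by
    refine (h.cn.diff_closed (cn_singleton m) (Set.singleton_subset_iff.2 hm.mem)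
      (fun x hx => hx.1) hZcl).union (cn_singleton _) ?_
    obtain ⟨x, hx, hxy⟩ := tch_singleton_right.1 (h.tch i.rev)
    exact tch_of_adj hxy ⟨hx, fun hxZ => hZt x hxZ hxy⟩ rfl
  have hmL : m ∉ L := fun h' => (hL.sub h').2 rfl
  have hmZ : m ∉ Z := fun h' => h'.1.2 rfl
  have hne : τ i ≠ m := fun e => (h.mem i).2 (e ▸ hm.mem)
  have hLK : L ⊆ K := hL.sub.trans Set.sdiff_subset
  have hLm : ∀ a ∈ L, a ≠ m := fun a ha e => hmL (e ▸ ha)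
  have hL' : ∀ a ∈ L ∪ Set.range (subT τ m i), a ≠ m → a ∉ K \ Z ∪ {τ i.rev} := by
    rw [range_subT]
    rintro a (ha | rfl | rfl) ham (h' | h')
    · exact h'.2 (hLZ ha)
    · exact (h.mem i.rev).2 (h' ▸ hLK ha)
    · exact (h.mem i).2 h'.1
    · exact fin_two_rev_ne i (h.inj h').symm
    · exact ham rfl
    · exact ham rfl
  refine ⟨fun a => if a = m then K \ Z ∪ {τ i.rev} else {a}, ?_, ?_, ?_, ?_, ?_, ?_, ?_, ?_⟩
  · intro a ha
    rw [if_neg (hLm a ha)]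
    exact Set.singleton_subset_iff.2 (hLK ha)
  · intro j
    rcases fin_two_cases i j with rfl | rfl
    · simp [hne]
    · simp only [subT_rev, if_true]
      exact Set.union_subset_union_left _ Set.sdiff_subset
  · intro j
    rcases fin_two_cases i j with rfl | rfl <;> simp [hne]
  · intro a ha
    split_ifs
    · exact hcn
    · exact cn_singleton a
  · intro a ha c hc hac
    split_ifs with h1 h2 h2
    · exact absurd (h1.trans h2.symm) hac
    · exact Set.disjoint_singleton_right.2 (hL' c hc h2)
    · exact Set.disjoint_singleton_left.2 (hL' a ha h1)
    · simpa using hac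
  · intro a ha c hc hac
    rw [if_neg (hLm a ha)]
    split_ifs with h1
    · subst h1
      constructor
      · rintro ⟨_, rfl, y, hy | rfl, hxy⟩
        · by_cases hym : y = c
          · exact hym ▸ hxy
          · exact absurd (hZcl _ (hLZ ha) y ⟨hy.1, hym⟩ hxy) hy.2
        · exact absurd hxy (hZt _ (hLZ ha))
      · exact fun h' => ⟨a, rfl, c, Or.inl ⟨hm.mem, hmZ⟩, h'⟩
    · simp [Tch]
  · intro hb' j k hjk x hx y hy hxy
    have key : ∀ y ∈ K \ Z ∪ {τ i.rev}, G.Adj (τ i) y → y = τ i.rev := by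
      rintro y (hy | hy) hadj
      · by_cases hym : y = m
        · exact absurd (hym ▸ hadj.symm) (hb hb')
        · exact absurd (hZs y hy.1 hym hadj.symm) hy.2
      · exact hy
    rcases fin_two_cases i j with hj | hj <;> rcases fin_two_cases i k with hk | hk <;>
      rw [hj, hk] at hjk <;> subst hj hk
    · exact absurd rfl hjk
    · simp only [subT_self, if_neg hne, subT_rev, if_true] at hx hy
      rw [Set.mem_singleton_iff] at hx
      subst hx
      exact ⟨rfl, key y hy hxy⟩
    · simp only [subT_self, if_neg hne, subT_rev, if_true] at hx hy
      rw [Set.mem_singleton_iff] at hy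
      subst hy
      exact ⟨key x hx hxy.symm, rfl⟩
    · exact absurd rfl hjk
  · intro a ha
    rw [if_neg (hLm a ha)]
    exact ⟨a, rfl, refl_of r _⟩

/-- The components of `K \ {m}` attached to `τ i`. -/
def SubI (G : SimpleGraph V) (K : Set V) (τ : Fin 2 → V) (m : V) (i : Fin 2) : Type :=
  {L : Set V // IsComp G (K \ {m}) L ∧ Tch G L {τ i}}

variable {V' : Type} {G' : SimpleGraph V'} {U' K' : Set V'} {τ' : Fin 2 → V'} {m' : V'}

lemma SP.compose {Q : Type 1} {r : Q → Q → Prop} {lab : V → Q} {lab' : V' → Q}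
    (h : SP G U K τ) (hm : Mid G K τ m) (h' : SP G' U' K' τ') (hm' : Mid G' K' τ' m')
    (hl : r (lab m) (lab' m')) (hadj : ∀ i, G.Adj m (τ i) ↔ G'.Adj m' (τ' i))
    (φ : ∀ i, SubI G K τ m i → SubI G' K' τ' m' i) (hφ : ∀ i, Function.Injective (φ i))
    {b : Fin 2 → Bool} (hb : ∀ i, b i = true → G.Adj m (τ i))
    (hM : ∀ i L, ∃ μ, Mod r (b i) G lab L.1 (subT τ m i) G' lab' (φ i L).1 (subT τ' m' i) μ) :
    ∃ μ, Mod r false G lab K τ G' lab' K' τ' μ := by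
  classical
  choose M hM using hM
  have hτm : ∀ i, τ i ≠ m := fun i e => (h.mem i).2 (e ▸ hm.mem)
  have hτm' : ∀ i, τ' i ≠ m' := fun i e => (h'.mem i).2 (e ▸ hm'.mem)
  have diff : ∀ x y : Σ i, SubI G K τ m i, x ≠ y → x.2.1 ≠ y.2.1 := by
    rintro ⟨i, L, hL⟩ ⟨j, L', hL'⟩ hne e
    simp only at e
    subst e
    by_cases hij : i = j
    · subst hij
      exact hne rfl
    · exact hm.sep L (hL.1.sub.trans Set.sdiff_subset) (fun h' => (hL.1.sub h').2 rfl) hL.1.cn i j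
        hij hL.2 hL'.2
  have diff' : ∀ x y : Σ i, SubI G K τ m i, x ≠ y → (φ x.1 x.2).1 ≠ (φ y.1 y.2).1 := by
    rintro ⟨i, L⟩ ⟨j, L'⟩ hne e
    by_cases hij : i = j
    · subst hij
      have e' : L = L' := hφ i (Subtype.ext e)
      exact hne (by rw [e'])
    · exact hm'.sep _ ((φ i L).2.1.sub.trans Set.sdiff_subset) (fun h' => ((φ i L).2.1.sub h').2 rfl)
        (φ i L).2.1.cn i j hij (φ i L).2.2 (by simp only at e; rw [e]; exact (φ j L').2.2)
  let ν : V → Set V' := fun a => if a = m then {m'} else if a = τ 0 then {τ' 0} else {τ' 1}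
  have hνm : ν m = {m'} := if_pos rfl
  have hντ : ∀ i, ν (τ i) = {τ' i} := by
    intro i
    fin_cases i
    · simp [ν, hτm]
    · have : τ 1 ≠ τ 0 := h.inj.ne (by decide)
      simp [ν, hτm, this]
  have hνT : ∀ i j, ν (subT τ m i j) = {subT τ' m' i j} := by
    intro i j
    rcases fin_two_cases i j with rfl | rfl
    · simp [hντ]
    · simp [hνm]
  have hcore : Mod r false G lab {m} τ G' lab' {m'} τ' ν := by
    refine ⟨?_, ?_, ?_, ?_, ?_, ?_, ?_, ?_⟩
    · rintro _ rfl
      rw [hνm]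
    · intro i
      rw [hντ]
      exact Set.subset_union_right
    · intro i
      rw [hντ]
      rfl
    · rintro a (rfl | ⟨i, rfl⟩)
      · rw [hνm]
        exact cn_singleton _
      · rw [hντ]
        exact cn_singleton _
    · rintro a (rfl | ⟨i, rfl⟩) c (rfl | ⟨j, rfl⟩) hac
      · exact absurd rfl hac
      · rw [hνm, hντ]
        exact Set.disjoint_singleton.2 (hτm' j).symm
      · rw [hνm, hντ]
        exact Set.disjoint_singleton.2 (hτm' i)
      · rw [hντ, hντ]
        exact Set.disjoint_singleton.2 fun e => hac (congrArg τ (h'.inj e))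
    · rintro a rfl c (rfl | ⟨i, rfl⟩) hac
      · exact absurd rfl hac
      · rw [hνm, hντ, hadj]
        simp [Tch]
    · intro _ i j hij x hx y hy _
      rw [hντ] at hx hy
      exact ⟨hx, hy⟩
    · rintro a rfl
      exact ⟨m', by rw [hνm]; rfl, hl⟩
  have memU : ∀ {y L}, IsComp G (K \ {m}) L → y ∈ ({m} : Set V) ∪ Set.range τ → y ∈ U \ L := by
    rintro y L hL (rfl | ⟨i, rfl⟩)
    · exact ⟨h.sub hm.mem, fun h' => (hL.sub h').2 rfl⟩
    · exact ⟨(h.mem i).1, fun h' => (h.mem i).2 (hL.sub h').1⟩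
  have memU' : ∀ {y L}, IsComp G' (K' \ {m'}) L → y ∈ ({m'} : Set V') ∪ Set.range τ' →
      y ∈ U' \ L := by
    rintro y L hL (rfl | ⟨i, rfl⟩)
    · exact ⟨h'.sub hm'.mem, fun h' => (hL.sub h').2 rfl⟩
    · exact ⟨(h'.mem i).1, fun h'' => (h'.mem i).2 (hL.sub h'').1⟩
  have hglue := Mod.glue (I := Σ i, SubI G K τ m i) (KK := fun x => x.2.1)
    (T := fun x => subT τ m x.1) (KK' := fun x => (φ x.1 x.2).1) (T' := fun x => subT τ' m' x.1)
    (M := fun x => M x.1 x.2) (bb := fun x => b x.1) h.inj hcore (fun x => hM x.1 x.2)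
    (by
      intro x j
      rcases fin_two_cases x.1 j with rfl | rfl
      · rw [subT_self]
        exact Or.inr ⟨_, rfl⟩
      · rw [subT_rev]
        exact Or.inl rfl)
    (fun x => Set.disjoint_left.2 fun y hy hy' => (memU x.2.2.1 hy').2 hy)
    (fun x y hxy => x.2.2.1.disjoint y.2.2.1 (diff x y hxy))
    (fun x y hy z hz hyz => (h.sub_piece hm x.2.2.1 x.2.2.2).out y hy z (memU x.2.2.1 hz) hyz)
    (fun x y hxy => x.2.2.1.not_tch y.2.2.1 (diff x y hxy))
    (fun x j => by rw [hνT]; rfl)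
    (fun x => Set.disjoint_left.2 fun y hy hy' => (memU' (φ x.1 x.2).2.1 hy').2 hy)
    (fun x y hxy => (φ x.1 x.2).2.1.disjoint (φ y.1 y.2).2.1 (diff' x y hxy))
    (fun x y hy z hz hyz => (h'.sub_piece hm' (φ x.1 x.2).2.1 (φ x.1 x.2).2.2).out y hy z
      (memU' (φ x.1 x.2).2.1 hz) hyz)
    (fun x y hxy => (φ x.1 x.2).2.1.not_tch (φ y.1 y.2).2.1 (diff' x y hxy))
    (by
      intro x hx j k hjk
      have hmτ : m ∉ Set.range τ := by
        rintro ⟨i, hi⟩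
        exact hτm i hi
      rcases fin_two_cases x.1 j with rfl | rfl <;> rcases fin_two_cases x.1 k with rfl | rfl
      · exact absurd rfl hjk
      · simp only [subT_self, subT_rev]
        exact ⟨(hb _ hx).symm, Or.inr hmτ⟩
      · simp only [subT_self, subT_rev]
        exact ⟨hb _ hx, Or.inl hmτ⟩
      · exact absurd rfl hjk)
  have hK : ({m} ∪ ⋃ x : Σ i, SubI G K τ m i, x.2.1) = K := by
    ext y
    constructor
    · rintro (rfl | hy)
      · exact hm.mem
      · obtain ⟨x, hx⟩ := Set.mem_iUnion.1 hy
        exact (x.2.2.1.sub hx).1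
    · intro hy
      by_cases hym : y = m
      · exact Or.inl hym
      · obtain ⟨L, hL, hyL⟩ := exists_isComp (G := G) (Z := K \ {m}) ⟨hy, hym⟩
        obtain ⟨i, hi⟩ := h.exists_tch hm hL
        exact Or.inr (Set.mem_iUnion.2 ⟨⟨i, L, hL, hi⟩, hyL⟩)
  rw [hK] at hglue
  refine ⟨_, hglue.mono_target ?_⟩
  rintro y (rfl | hy)
  · exact hm'.mem
  · obtain ⟨x, hx⟩ := Set.mem_iUnion.1 hy
    exact ((φ x.1 x.2).2.1.sub hx).1

end SeriesParallel

section SeriesParallelPwo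

variable {Q : Type 1} {r : Q → Q → Prop}

instance {V : Type} [Finite V] {G : SimpleGraph V} {K : Set V} {τ : Fin 2 → V} {m : V} {i : Fin 2} :
    Finite (SubI G K τ m i) := inferInstanceAs (Finite (Subtype _))

/-- The piece on a component of `K \ {m}`. -/
def subPiece (P : Piece Q 2) {m : P.V} (hm : m ∈ P.K) (i : Fin 2) (L : SubI P.G P.K P.τ m i) :
    Piece Q 2 where
  V := P.V
  fin := P.fin
  G := P.G
  lab := P.lab
  K := L.1
  τ := subT P.τ m i
  inj j k hjk := by
    have hne : P.τ i ≠ m := fun e => P.notMem i (e ▸ hm)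
    rcases fin_two_cases i j with hj | hj <;> rcases fin_two_cases i k with hk | hk <;>
      subst hj hk
    · rfl
    · simp [hne] at hjk
    · simp [hne.symm] at hjk
    · rfl
  notMem j h := by
    have h' := L.2.1.sub h
    rcases fin_two_cases i j with hj | hj <;> subst hj
    · rw [subT_self] at h'
      exact P.notMem _ h'.1
    · rw [subT_rev] at h'
      exact h'.2 rfl

open Classical in
/-- The family of sub-pieces attached to the terminal `i`, with a mark telling whether the
separating vertex is adjacent to that terminal. -/
noncomputable def spSide (P : Piece Q 2) (i : Fin 2) : Bool × Fam (Piece Q 2) :=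
  if h : ∃ m, Mid P.G P.K P.τ m then
    (decide (P.G.Adj h.choose (P.τ i)), ⟨SubI P.G P.K P.τ h.choose i,
      have := P.fin; inferInstance, fun L => subPiece P h.choose_spec.mem i L⟩)
  else (false, ⟨Empty, inferInstance, fun x => x.elim⟩)

open Classical in
lemma spSide_eq {P : Piece Q 2} {i : Fin 2} (h : ∃ m, Mid P.G P.K P.τ m) :
    spSide P i = (decide (P.G.Adj h.choose (P.τ i)), ⟨SubI P.G P.K P.τ h.choose i,
      have := P.fin; inferInstance, fun L => subPiece P h.choose_spec.mem i L⟩) :=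
  dif_pos h

/-- The label of the separating vertex. -/
noncomputable def spLab (P : Piece Q 2) : Q :=
  open Classical in if h : ∃ m, Mid P.G P.K P.τ m then P.lab h.choose else P.lab (P.τ 0)

/-- The pieces arising from series-parallel graphs. -/
def SPSet (S : Set Q) : Set (Piece Q 2) :=
  {P | (∃ U, SP P.G U P.K P.τ) ∧ ∀ a ∈ P.K, P.lab a ∈ S}

/-- The terminal on a given side. -/
def sideIdx (s : Bool) : Fin 2 := if s then 1 else 0

theorem sp_pwo [IsPreorder Q r] {S : Set Q} (hS : S.PartiallyWellOrderedOn r) :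
    (SPSet S).PartiallyWellOrderedOn (PLE r false) := by
  have hmid : ∀ P ∈ SPSet S, ∃ m, Mid P.G P.K P.τ m := fun P hP => by
    have := P.fin
    obtain ⟨⟨U, hU⟩, -⟩ := hP
    exact hU.exists_mid
  refine pwo_of_decomp (R := fun b => PLE r b) (fun _ _ h => h.lax) (fun P => P.K.ncard) hS
    (fun P s => spSide P (sideIdx s)) spLab ?_ ?_ ?_
  · intro P hP
    have h := hmid P hP
    rw [spLab, dif_pos h]
    exact hP.2 _ h.choose_spec.mem
  · intro P hP s
    have h := hmid P hP
    have := P.fin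
    rw [spSide_eq h]
    intro L
    obtain ⟨⟨U, hU⟩, hl⟩ := hP
    have hm := h.choose_spec
    obtain ⟨μ, hμ⟩ := hU.sub_mod (r := r) (lab := P.lab) (b := true) hm L.2.1 L.2.2 (by simp)
    refine ⟨⟨⟨U, hU.sub_piece hm L.2.1 L.2.2⟩, fun a ha => hl a (L.2.1.sub ha).1⟩, ?_, ⟨μ, hμ⟩,
      fun hb => ?_⟩
    · refine Set.ncard_lt_ncard ⟨fun a ha => (L.2.1.sub ha).1, fun h' => ?_⟩ (Set.toFinite P.K)
      exact (L.2.1.sub (h' hm.mem)).2 rfl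
    · obtain ⟨μ, hμ⟩ := hU.sub_mod (r := r) (lab := P.lab) (b := false) hm L.2.1 L.2.2
        (fun _ => by simpa using hb)
      exact ⟨μ, hμ⟩
  · intro P hP P' hP' hq hd
    have h := hmid P hP
    have h' := hmid P' hP'
    obtain ⟨⟨U, hU⟩, -⟩ := hP
    obtain ⟨⟨U', hU'⟩, -⟩ := hP'
    rw [spLab, spLab, dif_pos h, dif_pos h'] at hq
    have hd' : ∀ i, BLE (fun b => PLE r b) (spSide P i) (spSide P' i) := by
      intro i
      fin_cases i
      exacts [hd false, hd true]
    simp only [spSide_eq h, spSide_eq h'] at hd'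
    choose hadj φ hφ hle using hd'
    exact hU.compose (b := fun i => open Classical in decide (P.G.Adj h.choose (P.τ i)))
      h.choose_spec hU' h'.choose_spec hq (fun i => by simpa using hadj i) φ hφ
      (fun i hi => by simpa using hi) hle

end SeriesParallelPwo

section K4Free

variable {V : Type} {G : SimpleGraph V}

lemma NoCut.exists_adj_mem {B : Set V} (hB : NoCut G B) {a : V} (ha : a ∈ B) :
    ∃ b ∈ B, G.Adj a b := by
  obtain ⟨c, hc, hca⟩ : ∃ c ∈ B, c ≠ a := by
    obtain ⟨p, hp, q, hq, hpq⟩ := hB.two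
    by_cases h : p = a
    · exact ⟨q, hq, fun e => hpq (h.trans e.symm)⟩
    · exact ⟨p, hp, h⟩
  obtain ⟨x, hx, y, hy, -, hxy⟩ := hB.cn.exists_adj (X := {a}) (Set.singleton_subset_iff.2 ha)
    ⟨a, rfl⟩ hc hca
  exact ⟨y, hy, (Set.mem_singleton_iff.1 hx) ▸ hxy⟩

/-- In a `2`-connected set, the components left by an edge are attached to both of its ends. -/
lemma NoCut.tch_both {B L : Set V} (hB : NoCut G B) {τ : Fin 2 → V} (hτ : ∀ i, τ i ∈ B)
    (inj : Function.Injective τ) (hL : IsComp G (B \ Set.range τ) L) (i : Fin 2) :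
    Tch G L {τ i} := by
  obtain ⟨x, hx⟩ := hL.cn.nonempty
  obtain ⟨y, hy, z, hz, hzL, hyz⟩ := (hB.del (τ i.rev)).exists_adj (X := L)
    (fun y hy => ⟨(hL.sub hy).1, fun e => (hL.sub hy).2 ⟨_, e.symm⟩⟩) ⟨x, hx⟩ (a := τ i)
    ⟨hτ i, fun e => fin_two_rev_ne i (inj e).symm⟩ fun h' => (hL.sub h').2 ⟨_, rfl⟩
  by_cases hzτ : z ∈ Set.range τ
  · obtain ⟨j, rfl⟩ := hzτ
    rcases fin_two_cases i j with rfl | rfl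
    · exact tch_singleton_right.2 ⟨y, hy, hyz⟩
    · exact absurd rfl hz.2
  · exact absurd (hL.closed y hy z ⟨hz.1, hzτ⟩ hyz) hzL

lemma cn_range {τ : Fin 2 → V} (h : G.Adj (τ 0) (τ 1)) : Cn G (Set.range τ) := by
  have : Set.range τ = {τ 0, τ 1} := by
    ext x
    simp [Fin.exists_fin_two, eq_comm]
  rw [this]
  exact cn_pair h

lemma sp_of_edge {B L : Set V} (hB : NoCut G B) (h4 : ¬ HasK4 G B) {τ : Fin 2 → V}
    (hτ : ∀ i, τ i ∈ B) (hadj : G.Adj (τ 0) (τ 1)) (inj : Function.Injective τ)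
    (hL : IsComp G (B \ Set.range τ) L) : SP G B L τ where
  noCut := hB
  k4 := h4
  sub := hL.sub.trans Set.sdiff_subset
  mem i := ⟨hτ i, fun h => (hL.sub h).2 ⟨i, rfl⟩⟩
  inj := inj
  cn := hL.cn
  tch := hB.tch_both hτ inj hL
  out x hx y hy hxy := by
    by_contra hyτ
    exact hy.2 (hL.closed x hx y ⟨hy.1, hyτ⟩ hxy)
  co := hB.cn.diff_isComp (cn_range hadj) (by rintro _ ⟨i, rfl⟩; exact hτ i) hL

lemma inj_of_adj {τ : Fin 2 → V} (h : G.Adj (τ 0) (τ 1)) : Function.Injective τ := by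
  intro i j hij
  fin_cases i <;> fin_cases j
  · rfl
  · exact absurd hij h.ne
  · exact absurd hij h.ne'
  · rfl

lemma edge_compose {V' : Type} {G' : SimpleGraph V'} {Q : Type 1} {r : Q → Q → Prop}
    {lab : V → Q} {lab' : V' → Q} {B : Set V} {B' : Set V'} {τ : Fin 2 → V} {τ' : Fin 2 → V'}
    (hτ : ∀ i, τ i ∈ B) (hτ' : ∀ i, τ' i ∈ B') (h : G.Adj (τ 0) (τ 1))
    (h' : G'.Adj (τ' 0) (τ' 1))
    (hl : ∀ i, r (lab (τ i)) (lab' (τ' i)))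
    (φ : {L // IsComp G (B \ Set.range τ) L} → {L // IsComp G' (B' \ Set.range τ') L})
    (hφ : Function.Injective φ)
    (hM : ∀ L, ∃ μ, Mod r false G lab L.1 τ G' lab' (φ L).1 τ' μ) (σ : Fin 0 → V)
    (σ' : Fin 0 → V') : ∃ μ, Mod r false G lab B σ G' lab' B' σ' μ := by
  classical
  choose M hM using hM
  have inj := inj_of_adj h
  have inj' := inj_of_adj h'
  have hσ : Set.range σ = ∅ := Set.range_eq_empty σ
  have hσ' : Set.range σ' = ∅ := Set.range_eq_empty σ'
  let ν : V → Set V' := fun a => if a = τ 0 then {τ' 0} else {τ' 1}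
  have hντ : ∀ i, ν (τ i) = {τ' i} := by
    intro i
    fin_cases i
    · simp [ν]
    · have : τ 1 ≠ τ 0 := h.ne'
      simp [ν, this]
  have hcore : Mod r false G lab (Set.range τ) σ G' lab' (Set.range τ') σ' ν := by
    refine ⟨?_, fun i => i.elim0, fun i => i.elim0, ?_, ?_, ?_, fun _ i => i.elim0, ?_⟩
    · rintro _ ⟨i, rfl⟩
      rw [hντ]
      exact Set.singleton_subset_iff.2 ⟨i, rfl⟩
    · rw [hσ, Set.union_empty]
      rintro _ ⟨i, rfl⟩
      rw [hντ]
      exact cn_singleton _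
    · rw [hσ, Set.union_empty]
      rintro _ ⟨i, rfl⟩ _ ⟨j, rfl⟩ hij
      rw [hντ, hντ]
      exact Set.disjoint_singleton.2 fun e => hij (congrArg τ (inj' e))
    · rw [hσ, Set.union_empty]
      rintro _ ⟨i, rfl⟩ _ ⟨j, rfl⟩ hij
      rw [hντ, hντ]
      have e1 : Tch G' {τ' i} {τ' j} ↔ G'.Adj (τ' i) (τ' j) := by simp [Tch]
      rw [e1]
      fin_cases i <;> fin_cases j
      · exact absurd rfl hij
      · exact ⟨fun _ => h, fun _ => h'⟩
      · exact ⟨fun _ => h.symm, fun _ => h'.symm⟩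
      · exact absurd rfl hij
    · rintro _ ⟨i, rfl⟩
      exact ⟨τ' i, by rw [hντ]; rfl, hl i⟩
  have hglue := Mod.glue (I := {L // IsComp G (B \ Set.range τ) L}) (KK := fun L => L.1)
    (T := fun _ => τ) (KK' := fun L => (φ L).1) (T' := fun _ => τ')
    (M := M) (bb := fun _ => false) (fun i => i.elim0) hcore hM
    (by rw [hσ, Set.union_empty]; exact fun _ j => ⟨j, rfl⟩)
    (by
      rw [hσ, Set.union_empty]
      exact fun L => Set.disjoint_left.2 fun y hy => (L.2.sub hy).2)
    (fun x y hxy => x.2.disjoint y.2 fun e => hxy (Subtype.ext e))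
    (by rw [hσ, Set.union_empty]; exact fun _ _ _ y hy _ => hy)
    (fun x y hxy => x.2.not_tch y.2 fun e => hxy (Subtype.ext e))
    (fun _ j => by rw [hντ]; rfl)
    (by
      rw [hσ', Set.union_empty]
      exact fun L => Set.disjoint_left.2 fun y hy => ((φ L).2.sub hy).2)
    (fun x y hxy => (φ x).2.disjoint (φ y).2 fun e => hxy (hφ (Subtype.ext e)))
    (by rw [hσ', Set.union_empty]; exact fun _ _ _ y hy _ => hy)
    (fun x y hxy => (φ x).2.not_tch (φ y).2 fun e => hxy (hφ (Subtype.ext e)))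
    (by simp)
  have hK : (Set.range τ ∪ ⋃ L : {L // IsComp G (B \ Set.range τ) L}, L.1) = B := by
    ext y
    constructor
    · rintro (⟨i, rfl⟩ | hy)
      · exact hτ i
      · obtain ⟨x, hx⟩ := Set.mem_iUnion.1 hy
        exact (x.2.sub hx).1
    · intro hy
      by_cases hyτ : y ∈ Set.range τ
      · exact Or.inl hyτ
      · obtain ⟨L, hL, hyL⟩ := exists_isComp (G := G) (Z := B \ Set.range τ) ⟨hy, hyτ⟩
        exact Or.inr (Set.mem_iUnion.2 ⟨⟨L, hL⟩, hyL⟩)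
  rw [hK] at hglue
  refine ⟨_, hglue.mono_target ?_⟩
  rintro y (⟨i, rfl⟩ | hy)
  · exact hτ' i
  · obtain ⟨x, hx⟩ := Set.mem_iUnion.1 hy
    exact ((φ x).2.sub hx).1

theorem k4free_block_pwo : LabelledPwo fun _ G K => NoCut G K ∧ ¬ HasK4 G K := by
  intro Q r _ S hS
  refine pwo_of_good fun f hf => ?_
  have key : ∀ i, ∃ τ : Fin 2 → (f i).V, (∀ j, τ j ∈ (f i).K) ∧ (f i).G.Adj (τ 0) (τ 1) := by
    intro i
    obtain ⟨a, ha⟩ := (hf i).1.1.cn.nonempty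
    obtain ⟨b, hb, hab⟩ := (hf i).1.1.exists_adj_mem ha
    refine ⟨![a, b], fun j => ?_, hab⟩
    fin_cases j
    exacts [ha, hb]
  choose τ hτ hadj using key
  let F : ℕ → Fam (Piece Q 2) := fun i =>
    ⟨{L // IsComp (f i).G ((f i).K \ Set.range (τ i)) L}, have := (f i).fin; inferInstance,
      fun L => ⟨(f i).V, (f i).fin, (f i).G, (f i).lab, L.1, τ i, inj_of_adj (hadj i),
        fun j h => (L.2.sub h).2 ⟨j, rfl⟩⟩⟩
  obtain ⟨i, j, hij, h0, h1, φ, hφ, hM⟩ := pwo_good (hS.prod (hS.prod (fam_pwo (sp_pwo hS))))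
    (fun i => ((f i).lab (τ i 0), (f i).lab (τ i 1), F i)) fun i => ⟨(hf i).2 _ (hτ i 0),
      (hf i).2 _ (hτ i 1), fun L => ⟨⟨_, sp_of_edge (hf i).1.1 (hf i).1.2 (hτ i) (hadj i)
        (inj_of_adj (hadj i)) L.2⟩, fun a ha => (hf i).2 a (L.2.sub ha).1⟩⟩
  refine ⟨i, j, hij, edge_compose (hτ i) (hτ j) (hadj i) (hadj j) (fun k => ?_) φ hφ hM _ _⟩
  fin_cases k
  exacts [h0, h1]

theorem k4free_pwo : LabelledPwo fun _ G K => Cn G K ∧ ¬ HasK4 G K := by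
  intro Q r _ S hS
  refine Set.PartiallyWellOrderedOn.mono (connected_pwo_of_blocks k4free_block_pwo Q r S hS) ?_
  rintro P ⟨⟨h1, h2⟩, h3⟩
  exact ⟨⟨h1, fun B hB hBc => ⟨hBc, fun h => h2 (h.mono hB)⟩⟩, h3⟩

end K4Free

section Degree

variable {V : Type} {G : SimpleGraph V}

/-- The neighbours of `u` in `U`. -/
def nb (G : SimpleGraph V) (U : Set V) (u : V) : Set V := {x | x ∈ U ∧ G.Adj u x}

lemma HasK4.four_le [Finite V] {U : Set V} (h : HasK4 G U) : 4 ≤ U.ncard := by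
  obtain ⟨A, h1, h2, h3⟩ := h
  choose x hx using fun i => (h2 i).nonempty
  have hinj : Function.Injective x := fun i j hij => by
    by_contra hne
    exact Set.disjoint_left.1 (h3 i j hne).1 (hx i) (hij ▸ hx j)
  have : (Set.range x).ncard = 4 := by
    rw [← Set.image_univ, Set.ncard_image_of_injective _ hinj, Set.ncard_univ]
    simp
  rw [← this]
  refine Set.ncard_le_ncard ?_ (Set.toFinite _)
  rintro _ ⟨i, rfl⟩
  exact h1 i (hx i)

lemma ncard_range_fin_two_le {τ : Fin 2 → V} : (Set.range τ).ncard ≤ 2 := by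
  rw [← Set.image_univ]
  refine (Set.ncard_image_le (Set.toFinite _)).trans ?_
  rw [Set.ncard_univ]
  simp

lemma SP.exists_deg_le_two [Finite V] (n : ℕ) : ∀ {U K : Set V} {τ : Fin 2 → V}, K.ncard = n →
    SP G U K τ → ∃ u ∈ K, (nb G U u).ncard ≤ 2 := by
  induction n using Nat.strong_induction_on with
  | _ n ih =>
    intro U K τ hn h
    obtain ⟨m, hm⟩ := h.exists_mid
    by_cases hK : ∃ a, a ∈ K \ {m}
    · obtain ⟨a, ha⟩ := hK
      obtain ⟨L, hL, -⟩ := exists_isComp (G := G) ha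
      obtain ⟨i, hi⟩ := h.exists_tch hm hL
      have hlt : L.ncard < n := by
        rw [← hn]
        exact Set.ncard_lt_ncard ⟨fun a ha => (hL.sub ha).1,
          fun h' => (hL.sub (h' hm.mem)).2 rfl⟩ (Set.toFinite K)
      obtain ⟨u, hu, hu'⟩ := ih _ hlt rfl (h.sub_piece hm hL hi)
      exact ⟨u, (hL.sub hu).1, hu'⟩
    · refine ⟨m, hm.mem, (Set.ncard_le_ncard ?_ (Set.toFinite _)).trans
        (ncard_range_fin_two_le (τ := τ))⟩
      intro x hx
      refine h.out m hm.mem x ⟨hx.1, fun hxK => hK ⟨x, hxK, ?_⟩⟩ hx.2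
      exact hx.2.ne'

lemma exists_deg_le_two [Finite V] (n : ℕ) : ∀ {H : Set V} {p a : V}, H.ncard = n → Cn G H →
    ¬ HasK4 G H → p ∈ H → a ∈ H → a ≠ p → ∃ u ∈ H, u ≠ p ∧ (nb G H u).ncard ≤ 2 := by
  induction n using Nat.strong_induction_on with
  | _ n ih =>
    intro H p a hn hH h4 hp ha hap
    by_cases hcut : ∃ c ∈ H, ¬ Cn G (H \ {c})
    · obtain ⟨c, hc, hcn⟩ := hcut
      obtain ⟨y, hy, hpy⟩ : ∃ y ∈ H \ {c}, p ∉ cmp G (H \ {c}) y := by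
        by_cases hpc : p = c
        · exact ⟨a, ⟨ha, fun e => hap (e.trans hpc.symm)⟩, fun h' =>
            ((cmp_isComp (G := G) (Z := H \ {c}) (a := a)
              ⟨ha, fun e => hap (e.trans hpc.symm)⟩).sub h').2 hpc⟩
        · have hpH : p ∈ H \ {c} := ⟨hp, hpc⟩
          have hcp := cmp_isComp (G := G) hpH
          obtain ⟨y, hy, hyp⟩ : ∃ y ∈ H \ {c}, y ∉ cmp G (H \ {c}) p := by
            by_contra hno
            push Not at hno
            exact hcn ((hcp.sub.antisymm hno) ▸ hcp.cn)
          refine ⟨y, hy, fun h' => hyp ?_⟩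
          rw [hcp.eq (cmp_isComp hy) ⟨p, mem_cmp hpH, h'⟩]
          exact mem_cmp hy
      have hL := cmp_isComp (G := G) hy
      set L := cmp G (H \ {c}) y
      have hLc : Tch G L {c} :=
        (hL.tch hH ⟨c, rfl, hc⟩).mono subset_rfl Set.inter_subset_left
      have hsub : L ∪ {c} ⊆ H := Set.union_subset (hL.sub.trans Set.sdiff_subset)
        (Set.singleton_subset_iff.2 hc)
      have hlt : (L ∪ {c}).ncard < n := by
        rw [← hn]
        refine Set.ncard_lt_ncard ⟨hsub, fun h' => hcn ?_⟩ (Set.toFinite H)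
        have : H \ {c} = L := by
          refine Set.Subset.antisymm (fun x hx => (h' hx.1).resolve_right hx.2) hL.sub
        rw [this]
        exact hL.cn
      obtain ⟨u, hu, huc, hdeg⟩ := ih _ hlt (H := L ∪ {c}) (p := c) (a := y) rfl
        (hL.cn.union (cn_singleton c) hLc)
        (fun h => h4 (h.mono hsub)) (Or.inr rfl) (Or.inl (mem_cmp hy)) hy.2
      have huL : u ∈ L := hu.resolve_right huc
      refine ⟨u, hsub hu, fun e => hpy (e ▸ huL), le_trans ?_ hdeg⟩
      refine Set.ncard_le_ncard (fun x hx => ⟨?_, hx.2⟩) (Set.toFinite _)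
      by_cases hxc : x = c
      · exact Or.inr hxc
      · exact Or.inl (hL.closed u huL x ⟨hx.1, hxc⟩ hx.2)
    · push Not at hcut
      have hNC : NoCut G H := by
        refine ⟨hH, ⟨a, ha, p, hp, hap⟩, fun b => ?_⟩
        by_cases hb : b ∈ H
        · exact hcut b hb
        · rwa [Set.sdiff_singleton_eq_self hb]
      obtain ⟨q, hq, hpq⟩ := hNC.exists_adj_mem hp
      let τ : Fin 2 → V := ![p, q]
      have hτ : ∀ i, τ i ∈ H := by
        intro i
        fin_cases i
        exacts [hp, hq]
      have hpτ : p ∈ Set.range τ := ⟨0, rfl⟩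
      by_cases hne : ∃ x, x ∈ H \ Set.range τ
      · obtain ⟨x, hx⟩ := hne
        obtain ⟨L, hL, -⟩ := exists_isComp (G := G) hx
        obtain ⟨u, hu, hdeg⟩ := SP.exists_deg_le_two _ rfl
          (sp_of_edge hNC h4 hτ hpq (inj_of_adj hpq) hL)
        exact ⟨u, (hL.sub hu).1, fun e => (hL.sub hu).2 (e ▸ hpτ), hdeg⟩
      · refine ⟨q, hq, hpq.ne', (Set.ncard_le_ncard ?_ (Set.toFinite _)).trans
          (ncard_range_fin_two_le (τ := τ))⟩
        intro x hx
        by_contra hxτ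
        exact hne ⟨x, hx.1, hxτ⟩

/-- A set with a `K₄` minor none of whose vertices can be deleted. -/
def Crit (G : SimpleGraph V) (S : Set V) : Prop :=
  HasK4 G S ∧ ∀ u ∈ S, ¬ HasK4 G (S \ {u})

lemma exists_deg_le_three [Finite V] {B : Set V} (hB : NoCut G B) (h : Crit G B) :
    ∃ u ∈ B, (nb G B u).ncard ≤ 3 := by
  obtain ⟨v, hv⟩ := hB.cn.nonempty
  have h4 := h.1.four_le
  have h3 : 1 < (B \ {v}).ncard := by
    have := Set.ncard_sdiff_singleton_add_one hv (Set.toFinite B)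
    omega
  obtain ⟨a, ha, p, hp, hap⟩ := (Set.one_lt_ncard (Set.toFinite _)).1 h3
  obtain ⟨u, hu, -, hdeg⟩ := exists_deg_le_two _ rfl (hB.del v) (h.2 v hv) hp ha hap
  refine ⟨u, hu.1, ?_⟩
  have hsub : nb G B u ⊆ insert v (nb G (B \ {v}) u) := by
    intro x hx
    by_cases hxv : x = v
    · exact Or.inl hxv
    · exact Or.inr ⟨⟨hx.1, hxv⟩, hx.2⟩
  exact (Set.ncard_le_ncard hsub (Set.toFinite _)).trans
    ((Set.ncard_insert_le _ _).trans (by omega))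

end Degree

section CriticalPwo

/-- The order on marks where the absence of a mark is least. -/
def OLE (x y : Option (Fin 3)) : Prop := x = none ∨ x = y

instance : IsPreorder (Option (Fin 3)) OLE where
  refl _ := Or.inr rfl
  trans := by
    rintro x y z (h | h) (h' | h')
    · exact Or.inl h
    · exact Or.inl h
    · exact Or.inl (h.trans h')
    · exact Or.inr (h.trans h')

variable {Q : Type 1} {r : Q → Q → Prop}

/-- The order on marked labels. -/
def MarkLE (r : Q → Q → Prop) (x y : Q × Option (Fin 3)) : Prop := r x.1 y.1 ∧ OLE x.2 y.2

instance [IsPreorder Q r] : IsPreorder (Q × Option (Fin 3)) (MarkLE r) where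
  refl _ := ⟨refl_of r _, refl_of OLE _⟩
  trans _ _ _ h h' := ⟨trans_of r h.1 h'.1, trans_of OLE h.2 h'.2⟩

lemma exists_marks {V : Type} [Finite V] (N : Set V) (hN : N.ncard ≤ 3) :
    ∃ g : V → Option (Fin 3), (∀ x, g x ≠ none ↔ x ∈ N) ∧
      ∀ x ∈ N, ∀ y ∈ N, g x = g y → x = y := by
  classical
  have hc : Nat.card N ≤ Nat.card (Fin 3) := by
    rw [Nat.card_coe_set_eq]
    simpa using hN
  have := Fintype.ofFinite N
  obtain ⟨e⟩ : Nonempty (N ↪ Fin 3) := by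
    refine Function.Embedding.nonempty_of_card_le ?_
    rwa [← Nat.card_eq_fintype_card, ← Nat.card_eq_fintype_card]
  refine ⟨fun x => if h : x ∈ N then some (e ⟨x, h⟩) else none, fun x => ?_, fun x hx y hy h => ?_⟩
  · by_cases h : x ∈ N <;> simp [h]
  · simp only [dif_pos hx, dif_pos hy, Option.some.injEq] at h
    exact congrArg Subtype.val (e.injective h)

lemma mark_compose {V V' : Type} {G : SimpleGraph V} {G' : SimpleGraph V'} {lab : V → Q}
    {lab' : V' → Q} {K : Set V} {K' : Set V'} {u : V} {u' : V'} (hu' : u' ∈ K')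
    {g : V → Option (Fin 3)} {g' : V' → Option (Fin 3)}
    (hg : ∀ x, g x ≠ none ↔ x ∈ nb G K u) (hg' : ∀ x, g' x ≠ none ↔ x ∈ nb G' K' u')
    (hinj' : ∀ x ∈ nb G' K' u', ∀ y ∈ nb G' K' u', g' x = g' y → x = y)
    (hmarks : ∀ j, (∃ x, g x = some j) ↔ ∃ x, g' x = some j)
    (hl : r (lab u) (lab' u')) {σ : Fin 0 → V} {σ' : Fin 0 → V'} {ν : V → Set V'}
    (hν : Mod (MarkLE r) false G (fun x => (lab x, g x)) (K \ {u}) σ G' (fun x => (lab' x, g' x))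
      (K' \ {u'}) σ' ν) : ∃ μ, Mod r false G lab K σ G' lab' K' σ' μ := by
  classical
  have hσ : Set.range σ = ∅ := Set.range_eq_empty σ
  have hcn := hν.cn
  have hdisj := hν.disj
  have hadj := hν.adj
  rw [hσ, Set.union_empty] at hcn hdisj hadj
  have hu'ν : ∀ a ∈ K \ {u}, u' ∉ ν a := fun a ha h => (hν.sub a ha h).2 rfl
  have key : ∀ a ∈ K \ {u}, (Tch G' (ν a) {u'} ↔ G.Adj a u) := by
    intro a ha
    constructor
    · intro h
      obtain ⟨x, hx, hxu⟩ := tch_singleton_right.1 h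
      have hxn : x ∈ nb G' K' u' := ⟨(hν.sub a ha hx).1, hxu.symm⟩
      obtain ⟨j, hj⟩ := Option.ne_none_iff_exists'.1 ((hg' x).2 hxn)
      obtain ⟨c, hc⟩ := (hmarks j).2 ⟨x, hj⟩
      have hcn : c ∈ nb G K u := (hg c).1 (by simp [hc])
      have hcK : c ∈ K \ {u} := ⟨hcn.1, hcn.2.ne'⟩
      obtain ⟨y, hy, -, hy'⟩ := hν.lab c hcK
      have hyj : g' y = some j := by
        rcases hy' with h' | h'
        · simp [hc] at h'
        · simpa [hc] using h'.symm
      have hyn : y ∈ nb G' K' u' := (hg' y).1 (by simp [hyj])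
      have hyx : y = x := hinj' y hyn x hxn (by rw [hyj, hj])
      by_cases hac : a = c
      · rw [hac]
        exact hcn.2.symm
      · exact absurd (hyx ▸ hy) (Set.disjoint_left.1 (hdisj a ha c hcK hac) hx)
    · intro h
      have han : a ∈ nb G K u := ⟨ha.1, h.symm⟩
      obtain ⟨x, hx, -, hx'⟩ := hν.lab a ha
      have hne := (hg a).2 han
      rcases hx' with h' | h'
      · exact absurd h' hne
      · have : x ∈ nb G' K' u' := (hg' x).1 (by rw [← show g a = g' x from h']; exact hne)
        exact tch_singleton_right.2 ⟨x, hx, this.2.symm⟩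
  refine ⟨fun a => if a = u then {u'} else ν a, ?_, fun i => i.elim0, fun i => i.elim0, ?_, ?_, ?_,
    fun _ i => i.elim0, ?_⟩
  · intro a ha
    split_ifs with h
    · exact Set.singleton_subset_iff.2 hu'
    · exact (hν.sub a ⟨ha, h⟩).trans Set.sdiff_subset
  · rw [hσ, Set.union_empty]
    intro a ha
    split_ifs with h
    · exact cn_singleton _
    · exact hcn a ⟨ha, h⟩
  · rw [hσ, Set.union_empty]
    intro a ha c hc hac
    split_ifs with h1 h2 h2
    · exact absurd (h1.trans h2.symm) hac
    · exact Set.disjoint_singleton_left.2 (hu'ν c ⟨hc, h2⟩)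
    · exact Set.disjoint_singleton_right.2 (hu'ν a ⟨ha, h1⟩)
    · exact hdisj a ⟨ha, h1⟩ c ⟨hc, h2⟩ hac
  · rw [hσ, Set.union_empty]
    intro a ha c hc hac
    split_ifs with h1 h2 h2
    · exact absurd (h1.trans h2.symm) hac
    · rw [tch_comm, key c ⟨hc, h2⟩, h1, G.adj_comm]
    · rw [key a ⟨ha, h1⟩, h2]
    · exact hadj a ⟨ha, h1⟩ c ⟨hc, h2⟩ hac
  · intro a ha
    split_ifs with h
    · exact ⟨u', rfl, h ▸ hl⟩
    · obtain ⟨x, hx, hx', -⟩ := hν.lab a ⟨ha, h⟩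
      exact ⟨x, hx, hx'⟩

theorem critical_pwo : LabelledPwo fun _ G K => NoCut G K ∧ Crit G K := by
  intro Q r _ S hS
  refine pwo_of_good fun f hf => ?_
  have key : ∀ i, ∃ u ∈ (f i).K, (nb (f i).G (f i).K u).ncard ≤ 3 := fun i => by
    have := (f i).fin
    exact exists_deg_le_three (hf i).1.1 (hf i).1.2
  choose u hu hdeg using key
  have key2 : ∀ i, ∃ g : (f i).V → Option (Fin 3),
      (∀ x, g x ≠ none ↔ x ∈ nb (f i).G (f i).K (u i)) ∧
      ∀ x ∈ nb (f i).G (f i).K (u i), ∀ y ∈ nb (f i).G (f i).K (u i), g x = g y → x = y :=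
    fun i => by
      have := (f i).fin
      exact exists_marks _ (hdeg i)
  choose g hg hinj using key2
  let F : ℕ → Piece (Q × Option (Fin 3)) 0 := fun i =>
    ⟨(f i).V, (f i).fin, (f i).G, fun x => ((f i).lab x, g i x), (f i).K \ {u i}, (f i).τ,
      fun j => j.elim0, fun j => j.elim0⟩
  have hO : (Set.univ : Set (Option (Fin 3))).PartiallyWellOrderedOn OLE :=
    Set.finite_univ.partiallyWellOrderedOn
  have hM : (S ×ˢ (Set.univ : Set (Option (Fin 3)))).PartiallyWellOrderedOn (MarkLE r) :=
    hS.prod hO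
  have hE : (Set.univ : Set (Set (Fin 3))).PartiallyWellOrderedOn Eq :=
    Set.finite_univ.partiallyWellOrderedOn
  obtain ⟨i, j, hij, h1, h2, ν, hν⟩ := pwo_good (hE.prod (hS.prod (k4free_pwo _ (MarkLE r) _ hM)))
    (fun i => ({k | ∃ x, g i x = some k}, (f i).lab (u i), F i)) fun i => ⟨trivial,
      (hf i).2 _ (hu i), ⟨(hf i).1.1.del (u i), (hf i).1.2.2 _ (hu i)⟩,
      fun a ha => ⟨(hf i).2 a ha.1, trivial⟩⟩
  exact ⟨i, j, hij, mark_compose (hu j) (hg i) (hg j) (hinj j)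
    (fun k => Set.ext_iff.1 h1 k) h2 hν⟩

end CriticalPwo

section Hats

variable {V : Type} {G : SimpleGraph V}

/-- A family of four sets forming a model of `K₄`. -/
def K4F (G : SimpleGraph V) (A : Fin 4 → Set V) : Prop :=
  (∀ i, Cn G (A i)) ∧ ∀ i j, i ≠ j → Disjoint (A i) (A j) ∧ Tch G (A i) (A j)

/-- `U` contains no model of `K₄` together with a connected set touching exactly two bags. -/
def NoHat (G : SimpleGraph V) (U : Set V) : Prop :=
  ∀ A : Fin 4 → Set V, K4F G A → (∀ i, A i ⊆ U) → ∀ E ⊆ U, Cn G E → (∀ i, Disjoint E (A i)) →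
    ∀ i j, i ≠ j → Tch G E (A i) → Tch G E (A j) → ∃ k, k ≠ i ∧ k ≠ j ∧ Tch G E (A k)

lemma NoHat.mono {U U' : Set V} (h : NoHat G U) (hU : U' ⊆ U) : NoHat G U' :=
  fun A hA hAU E hE => h A hA (fun i => (hAU i).trans hU) E (hE.trans hU)

/-- Replacing a single bag of a model of `K₄`. -/
lemma K4F.update {A : Fin 4 → Set V} (h : K4F G A) (i : Fin 4) {X : Set V} (hX : Cn G X)
    (hXA : ∀ j, j ≠ i → Disjoint X (A j) ∧ Tch G X (A j)) :
    K4F G (Function.update A i X) := by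
  refine ⟨fun j => ?_, fun j k hjk => ?_⟩
  · by_cases hj : j = i
    · subst hj
      simpa using hX
    · simpa [hj] using h.1 j
  · by_cases hj : j = i
    · subst hj
      simpa [Function.update_of_ne hjk.symm] using hXA k hjk.symm
    · by_cases hk : k = i
      · subst hk
        simpa [hj] using ⟨(hXA j hjk).1.symm, (hXA j hjk).2.symm⟩
      · simpa [hj, hk] using h.2 j k hjk

lemma K4F.cn_iUnion {A : Fin 4 → Set V} (h : K4F G A) (J : Set (Fin 4)) (hJ : J.Nonempty) :
    Cn G (⋃ i ∈ J, A i) := by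
  obtain ⟨i, hi⟩ := hJ
  have : (⋃ i ∈ J, A i) = A i ∪ ⋃ i ∈ J, A i :=
    (Set.union_eq_self_of_subset_left (Set.subset_biUnion_of_mem hi)).symm
  rw [this]
  refine (h.1 i).star fun a ha => ?_
  obtain ⟨j, hj, haj⟩ := Set.mem_iUnion₂.1 ha
  rw [← this]
  obtain ⟨x, hx⟩ := (h.1 i).nonempty
  by_cases hij : i = j
  · subst hij
    exact ⟨A i, Set.subset_biUnion_of_mem hi, h.1 i, haj, x, hx, hx⟩
  · exact ⟨A i ∪ A j, Set.union_subset (Set.subset_biUnion_of_mem hi)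
      (Set.subset_biUnion_of_mem hj), (h.1 i).union (h.1 j) (h.2 i j hij).2, Or.inr haj, x,
      Or.inl hx, hx⟩

lemma fin_four_exists_ne (i : Fin 4) : ∃ j, j ≠ i := by
  revert i
  decide

lemma Crit.noCut {S : Set V} (h : Crit G S) : NoCut G S := by
  obtain ⟨⟨A, hAS, hA⟩, hdel⟩ := h
  change K4F G A at hA
  have hcov : ∀ x ∈ S, ∃ i, x ∈ A i := by
    intro x hx
    by_contra hno
    push Not at hno
    exact hdel x hx ⟨A, fun i y hy => ⟨hAS i hy, fun e => hno i (e ▸ hy)⟩, hA⟩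
  have hS : S = ⋃ i ∈ (Set.univ : Set (Fin 4)), A i := by
    ext x
    simp only [Set.mem_univ, Set.iUnion_true, Set.mem_iUnion]
    exact ⟨hcov x, fun ⟨i, hi⟩ => hAS i hi⟩
  have hcn : Cn G S := hS ▸ hA.cn_iUnion _ ⟨0, trivial⟩
  obtain ⟨x0, hx0⟩ := (hA.1 0).nonempty
  obtain ⟨x1, hx1⟩ := (hA.1 1).nonempty
  refine ⟨hcn, ⟨x0, hAS 0 hx0, x1, hAS 1 hx1, fun e =>
    Set.disjoint_left.1 (hA.2 0 1 (by decide)).1 hx0 (e ▸ hx1)⟩, fun b => ?_⟩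
  by_cases hb : b ∈ S
  swap
  · rwa [Set.sdiff_singleton_eq_self hb]
  obtain ⟨i, hi⟩ := hcov b hb
  have hR := hA.cn_iUnion {j | j ≠ i} (fin_four_exists_ne i)
  have hSb : S \ {b} = (⋃ j ∈ {j | j ≠ i}, A j) ∪ (A i \ {b}) := by
    ext x
    constructor
    · intro hx
      obtain ⟨j, hj⟩ := hcov x hx.1
      by_cases hji : j = i
      · exact Or.inr ⟨hji ▸ hj, hx.2⟩
      · exact Or.inl (Set.mem_iUnion₂.2 ⟨j, hji, hj⟩)
    · rintro (hx | hx)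
      · obtain ⟨j, hji, hj⟩ := Set.mem_iUnion₂.1 hx
        refine ⟨hAS j hj, fun e => ?_⟩
        rw [Set.mem_singleton_iff] at e
        exact Set.disjoint_left.1 (hA.2 j i hji).1 hj (e ▸ hi)
      · exact ⟨hAS i hx.1, hx.2⟩
  rw [hSb]
  refine hR.union_of fun Y hY ⟨y, hy⟩ _ hcl => ?_
  by_contra hno
  have hcnY : Cn G (A i \ Y) := (hA.1 i).diff_closed (cn_singleton b)
    (Set.singleton_subset_iff.2 hi) hY hcl
  have hA' : K4F G (Function.update A i (A i \ Y)) := by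
    refine hA.update i hcnY fun j hj => ⟨(hA.2 i j hj.symm).1.mono_left Set.sdiff_subset, ?_⟩
    obtain ⟨x, hx, z, hz, hxz⟩ := (hA.2 i j hj.symm).2
    exact ⟨x, ⟨hx, fun hxY => hno ⟨x, hxY, z, Set.mem_iUnion₂.2 ⟨j, hj, hz⟩, hxz⟩⟩, z, hz, hxz⟩
  refine hdel y (hAS i (hY hy).1) ⟨_, fun j => ?_, hA'⟩
  by_cases hj : j = i
  · subst hj
    rw [Function.update_self]
    exact fun x hx => ⟨hAS j hx.1, fun e => hx.2 (by rw [Set.mem_singleton_iff.1 e]; exact hy)⟩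
  · rw [Function.update_of_ne hj]
    refine fun x hx => ⟨hAS j hx, fun e => ?_⟩
    rw [Set.mem_singleton_iff] at e
    exact Set.disjoint_left.1 (hA.2 j i hj).1 hx (e ▸ (hY hy).1)

lemma HasK4.exists_spanning [Finite V] {B : Set V} (hB : Cn G B) (h : HasK4 G B) :
    ∃ A, K4F G A ∧ (∀ i, A i ⊆ B) ∧ ∀ x ∈ B, ∃ i, x ∈ A i := by
  obtain ⟨A₀, hA₀, h₀⟩ := h
  obtain ⟨A, -, hmax⟩ := (Set.toFinite {A : Fin 4 → Set V | K4F G A ∧ ∀ i, A i ⊆ B}).exists_le_maximal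
    (a := A₀) ⟨h₀, hA₀⟩
  obtain ⟨hA, hAB⟩ := hmax.1
  refine ⟨A, hA, hAB, fun x hx => ?_⟩
  by_contra hno
  push Not at hno
  obtain ⟨y, hy, z, hz, hzA, hyz⟩ := hB.exists_adj (X := ⋃ i, A i) (Set.iUnion_subset hAB)
    ((hA.1 0).nonempty.mono (Set.subset_iUnion A 0)) hx (by simpa using hno)
  obtain ⟨i, hi⟩ := Set.mem_iUnion.1 hy
  have hzA' : ∀ j, z ∉ A j := by simpa using hzA
  have hle : A ≤ Function.update A i (insert z (A i)) := by
    intro j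
    by_cases hj : j = i
    · subst hj
      rw [Function.update_self]
      exact Set.subset_insert _ _
    · rw [Function.update_of_ne hj]
  have hnew : K4F G (Function.update A i (insert z (A i))) :=
    hA.update i ((hA.1 i).insert_of_adj hi hyz.symm) fun j hj =>
      ⟨Set.disjoint_insert_left.2 ⟨hzA' j, (hA.2 i j hj.symm).1⟩,
        (hA.2 i j hj.symm).2.mono (Set.subset_insert _ _) subset_rfl⟩
  have := hmax.2 (y := Function.update A i (insert z (A i))) ⟨hnew, fun j => by
    by_cases hj : j = i
    · subst hj
      rw [Function.update_self]
      exact Set.insert_subset hz (hAB j)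
    · rw [Function.update_of_ne hj]
      exact hAB j⟩ hle i
  rw [Function.update_self] at this
  exact hzA' i (this (Set.mem_insert _ _))

lemma prop_split (p q : Fin 4 → Prop) (i : Fin 4) (h : ∀ l, l ≠ i → p l ∨ q l)
    (hp : ∃ l, l ≠ i ∧ p l) (hq : ∃ l, l ≠ i ∧ q l) :
    (∃ j, j ≠ i ∧ p j ∧ ∀ l, l ≠ i → l ≠ j → q l) ∨
      ∃ j, j ≠ i ∧ q j ∧ ∀ l, l ≠ i → l ≠ j → p l := by
  by_cases hm : ∃ m, m ≠ i ∧ ¬ p m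
  · obtain ⟨m, hmi, hm⟩ := hm
    by_cases hm' : ∃ m', m' ≠ i ∧ m' ≠ m ∧ ¬ p m'
    · obtain ⟨m', hmi', hmm, hm'⟩ := hm'
      obtain ⟨a, hai, ha⟩ := hp
      refine Or.inl ⟨a, hai, ha, fun l hli hla => ?_⟩
      have h1 : a ≠ m := fun e => hm (e ▸ ha)
      have h2 : a ≠ m' := fun e => hm' (e ▸ ha)
      have : l = m ∨ l = m' := by omega
      rcases this with rfl | rfl
      · exact (h l hli).resolve_left hm
      · exact (h l hli).resolve_left hm'
    · push Not at hm'
      exact Or.inr ⟨m, hmi, (h m hmi).resolve_left hm, hm'⟩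
  · push Not at hm
    obtain ⟨b, hbi, hb⟩ := hq
    exact Or.inr ⟨b, hbi, hb, fun l hli _ => hm l hli⟩

lemma hat_split [Finite V] {U B E : Set V} (hU : NoHat G U) (hBU : B ⊆ U) (hEU : E ⊆ U)
    (hB : NoCut G B) (h4 : HasK4 G B) (hE : Cn G E) (hd : Disjoint E B) {x y : V} (hx : x ∈ B)
    (hy : y ∈ B) (hxy : x ≠ y) (hN : ∀ b ∈ B, Tch G E {b} ↔ b = x ∨ b = y) : False := by
  obtain ⟨A, hA, hAB, hcov⟩ := h4.exists_spanning hB.cn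
  have hEx : ∀ {X}, x ∈ X → Tch G E X := fun h =>
    ((hN x hx).2 (Or.inl rfl)).mono subset_rfl (Set.singleton_subset_iff.2 h)
  have hEy : ∀ {X}, y ∈ X → Tch G E X := fun h =>
    ((hN y hy).2 (Or.inr rfl)).mono subset_rfl (Set.singleton_subset_iff.2 h)
  have hEno : ∀ {X : Set V}, X ⊆ B → x ∉ X → y ∉ X → ¬ Tch G E X := by
    rintro X hX hxX hyX ⟨e, he, b, hb, heb⟩
    rcases (hN b (hX hb)).1 (tch_singleton_right.2 ⟨e, he, heb⟩) with rfl | rfl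
    exacts [hxX hb, hyX hb]
  have hAE : ∀ {X : Set V}, X ⊆ B → Disjoint E X := fun h => hd.mono_right h
  obtain ⟨i, hi⟩ := hcov x hx
  obtain ⟨j, hj⟩ := hcov y hy
  have only : ∀ {z k l}, z ∈ A k → l ≠ k → z ∉ A l := fun hz hlk hz' =>
    Set.disjoint_left.1 (hA.2 _ _ hlk).1 hz' hz
  by_cases hij : i = j
  swap
  · obtain ⟨k, hki, hkj, hk⟩ := hU A hA (fun i => (hAB i).trans hBU) E hEU hE
      (fun i => hAE (hAB i)) i j hij (hEx hi) (hEy hj)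
    exact hEno (hAB k) (only hi hki) (only hj hkj) hk
  subst hij
  have finish : ∀ X Y : Set V, ∀ x' y', (x' = x ∧ y' = y ∨ x' = y ∧ y' = x) → x' ∈ X → y' ∈ Y →
      X ∪ Y = A i → Disjoint X Y → Cn G X → Cn G Y → Tch G X Y → ∀ j, j ≠ i → Tch G X (A j) →
      (∀ l, l ≠ i → l ≠ j → Tch G Y (A l)) → False := by
    intro X Y x' y' hxy' hxX hyY hXY hdXY hXc hYc htXY j hji hXj hY
    have hXi : X ⊆ A i := hXY ▸ Set.subset_union_left
    have hYi : Y ⊆ A i := hXY ▸ Set.subset_union_right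
    let A' := Function.update (Function.update A i Y) j (X ∪ A j)
    have hij' : i ≠ j := hji.symm
    have hA'i : A' i = Y := by simp [A', hij']
    have hA'j : A' j = X ∪ A j := by simp [A']
    have hA'l : ∀ l, l ≠ i → l ≠ j → A' l = A l := fun l h1 h2 => by simp [A', h1, h2]
    have hK : K4F G A' := by
      have hpair : ∀ l, l ≠ i → l ≠ j → (Disjoint Y (A l) ∧ Tch G Y (A l)) ∧
          Disjoint (X ∪ A j) (A l) ∧ Tch G (X ∪ A j) (A l) := fun l hli hlj =>
        ⟨⟨(hA.2 i l hli.symm).1.mono_left hYi, hY l hli hlj⟩,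
          Set.disjoint_union_left.2 ⟨(hA.2 i l hli.symm).1.mono_left hXi, (hA.2 j l hlj.symm).1⟩,
          (hA.2 j l hlj.symm).2.mono Set.subset_union_right subset_rfl⟩
      have hij2 : Disjoint Y (X ∪ A j) ∧ Tch G Y (X ∪ A j) :=
        ⟨Set.disjoint_union_right.2 ⟨hdXY.symm, (hA.2 i j hij').1.mono_left hYi⟩,
          htXY.symm.mono subset_rfl Set.subset_union_left⟩
      refine ⟨fun l => ?_, fun l k hlk => ?_⟩
      · by_cases hli : l = i
        · rw [hli, hA'i]
          exact hYc
        · by_cases hlj : l = j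
          · rw [hlj, hA'j]
            exact hXc.union (hA.1 j) hXj
          · rw [hA'l l hli hlj]
            exact hA.1 l
      · have hsymm : ∀ {X Y : Set V}, Disjoint X Y ∧ Tch G X Y → Disjoint Y X ∧ Tch G Y X :=
          fun h => ⟨h.1.symm, h.2.symm⟩
        by_cases hli : l = i
        · by_cases hkj : k = j
          · rw [hli, hkj, hA'i, hA'j]
            exact hij2
          · have hki : k ≠ i := fun e => hlk (hli.trans e.symm)
            rw [hli, hA'i, hA'l k hki hkj]
            exact (hpair k hki hkj).1
        · by_cases hlj : l = j
          · by_cases hki : k = i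
            · rw [hlj, hki, hA'i, hA'j]
              exact hsymm hij2
            · have hkj : k ≠ j := fun e => hlk (hlj.trans e.symm)
              rw [hlj, hA'j, hA'l k hki hkj]
              exact (hpair k hki hkj).2
          · rw [hA'l l hli hlj]
            by_cases hki : k = i
            · rw [hki, hA'i]
              exact hsymm (hpair l hli hlj).1
            · by_cases hkj : k = j
              · rw [hkj, hA'j]
                exact hsymm (hpair l hli hlj).2
              · rw [hA'l k hki hkj]
                exact hA.2 l k hlk
    have hsub : ∀ l, A' l ⊆ B := by
      intro l
      by_cases hli : l = i
      · rw [hli, hA'i]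
        exact hYi.trans (hAB i)
      · by_cases hlj : l = j
        · rw [hlj, hA'j]
          exact Set.union_subset (hXi.trans (hAB i)) (hAB j)
        · rw [hA'l l hli hlj]
          exact hAB l
    have htch : Tch G E (A' i) ∧ Tch G E (A' j) := by
      rw [hA'i, hA'j]
      rcases hxy' with ⟨rfl, rfl⟩ | ⟨rfl, rfl⟩
      · exact ⟨hEy hyY, hEx (Or.inl hxX)⟩
      · exact ⟨hEx hyY, hEy (Or.inl hxX)⟩
    obtain ⟨k, hki, hkj, hk⟩ := hU A' hK (fun l => (hsub l).trans hBU) E hEU hE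
      (fun l => hAE (hsub l)) i j hij' htch.1 htch.2
    rw [hA'l k hki hkj] at hk
    exact hEno (hAB k) (only hi hki) (only hj hki) hk
  obtain ⟨X, Y, hXi, hYi, hdXY, hXc, hYc, ⟨x', hx'⟩, ⟨x1, hx1⟩, ⟨y', hy'⟩, ⟨y1, hy1⟩⟩ :=
    exists_two_disjoint (G := G) _ (A i) {x, y} {z | ∃ w ∈ B, w ∉ A i ∧ G.Adj z w} rfl
      ⟨x, hi⟩ (by
    intro m hm
    obtain ⟨x', hx', hx'm⟩ : ∃ x' ∈ ({x, y} : Set V), x' ≠ m := by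
      by_cases h : x = m
      · exact ⟨y, Or.inr rfl, fun e => hxy (h.trans e.symm)⟩
      · exact ⟨x, Or.inl rfl, h⟩
    have hx'i : x' ∈ A i := by
      rcases hx' with rfl | rfl
      exacts [hi, hj]
    obtain ⟨L, hL, hx'L⟩ := exists_isComp (G := G) (Z := A i \ {m}) ⟨hx'i, hx'm⟩
    obtain ⟨l, hl⟩ := fin_four_exists_ne i
    obtain ⟨a, ha⟩ := (hA.1 l).nonempty
    obtain ⟨z, hz, w, hw, hwL, hzw⟩ := (hB.del m).exists_adj (X := L)
      (fun z hz => ⟨hAB i (hL.sub hz).1, (hL.sub hz).2⟩) ⟨x', hx'L⟩ (a := a)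
      ⟨hAB l ha, fun e => only hm hl (e ▸ ha)⟩ fun h => only (hL.sub h).1 hl ha
    refine ⟨L, hL.sub.trans Set.sdiff_subset, fun h => (hL.sub h).2 rfl, hL.cn, ⟨x', hx'L, hx'⟩,
      z, hz, w, hw.1, fun hwi => hwL (hL.closed z hz w ⟨hwi, hw.2⟩ hzw), hzw⟩)
  obtain ⟨X', Y', hXX, hYY, hXY', hd', hXc', hYc', hT⟩ := (hA.1 i).grow hXc hYc hXi hYi hdXY
  have out : ∀ {Z : Set V} {z}, z ∈ Z → z ∈ {z | ∃ w ∈ B, w ∉ A i ∧ G.Adj z w} →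
      ∃ l, l ≠ i ∧ Tch G Z (A l) := by
    rintro Z z hz ⟨w, hw, hwi, hzw⟩
    obtain ⟨l, hl⟩ := hcov w hw
    exact ⟨l, fun e => hwi (e ▸ hl), tch_of_adj hzw hz hl⟩
  have hxy'' : x' = x ∧ y' = y ∨ x' = y ∧ y' = x := by
    have hne : x' ≠ y' := fun e => Set.disjoint_left.1 hdXY hx'.1 (e ▸ hy'.1)
    rcases hx'.2 with h1 | h1 <;> rcases hy'.2 with h2 | h2
    · exact absurd (h1.trans h2.symm) hne
    · exact Or.inl ⟨h1, h2⟩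
    · exact Or.inr ⟨h1, h2⟩
    · exact absurd (h1.trans h2.symm) hne
  rcases prop_split (fun l => Tch G X' (A l)) (fun l => Tch G Y' (A l)) i
    (fun l hl => by
      obtain ⟨z, hz, w, hw, hzw⟩ := (hA.2 i l hl.symm).2
      rw [← hXY'] at hz
      rcases hz with hz | hz
      · exact Or.inl ⟨z, hz, w, hw, hzw⟩
      · exact Or.inr ⟨z, hz, w, hw, hzw⟩)
    (out (hXX hx1.1) hx1.2) (out (hYY hy1.1) hy1.2) with ⟨j, hj, h1, h2⟩ | ⟨j, hj, h1, h2⟩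
  · exact finish X' Y' x' y' hxy'' (hXX hx'.1) (hYY hy'.1) hXY' hd' hXc' hYc' hT j hj h1 h2
  · exact finish Y' X' y' x' (by tauto) (hYY hy'.1) (hXX hx'.1)
      (by rw [Set.union_comm]; exact hXY') hd'.symm hYc' hXc' hT.symm j hj h1 h2

/-- `v` has at least three neighbours in `S`. -/
def Three (G : SimpleGraph V) (S : Set V) (v : V) : Prop :=
  ∃ a ∈ S, ∃ b ∈ S, ∃ c ∈ S, a ≠ b ∧ a ≠ c ∧ b ≠ c ∧ G.Adj v a ∧ G.Adj v b ∧ G.Adj v c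

lemma noCut_insert {B : Set V} (hB : NoCut G B) {v a b : V} (hv : v ∉ B) (ha : a ∈ B) (hb : b ∈ B)
    (hab : a ≠ b) (hva : G.Adj v a) (hvb : G.Adj v b) : NoCut G (insert v B) := by
  have : insert v B = B ∪ {v} := by
    rw [Set.union_comm]
    rfl
  rw [this]
  refine IsEar.noCut hB ⟨⟨cn_singleton v, Set.disjoint_singleton_left.2 hv, a, ha, b, hb, hab,
    tch_singleton_right.2 ⟨v, rfl, hva⟩, tch_singleton_right.2 ⟨v, rfl, hvb⟩⟩, fun L hL hLv => ?_⟩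
  obtain ⟨x, hx⟩ := hL.cn.nonempty
  have hxv : x = v := hLv hx
  exact Set.singleton_subset_iff.2 (hxv ▸ hx)

lemma exists_ear {S U : Set V} (hS : NoCut G S) (hU : NoCut G U) (hSU : S ⊆ U) (hne : S ≠ U) :
    ∃ L, IsEar G S L ∧ L ⊆ U := by
  obtain ⟨x, hx, hxS⟩ := Set.exists_of_ssubset (hSU.ssubset_of_ne hne)
  obtain ⟨L, hL, hxL⟩ := exists_isComp (G := G) (Z := U \ S) ⟨hx, hxS⟩
  obtain ⟨s, hs⟩ := hS.cn.nonempty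
  obtain ⟨y, hy, b, hb, hyb⟩ := hL.tch hU.cn ⟨s, hs, hSU hs⟩
  obtain ⟨t, ht, htb⟩ : ∃ t ∈ S, t ≠ b := by
    obtain ⟨p, hp, q, hq, hpq⟩ := hS.two
    by_cases h : p = b
    · exact ⟨q, hq, fun e => hpq (h.trans e.symm)⟩
    · exact ⟨p, hp, h⟩
  obtain ⟨z, hz, w, hw, hwL, hzw⟩ := (hU.del b).exists_adj (X := L)
    (fun z hz => ⟨(hL.sub hz).1, fun e => (hL.sub hz).2 (e ▸ hb.1)⟩) ⟨x, hxL⟩ (a := t)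
    ⟨hSU ht, htb⟩ fun h => (hL.sub h).2 ht
  have hwS : w ∈ S := by
    by_contra hwS
    exact hwL (hL.closed z hz w ⟨hw.1, hwS⟩ hzw)
  exact ⟨L, ⟨hL.cn, Set.disjoint_left.2 fun z hz => (hL.sub hz).2, b, hb.1, w, hwS,
    fun e => hw.2 e.symm, tch_singleton_right.2 ⟨y, hy, hyb⟩, tch_singleton_right.2 ⟨z, hz, hzw⟩⟩,
    hL.sub.trans Set.sdiff_subset⟩

lemma exists_three [Finite V] {S U : Set V} (hS : NoCut G S) (hU : NoCut G U) (hSU : S ⊆ U)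
    (hne : S ≠ U) (h4 : HasK4 G S) (hhat : NoHat G U) : ∃ v ∈ U, v ∉ S ∧ Three G S v := by
  obtain ⟨L₀, hL₀, hL₀U⟩ := exists_ear hS hU hSU hne
  obtain ⟨L, hLL, hmin⟩ := hL₀.exists_minimal
  have hLU := hLL.trans hL₀U
  obtain ⟨a, ha, b, hb, hab, hta, htb⟩ := hmin.1.two
  obtain ⟨c, hc, hca, hcb, htc⟩ : ∃ c ∈ S, c ≠ a ∧ c ≠ b ∧ Tch G L {c} := by
    by_contra hno
    push Not at hno
    refine hat_split hhat hSU hLU hS h4 hmin.1.cn hmin.1.disj ha hb hab fun d hd => ⟨fun h => ?_, ?_⟩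
    · by_contra hd'
      push Not at hd'
      exact hno d hd hd'.1 hd'.2 h
    · rintro (rfl | rfl)
      exacts [hta, htb]
  have hsub : ∀ u ∈ L, Cn G (L \ {u}) → ∀ d ∈ S, ∀ e ∈ S, d ≠ e → Tch G (L \ {u}) {d} →
      Tch G (L \ {u}) {e} → False := fun u hu hcn d hd e he hde h1 h2 =>
    (hmin.2 ⟨hcn, hmin.1.disj.mono_left Set.sdiff_subset, d, hd, e, he, hde, h1, h2⟩
      Set.sdiff_subset hu).2 rfl
  obtain ⟨v, hv⟩ := hmin.1.cn.nonempty
  by_cases hsing : ∃ w ∈ L, w ≠ v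
  · exfalso
    obtain ⟨w, hw, hwv⟩ := hsing
    obtain ⟨u, hu, -, hucn⟩ := hmin.1.cn.exists_noncut hv hw hwv
    obtain ⟨w', hw', hw'u⟩ : ∃ w' ∈ L, w' ≠ u := by
      by_cases h : w = u
      · exact ⟨v, hv, fun e => hwv (h.trans e.symm)⟩
      · exact ⟨w, hw, h⟩
    obtain ⟨t, ht, htu, htcn⟩ := hmin.1.cn.exists_noncut hu hw' hw'u
    have hor : ∀ d, Tch G L {d} → Tch G (L \ {u}) {d} ∨ Tch G (L \ {t}) {d} := by
      intro d hd
      obtain ⟨x, hx, hxd⟩ := tch_singleton_right.1 hd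
      by_cases hxu : x = u
      · exact Or.inr (tch_singleton_right.2 ⟨x, ⟨hx, fun e => htu (e.symm.trans hxu)⟩, hxd⟩)
      · exact Or.inl (tch_singleton_right.2 ⟨x, ⟨hx, hxu⟩, hxd⟩)
    have hu' := hsub u hu hucn
    have ht' := hsub t ht htcn
    rcases hor a hta with h1 | h1 <;> rcases hor b htb with h2 | h2 <;>
      rcases hor c htc with h3 | h3
    · exact hu' a ha b hb hab h1 h2
    · exact hu' a ha b hb hab h1 h2
    · exact hu' c hc a ha hca h3 h1
    · exact ht' c hc b hb hcb h3 h2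
    · exact hu' c hc b hb hcb h3 h2
    · exact ht' c hc a ha hca h3 h1
    · exact ht' a ha b hb hab h1 h2
    · exact ht' a ha b hb hab h1 h2
  · push Not at hsing
    have adj : ∀ d, Tch G L {d} → G.Adj v d := by
      intro d hd
      obtain ⟨x, hx, hxd⟩ := tch_singleton_right.1 hd
      exact hsing x hx ▸ hxd
    exact ⟨v, hLU hv, Set.disjoint_left.1 hmin.1.disj hv, a, ha, b, hb, c, hc, hab, hca.symm,
      hcb.symm, adj a hta, adj b htb, adj c htc⟩

end Hats

section Extension

variable {V : Type} {G : SimpleGraph V}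

lemma cn_pair' {a b : V} (h : a = b ∨ G.Adj a b) : Cn G {a, b} := by
  rcases h with rfl | h
  · simpa using cn_singleton a
  · exact cn_pair h

lemma tch_pairs {a a' b b' : V} :
    Tch G {a, a'} {b, b'} ↔ (G.Adj a b ∨ G.Adj a b') ∨ G.Adj a' b ∨ G.Adj a' b' := by
  simp [Tch]

lemma k4m_pairs {a b c c' d d' : V} (hab : G.Adj a b) (hc : c = c' ∨ G.Adj c c')
    (hd : d = d' ∨ G.Adj d d') (hac : G.Adj a c ∨ G.Adj a c') (had : G.Adj a d ∨ G.Adj a d')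
    (hbc : G.Adj b c ∨ G.Adj b c') (hbd : G.Adj b d ∨ G.Adj b d')
    (hcd : (G.Adj c d ∨ G.Adj c d') ∨ G.Adj c' d ∨ G.Adj c' d')
    (na : a ≠ c ∧ a ≠ c' ∧ a ≠ d ∧ a ≠ d') (nb : b ≠ c ∧ b ≠ c' ∧ b ≠ d ∧ b ≠ d')
    (nc : c ≠ d ∧ c ≠ d' ∧ c' ≠ d ∧ c' ≠ d') : K4M G {a} {b} {c, c'} {d, d'} where
  a := cn_singleton a
  b := cn_singleton b
  c := cn_pair' hc
  d := cn_pair' hd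
  ab := by simpa using hab.ne
  ac := by
    simp only [Set.disjoint_singleton_left, Set.mem_insert_iff, Set.mem_singleton_iff]
    grind
  ad := by
    simp only [Set.disjoint_singleton_left, Set.mem_insert_iff, Set.mem_singleton_iff]
    grind
  bc := by
    simp only [Set.disjoint_singleton_left, Set.mem_insert_iff, Set.mem_singleton_iff]
    grind
  bd := by
    simp only [Set.disjoint_singleton_left, Set.mem_insert_iff, Set.mem_singleton_iff]
    grind
  cd := by
    simp only [Set.disjoint_insert_right, Set.disjoint_singleton_right, Set.mem_insert_iff,
      Set.mem_singleton_iff]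
    grind
  tab := by simp [Tch, hab]
  tac := by simpa [Tch] using hac
  tad := by simpa [Tch] using had
  tbc := by simpa [Tch] using hbc
  tbd := by simpa [Tch] using hbd
  tcd := tch_pairs.2 hcd

lemma K4M.k4f {A B C D : Set V} (h : K4M G A B C D) : K4F G ![A, B, C, D] := by
  refine ⟨fun i => ?_, fun i j hij => ?_⟩
  · fin_cases i
    exacts [h.a, h.b, h.c, h.d]
  · fin_cases i <;> fin_cases j
    exacts [absurd rfl hij, ⟨h.ab, h.tab⟩, ⟨h.ac, h.tac⟩, ⟨h.ad, h.tad⟩,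
      ⟨h.ab.symm, h.tab.symm⟩, absurd rfl hij, ⟨h.bc, h.tbc⟩, ⟨h.bd, h.tbd⟩,
      ⟨h.ac.symm, h.tac.symm⟩, ⟨h.bc.symm, h.tbc.symm⟩, absurd rfl hij, ⟨h.cd, h.tcd⟩,
      ⟨h.ad.symm, h.tad.symm⟩, ⟨h.bd.symm, h.tbd.symm⟩, ⟨h.cd.symm, h.tcd.symm⟩, absurd rfl hij]

/-- Four truth values of which not exactly two hold. -/
def NotTwo (p q r s : Prop) : Prop :=
  (p → q → r ∨ s) ∧ (p → r → q ∨ s) ∧ (p → s → q ∨ r) ∧ (q → r → p ∨ s) ∧ (q → s → p ∨ r) ∧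
    (r → s → p ∨ q)

lemma NoHat.notTwo {U A B C D E : Set V} (h : NoHat G U) (hM : K4M G A B C D) (hA : A ⊆ U)
    (hB : B ⊆ U) (hC : C ⊆ U) (hD : D ⊆ U) (hE : Cn G E) (hEU : E ⊆ U) (dA : Disjoint E A)
    (dB : Disjoint E B) (dC : Disjoint E C) (dD : Disjoint E D) :
    NotTwo (Tch G E A) (Tch G E B) (Tch G E C) (Tch G E D) := by
  have key := h ![A, B, C, D] hM.k4f (by simp [Fin.forall_fin_succ, hA, hB, hC, hD]) E hEU hE
    (by simp [Fin.forall_fin_succ, dA, dB, dC, dD])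
  have h01 := key 0 1 (by decide)
  have h02 := key 0 2 (by decide)
  have h03 := key 0 3 (by decide)
  have h12 := key 1 2 (by decide)
  have h13 := key 1 3 (by decide)
  have h23 := key 2 3 (by decide)
  simp [Fin.exists_fin_succ] at h01 h02 h03 h12 h13 h23
  exact ⟨h01, h02, h03, h12, h13, h23⟩

lemma NoHat.pairs {U : Set V} {a b c c' d d' e : V} (h : NoHat G U)
    (hU : a ∈ U ∧ b ∈ U ∧ c ∈ U ∧ c' ∈ U ∧ d ∈ U ∧ d' ∈ U ∧ e ∈ U)
    (hab : G.Adj a b) (hc : c = c' ∨ G.Adj c c')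
    (hd : d = d' ∨ G.Adj d d') (hac : G.Adj a c ∨ G.Adj a c') (had : G.Adj a d ∨ G.Adj a d')
    (hbc : G.Adj b c ∨ G.Adj b c') (hbd : G.Adj b d ∨ G.Adj b d')
    (hcd : (G.Adj c d ∨ G.Adj c d') ∨ G.Adj c' d ∨ G.Adj c' d')
    (na : a ≠ c ∧ a ≠ c' ∧ a ≠ d ∧ a ≠ d') (nb : b ≠ c ∧ b ≠ c' ∧ b ≠ d ∧ b ≠ d')
    (nc : c ≠ d ∧ c ≠ d' ∧ c' ≠ d ∧ c' ≠ d')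
    (ne : e ≠ a ∧ e ≠ b ∧ e ≠ c ∧ e ≠ c' ∧ e ≠ d ∧ e ≠ d') :
    NotTwo (G.Adj e a) (G.Adj e b) (G.Adj e c ∨ G.Adj e c') (G.Adj e d ∨ G.Adj e d') := by
  obtain ⟨ua, ub, uc, uc', ud, ud', ue⟩ := hU
  obtain ⟨n1, n2, n3, n4, n5, n6⟩ := ne
  have := h.notTwo (k4m_pairs hab hc hd hac had hbc hbd hcd na nb nc) (by simp [ua])
    (by simp [ub]) (by simp [Set.insert_subset_iff, *]) (by simp [Set.insert_subset_iff, *])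
    (cn_singleton e) (by simp [ue]) (by simpa using n1) (by simpa using n2) (by simp [n3, n4])
    (by simp [n5, n6])
  simpa [Tch] using this

/-- Nonadjacency is transitive on `W`. -/
def CM (G : SimpleGraph V) (W : Set V) : Prop :=
  ∀ x ∈ W, ∀ y ∈ W, ∀ z ∈ W, ¬ G.Adj x y → ¬ G.Adj y z → ¬ G.Adj x z

lemma Three.mono {S W : Set V} {v : V} (h : Three G S v) (hSW : S ⊆ W) : Three G W v := by
  obtain ⟨a, ha, b, hb, c, hc, h⟩ := h
  exact ⟨a, hSW ha, b, hSW hb, c, hSW hc, h⟩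

lemma CM.adj_of_adj {W : Set V} {v u x : V} (hW : CM G W) (h3 : ∀ x ∈ W, Three G W x)
    (hv : v ∉ W) (hv3 : Three G W v) (hN : NoHat G (insert v W)) (hu : u ∈ W) (hx : x ∈ W)
    (hvu : G.Adj v u) (hux : ¬ G.Adj u x) : G.Adj v x := by
  by_contra hvx
  have hxu : x ≠ u := fun e => hvx (e ▸ hvu)
  have hs : ∀ x y, G.Adj x y → G.Adj y x := fun _ _ h => h.symm
  have hi : ∀ x, ¬ G.Adj x x := fun _ => G.irrefl
  have hm : ∀ w ∈ W, w ∈ insert v W := fun w hw => Or.inr hw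
  have hvm : v ∈ insert v W := Or.inl rfl
  have hwv : ∀ w ∈ W, v ≠ w := fun w hw e => hv (e ▸ hw)
  have hOx : ∀ w ∈ W, (G.Adj u w ↔ G.Adj x w) := by
    intro w hw
    have h1 := hW u hu x hx w hw
    have h2 := hW x hx u hu w hw
    grind
  obtain ⟨o1, ho1, o2, ho2, o3, ho3, h12, h13, h23, hu1, hu2, hu3⟩ := h3 u hu
  have hx1 := (hOx o1 ho1).1 hu1
  have hx2 := (hOx o2 ho2).1 hu2
  have hx3 := (hOx o3 ho3).1 hu3
  by_cases hedge : ∃ q ∈ W, ∃ r ∈ W, G.Adj u q ∧ G.Adj u r ∧ G.Adj q r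
  · have iff : ∀ q ∈ W, ∀ r ∈ W, G.Adj u q → G.Adj u r → G.Adj q r → G.Adj v q → G.Adj v r := by
      intro q hq r hr huq hur hqr hvq
      obtain ⟨z, hz, huz, hzq, hzr⟩ : ∃ z ∈ W, G.Adj u z ∧ z ≠ q ∧ z ≠ r := by grind
      have := hN.pairs (a := x) (b := q) (c := r) (c' := r) (d := u) (d' := z) (e := v)
        (by simp [*]) (by grind) (by grind) (by grind) (by grind) (by grind) (by grind) (by grind)
        (by grind) (by grind) (by grind) (by grind) (by grind)
      simp only [NotTwo] at this
      grind
    obtain ⟨q, hq, r, hr, huq, hur, hqr⟩ := hedge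
    obtain ⟨z, hz, huz, hzq, hzr⟩ : ∃ z ∈ W, G.Adj u z ∧ z ≠ q ∧ z ≠ r := by grind
    by_cases hvq : G.Adj v q
    · have hvr := iff q hq r hr huq hur hqr hvq
      have := hN.pairs (a := v) (b := u) (c := q) (c' := q) (d := r) (d' := r) (e := x)
        (by simp [*]) (by grind) (by grind) (by grind) (by grind) (by grind) (by grind) (by grind)
        (by grind) (by grind) (by grind) (by grind) (by grind)
      simp only [NotTwo] at this
      grind
    · have hnone : ∀ o ∈ W, G.Adj u o → ¬ G.Adj v o := by
        intro o ho huo hvo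
        have h1 := hW q hq o ho r hr
        grind
      obtain ⟨u2, hu2, hvu2, hne⟩ : ∃ u2 ∈ W, G.Adj v u2 ∧ u2 ≠ u := by
        obtain ⟨a, ha, b, hb, c, hc, h⟩ := hv3
        grind
      have hadj : ∀ w ∈ W, G.Adj u w → G.Adj u2 w := by
        intro w hw
        have h1 := hW u hu u2 hu2 w hw
        grind
      have := hN.pairs (a := q) (b := r) (c := u) (c' := u) (d := u2) (d' := z) (e := v)
        (by simp [*]) (by grind) (by grind) (by grind) (by grind) (by grind) (by grind) (by grind)
        (by grind) (by grind) (by grind) (by grind) (by grind)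
      simp only [NotTwo] at this
      grind
  · push Not at hedge
    obtain ⟨p, hp, hp1, hpu, hpx⟩ : ∃ p ∈ W, G.Adj o1 p ∧ p ≠ u ∧ p ≠ x := by
      obtain ⟨a, ha, b, hb, c, hc, h⟩ := h3 o1 ho1
      grind
    have hup : ¬ G.Adj u p := by grind
    have comp : ∀ p ∈ W, ¬ G.Adj u p → ∀ o ∈ W, G.Adj u o → G.Adj p o := by
      intro p hp hup o ho huo
      have h1 := hW u hu p hp o ho
      grind
    have iff : ∀ p ∈ W, ¬ G.Adj u p → p ≠ u → p ≠ x → ∀ q1 ∈ W, ∀ q2 ∈ W, ∀ q3 ∈ W, q1 ≠ q2 →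
        q1 ≠ q3 → q2 ≠ q3 → G.Adj u q1 → G.Adj u q2 → G.Adj u q3 →
        (G.Adj v q1 ↔ G.Adj v p ∨ G.Adj v q3) := by
      intro p hp hup hpu hpx q1 hq1 q2 hq2 q3 hq3 h12 h13 h23 hu1 hu2 hu3
      have c1 := comp p hp hup q1 hq1 hu1
      have c3 := comp p hp hup q3 hq3 hu3
      have x1 := (hOx q1 hq1).1 hu1
      have x2 := (hOx q2 hq2).1 hu2
      have x3 := (hOx q3 hq3).1 hu3
      have := hN.pairs (a := x) (b := q1) (c := u) (c' := q2) (d := p) (d' := q3) (e := v)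
        (by simp [*]) (by grind) (by grind) (by grind) (by grind) (by grind) (by grind) (by grind)
        (by grind) (by grind) (by grind) (by grind) (by grind)
      simp only [NotTwo] at this
      grind
    have c1 := comp p hp hup o1 ho1 hu1
    have c2 := comp p hp hup o2 ho2 hu2
    have pnone : ∀ p ∈ W, ¬ G.Adj u p → p ≠ u → p ≠ x → ¬ G.Adj v p := by
      intro p hp hup hpu hpx hvp
      have c1 := comp p hp hup o1 ho1 hu1
      have c2 := comp p hp hup o2 ho2 hu2
      have i1 := iff p hp hup hpu hpx o1 ho1 o2 ho2 o3 ho3 h12 h13 h23 hu1 hu2 hu3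
      have i2 := iff p hp hup hpu hpx o2 ho2 o1 ho1 o3 ho3 h12.symm h23 h13 hu2 hu1 hu3
      clear iff comp h3 hedge hW
      have := hN.pairs (a := v) (b := u) (c := o1) (c' := o1) (d := p) (d' := o2) (e := x)
        (by simp [*]) (by grind) (by grind) (by grind) (by grind) (by grind) (by grind) (by grind)
        (by grind) (by grind) (by grind) (by grind) (by grind)
      simp only [NotTwo] at this
      grind
    have hvp := pnone p hp hup hpu hpx
    obtain ⟨o, ho, huo, hvo⟩ : ∃ o ∈ W, G.Adj u o ∧ G.Adj v o := by
      obtain ⟨a, ha, b, hb, c, hc, hab, -, -, hva, hvb, -⟩ := hv3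
      have key : ∀ w ∈ W, G.Adj v w → w ≠ u → G.Adj u w := fun w hw hvw hwu => by
        by_contra huw
        exact pnone w hw huw hwu (fun e => hvx (e ▸ hvw)) hvw
      by_cases hau : a = u
      · exact ⟨b, hb, key b hb hvb fun e => hab (hau.trans e.symm), hvb⟩
      · exact ⟨a, ha, key a ha hva hau, hva⟩
    have all : ∀ o' ∈ W, G.Adj u o' → G.Adj v o' := by
      intro o' ho' huo'
      by_cases he : o' = o
      · exact he ▸ hvo
      obtain ⟨o'', ho'', huo'', h1, h2⟩ : ∃ z ∈ W, G.Adj u z ∧ z ≠ o' ∧ z ≠ o := by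
        clear iff comp h3 hedge hW
        grind
      exact (iff p hp hup hpu hpx o' ho' o'' ho'' o ho h1.symm he h2 huo' huo'' huo).2 (Or.inr hvo)
    have v1 := all o1 ho1 hu1
    have v2 := all o2 ho2 hu2
    clear iff comp h3 hedge hW all pnone
    have := hN.pairs (a := v) (b := u) (c := o1) (c' := o1) (d := x) (d' := o2) (e := p)
      (by simp [*]) (by grind) (by grind) (by grind) (by grind) (by grind) (by grind) (by grind)
      (by grind) (by grind) (by grind) (by grind) (by grind)
    simp only [NotTwo] at this
    grind

lemma CM.insert_vertex {W : Set V} {v : V} (hW : CM G W) (h3 : ∀ x ∈ W, Three G W x)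
    (hv : v ∉ W) (hv3 : Three G W v) (hN : NoHat G (insert v W)) : CM G (insert v W) := by
  have hs : ∀ x y, G.Adj x y → G.Adj y x := fun _ _ h => h.symm
  have hi : ∀ x, ¬ G.Adj x x := fun _ => G.irrefl
  have hm : ∀ w ∈ W, w ∈ insert v W := fun w hw => Or.inr hw
  have hvm : v ∈ insert v W := Or.inl rfl
  have hwv : ∀ w ∈ W, v ≠ w := fun w hw e => hv (e ▸ hw)
  have key : ∀ u ∈ W, ∀ x ∈ W, G.Adj v u → ¬ G.Adj u x → G.Adj v x := fun u hu x hx =>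
    hW.adj_of_adj h3 hv hv3 hN hu hx
  have key2 : ∀ x ∈ W, ∀ y ∈ W, ¬ G.Adj v x → ¬ G.Adj v y → ¬ G.Adj x y := by
    intro x hx y hy hvx hvy hxy
    obtain ⟨u1, hu1, u2, hu2, -, -, h12, -, -, hv1, hv2, -⟩ := hv3
    have h1x : G.Adj u1 x := by_contra fun h => hvx (key u1 hu1 x hx hv1 h)
    have h1y : G.Adj u1 y := by_contra fun h => hvy (key u1 hu1 y hy hv1 h)
    have h2x : G.Adj u2 x := by_contra fun h => hvx (key u2 hu2 x hx hv2 h)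
    have h2y : G.Adj u2 y := by_contra fun h => hvy (key u2 hu2 y hy hv2 h)
    by_cases hu : G.Adj u1 u2
    · clear key h3 hW
      have := hN.pairs (a := x) (b := y) (c := u1) (c' := u1) (d := u2) (d' := u2) (e := v)
        (by simp [*]) (by grind) (by grind) (by grind) (by grind) (by grind) (by grind) (by grind)
        (by grind) (by grind) (by grind) (by grind) (by grind)
      simp only [NotTwo] at this
      grind
    · obtain ⟨z, hz, h1z, hzx, hzy⟩ : ∃ z ∈ W, G.Adj u1 z ∧ z ≠ x ∧ z ≠ y := by
        obtain ⟨a, ha, b, hb, c, hc, h⟩ := h3 u1 hu1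
        grind
      have h2z : G.Adj u2 z := by
        by_contra h
        exact hW u1 hu1 u2 hu2 z hz hu h h1z
      have hvz : ¬ G.Adj x z → ¬ G.Adj v z := fun h h' => hvx (key z hz x hx h' fun h'' => h h''.symm)
      clear key h3 hW
      have := hN.pairs (a := x) (b := y) (c := u1) (c' := u1) (d := u2) (d' := z) (e := v)
        (by simp [*]) (by grind) (by grind) (by grind) (by grind) (by grind) (by grind) (by grind)
        (by grind) (by grind) (by grind) (by grind) (by grind)
      simp only [NotTwo] at this
      grind
  intro x hx y hy z hz hxy hyz hxz
  rcases hx with rfl | hx <;> rcases hy with rfl | hy <;> rcases hz with rfl | hz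
  · exact hi _ hxz
  · exact hyz hxz
  · exact hi _ hxz
  · exact hxy (key z hz y hy hxz fun h => hyz h.symm)
  · exact hxy hxz
  · exact key2 x hx z hz (fun h => hxy h.symm) hyz hxz
  · exact hyz (key x hx y hy hxz.symm hxy).symm
  · exact hW x hx y hy z hz hxy hyz hxz

/-- `W` is the join of an independent set of size at least three with the disjoint union of
the edge `ab` and the vertex `y`. -/
structure EG (G : SimpleGraph V) (W : Set V) (a b y : V) : Prop where
  ma : a ∈ W
  mb : b ∈ W
  my : y ∈ W
  ab : G.Adj a b
  ya : ¬ G.Adj y a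
  yb : ¬ G.Adj y b
  nya : y ≠ a
  nyb : y ≠ b
  join : ∀ p ∈ W, p ≠ a → p ≠ b → p ≠ y → G.Adj p a ∧ G.Adj p b ∧ G.Adj p y
  indep : ∀ p ∈ W, p ≠ a → p ≠ b → p ≠ y → ∀ q ∈ W, q ≠ a → q ≠ b → q ≠ y → ¬ G.Adj p q
  three : ∃ p ∈ W, ∃ q ∈ W, ∃ r ∈ W, p ≠ q ∧ p ≠ r ∧ q ≠ r ∧ (p ≠ a ∧ p ≠ b ∧ p ≠ y) ∧
    (q ≠ a ∧ q ≠ b ∧ q ≠ y) ∧ (r ≠ a ∧ r ≠ b ∧ r ≠ y)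

lemma EG.symm {W : Set V} {a b y : V} (h : EG G W a b y) : EG G W b a y where
  ma := h.mb
  mb := h.ma
  my := h.my
  ab := h.ab.symm
  ya := h.yb
  yb := h.ya
  nya := h.nyb
  nyb := h.nya
  join p hp h1 h2 h3 := by
    obtain ⟨h4, h5, h6⟩ := h.join p hp h2 h1 h3
    exact ⟨h5, h4, h6⟩
  indep p hp h1 h2 h3 q hq h4 h5 h6 := h.indep p hp h2 h1 h3 q hq h5 h4 h6
  three := by
    obtain ⟨p, hp, q, hq, r, hr, h1, h2, h3, h4, h5, h6⟩ := h.three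
    exact ⟨p, hp, q, hq, r, hr, h1, h2, h3, by tauto, by tauto, by tauto⟩

lemma EG.model {W : Set V} {a b y v p q : V} (h : EG G W a b y) (hv : v ∉ W)
    (hN : NoHat G (insert v W)) (hp : p ∈ W) (hq : q ∈ W) (hpq : p ≠ q)
    (hp' : p ≠ a ∧ p ≠ b ∧ p ≠ y) (hq' : q ≠ a ∧ q ≠ b ∧ q ≠ y) :
    NotTwo (G.Adj v a) (G.Adj v b) (G.Adj v p) (G.Adj v q ∨ G.Adj v y) := by
  have hs : ∀ x y, G.Adj x y → G.Adj y x := fun _ _ h => h.symm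
  have hi : ∀ x, ¬ G.Adj x x := fun _ => G.irrefl
  have hwv : ∀ w ∈ W, v ≠ w := fun w hw e => hv (e ▸ hw)
  have hpj := h.join p hp hp'.1 hp'.2.1 hp'.2.2
  have hqj := h.join q hq hq'.1 hq'.2.1 hq'.2.2
  obtain ⟨ha, hb, hy, hab, hya, hyb, nya, nyb, -, -, -⟩ := h
  have := hN.pairs (a := a) (b := b) (c := p) (c' := p) (d := q) (d' := y) (e := v)
    (by simp [*]) (by grind) (by grind) (by grind) (by grind) (by grind) (by grind) (by grind)
    (by grind) (by grind) (by grind) (by grind) (by grind)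
  simpa using this

lemma EG.no_one {W : Set V} {a b y v : V} (h : EG G W a b y) (hv : v ∉ W)
    (hv3 : Three G W v) (hN : NoHat G (insert v W)) (hva : G.Adj v a) (hvb : ¬ G.Adj v b) :
    False := by
  have hs : ∀ x y, G.Adj x y → G.Adj y x := fun _ _ h => h.symm
  have hi : ∀ x, ¬ G.Adj x x := fun _ => G.irrefl
  have hwv : ∀ w ∈ W, v ≠ w := fun w hw e => hv (e ▸ hw)
  obtain ⟨p, hp, q, hq, hpq, hp', hq', hvp, hvq⟩ : ∃ p ∈ W, ∃ q ∈ W, p ≠ q ∧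
      (p ≠ a ∧ p ≠ b ∧ p ≠ y) ∧ (q ≠ a ∧ q ≠ b ∧ q ≠ y) ∧ G.Adj v p ∧ G.Adj v q := by
    obtain ⟨p, hp, q, hq, r, hr, hpq, hpr, hqr, hp', hq', hr'⟩ := h.three
    by_cases hvy : G.Adj v y
    · have m1 := h.model hv hN hp hq hpq hp' hq'
      have m2 := h.model hv hN hq hp hpq.symm hq' hp'
      simp only [NotTwo] at m1 m2
      refine ⟨p, hp, q, hq, hpq, hp', hq', ?_, ?_⟩ <;> grind
    · obtain ⟨s, hs, hs', hvs⟩ : ∃ s ∈ W, (s ≠ a ∧ s ≠ b ∧ s ≠ y) ∧ G.Adj v s := by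
        obtain ⟨c1, hc1, c2, hc2, -, -, h12, -, -, hv1, hv2, -⟩ := hv3
        by_cases h1 : c1 = a
        · exact ⟨c2, hc2, ⟨fun e => h12 (h1.trans e.symm), fun e => hvb (e ▸ hv2),
            fun e => hvy (e ▸ hv2)⟩, hv2⟩
        · exact ⟨c1, hc1, ⟨h1, fun e => hvb (e ▸ hv1), fun e => hvy (e ▸ hv1)⟩, hv1⟩
      obtain ⟨t, ht, ht', hst⟩ : ∃ t ∈ W, (t ≠ a ∧ t ≠ b ∧ t ≠ y) ∧ s ≠ t := by
        by_cases h1 : s = p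
        · exact ⟨q, hq, hq', fun e => hpq (h1.symm.trans e)⟩
        · exact ⟨p, hp, hp', h1⟩
      have m1 := h.model hv hN hs ht hst hs' ht'
      simp only [NotTwo] at m1
      refine ⟨s, hs, t, ht, hst, hs', ht', hvs, ?_⟩
      grind
  have hpj := h.join p hp hp'.1 hp'.2.1 hp'.2.2
  have hqj := h.join q hq hq'.1 hq'.2.1 hq'.2.2
  obtain ⟨ha, hb, hy, hab, hya, hyb, nya, nyb, -, -, -⟩ := h
  by_cases hvy : G.Adj v y
  · have := hN.pairs (a := v) (b := y) (c := p) (c' := p) (d := a) (d' := q) (e := b)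
      (by simp [*]) (by grind) (by grind) (by grind) (by grind) (by grind) (by grind) (by grind)
      (by grind) (by grind) (by grind) (by grind) (by grind)
    simp only [NotTwo] at this
    grind
  · have := hN.pairs (a := v) (b := a) (c := p) (c' := p) (d := b) (d' := q) (e := y)
      (by simp [*]) (by grind) (by grind) (by grind) (by grind) (by grind) (by grind) (by grind)
      (by grind) (by grind) (by grind) (by grind) (by grind)
    simp only [NotTwo] at this
    grind

lemma EG.insert_vertex {W : Set V} {a b y v : V} (h : EG G W a b y) (hv : v ∉ W)
    (hv3 : Three G W v) (hN : NoHat G (insert v W)) : EG G (insert v W) a b y := by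
  have hs : ∀ x y, G.Adj x y → G.Adj y x := fun _ _ h => h.symm
  have hi : ∀ x, ¬ G.Adj x x := fun _ => G.irrefl
  have hwv : ∀ w ∈ W, v ≠ w := fun w hw e => hv (e ▸ hw)
  have hvab : G.Adj v a ↔ G.Adj v b := ⟨fun h1 => by_contra fun h2 => h.no_one hv hv3 hN h1 h2,
    fun h1 => by_contra fun h2 => h.symm.no_one hv hv3 hN h1 h2⟩
  have hva : G.Adj v a := by
    by_contra hva
    have hvb : ¬ G.Adj v b := fun h => hva (hvab.2 h)
    obtain ⟨s, hs, t, ht, hst, hs', ht', hvs, hvt⟩ : ∃ s ∈ W, ∃ t ∈ W, s ≠ t ∧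
        (s ≠ a ∧ s ≠ b ∧ s ≠ y) ∧ (t ≠ a ∧ t ≠ b ∧ t ≠ y) ∧ G.Adj v s ∧ G.Adj v t := by
      have key : ∀ w, G.Adj v w → w ≠ y → w ≠ a ∧ w ≠ b ∧ w ≠ y := fun w hw hy =>
        ⟨fun e => hva (e ▸ hw), fun e => hvb (e ▸ hw), hy⟩
      obtain ⟨c1, hc1, c2, hc2, c3, hc3, h12, h13, h23, hv1, hv2, hv3⟩ := hv3
      by_cases h1 : c1 = y
      · subst h1
        exact ⟨c2, hc2, c3, hc3, h23, key _ hv2 h12.symm, key _ hv3 h13.symm, hv2, hv3⟩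
      · by_cases h2 : c2 = y
        · subst h2
          exact ⟨c1, hc1, c3, hc3, h13, key _ hv1 h1, key _ hv3 h23.symm, hv1, hv3⟩
        · exact ⟨c1, hc1, c2, hc2, h12, key _ hv1 h1, key _ hv2 h2, hv1, hv2⟩
    have m1 := h.model hv hN hs ht hst hs' ht'
    simp only [NotTwo] at m1
    grind
  have hvb := hvab.1 hva
  have two : ∀ p ∈ W, ∀ q ∈ W, p ≠ q → (p ≠ a ∧ p ≠ b ∧ p ≠ y) → (q ≠ a ∧ q ≠ b ∧ q ≠ y) →
      G.Adj v p → G.Adj v q → G.Adj v y := by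
    intro p hp q hq hpq hp' hq' hvp hvq
    by_contra hvy
    have hpj := h.join p hp hp'.1 hp'.2.1 hp'.2.2
    have hqj := h.join q hq hq'.1 hq'.2.1 hq'.2.2
    obtain ⟨ha, hb, hy, hab, hya, hyb, nya, nyb, -, -, -⟩ := h
    have := hN.pairs (a := v) (b := a) (c := p) (c' := p) (d := q) (d' := b) (e := y)
      (by simp [*]) (by grind) (by grind) (by grind) (by grind) (by grind) (by grind) (by grind)
      (by grind) (by grind) (by grind) (by grind) (by grind)
    simp only [NotTwo] at this
    grind
  have hvy : G.Adj v y := by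
    by_contra hvy
    obtain ⟨p, hp, q, hq, r, hr, hpq, hpr, hqr, hp', hq', hr'⟩ := h.three
    have m1 := h.model hv hN hp hq hpq hp' hq'
    have m2 := h.model hv hN hp hr hpr hp' hr'
    have m3 := h.model hv hN hq hr hqr hq' hr'
    have t1 := two p hp q hq hpq hp' hq'
    have t2 := two p hp r hr hpr hp' hr'
    have t3 := two q hq r hr hqr hq' hr'
    simp only [NotTwo] at m1 m2 m3
    grind
  have hvp : ∀ p ∈ W, p ≠ a → p ≠ b → p ≠ y → ¬ G.Adj v p := by
    intro p hp h1 h2 h3 hvp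
    have hpj := h.join p hp h1 h2 h3
    obtain ⟨ha, hb, hy, hab, hya, hyb, nya, nyb, -, -, -⟩ := h
    have := hN.pairs (a := v) (b := a) (c := b) (c' := b) (d := p) (d' := p) (e := y)
      (by simp [*]) (by grind) (by grind) (by grind) (by grind) (by grind) (by grind) (by grind)
      (by grind) (by grind) (by grind) (by grind) (by grind)
    simp only [NotTwo] at this
    grind
  refine ⟨Or.inr h.ma, Or.inr h.mb, Or.inr h.my, h.ab, h.ya, h.yb, h.nya, h.nyb, ?_, ?_, ?_⟩
  · rintro p (rfl | hp) h1 h2 h3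
    · exact ⟨hva, hvb, hvy⟩
    · exact h.join p hp h1 h2 h3
  · rintro p (rfl | hp) h1 h2 h3 q (rfl | hq) h4 h5 h6
    · exact hi _
    · exact hvp q hq h4 h5 h6
    · exact fun h => hvp p hp h1 h2 h3 h.symm
    · exact h.indep p hp h1 h2 h3 q hq h4 h5 h6
  · obtain ⟨p, hp, q, hq, r, hr, h'⟩ := h.three
    exact ⟨p, Or.inr hp, q, Or.inr hq, r, Or.inr hr, h'⟩

/-- The graphs that are either complete multipartite or of the form described by `EG`. -/
def Good (G : SimpleGraph V) (W : Set V) : Prop :=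
  (CM G W ∧ ∀ x ∈ W, Three G W x) ∨ ∃ a b y, EG G W a b y

lemma Good.insert_vertex {W : Set V} {v : V} (h : Good G W) (hv : v ∉ W) (hv3 : Three G W v)
    (hN : NoHat G (insert v W)) : Good G (insert v W) := by
  rcases h with ⟨hW, h3⟩ | ⟨a, b, y, h⟩
  · refine Or.inl ⟨hW.insert_vertex h3 hv hv3 hN, ?_⟩
    rintro x (rfl | hx)
    · exact hv3.mono (Set.subset_insert _ _)
    · exact (h3 x hx).mono (Set.subset_insert _ _)
  · exact Or.inr ⟨a, b, y, h.insert_vertex hv hv3 hN⟩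

end Extension

section Contraction

variable {V : Type} {G : SimpleGraph V}

/-- The graph obtained by contracting `y` into `x`, leaving `y` as an isolated vertex. -/
def con (G : SimpleGraph V) (x y : V) : SimpleGraph V where
  Adj a b := a ≠ b ∧ a ≠ y ∧ b ≠ y ∧ (G.Adj a b ∨ a = x ∧ G.Adj y b ∨ b = x ∧ G.Adj y a)
  symm := ⟨by
    rintro a b ⟨h1, h2, h3, h4 | h4 | h4⟩
    · exact ⟨h1.symm, h3, h2, Or.inl h4.symm⟩
    · exact ⟨h1.symm, h3, h2, Or.inr (Or.inr h4)⟩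
    · exact ⟨h1.symm, h3, h2, Or.inr (Or.inl h4)⟩⟩
  loopless := ⟨fun a h => h.1 rfl⟩

lemma con_adj_iff {x y a b : V} (hax : a ≠ x) (hay : a ≠ y) (hbx : b ≠ x) (hby : b ≠ y) :
    (con G x y).Adj a b ↔ G.Adj a b := by
  refine ⟨fun ⟨_, _, _, h⟩ => ?_, fun h => ⟨h.ne, hay, hby, Or.inl h⟩⟩
  rcases h with h | h | h
  exacts [h, absurd h.1 hax, absurd h.1 hbx]

lemma con_adj_left {x y b : V} (hxy : x ≠ y) (hbx : b ≠ x) (hby : b ≠ y) :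
    (con G x y).Adj x b ↔ G.Adj x b ∨ G.Adj y b := by
  refine ⟨fun ⟨_, _, _, h⟩ => ?_, fun h => ⟨hbx.symm, hxy, hby, ?_⟩⟩
  · rcases h with h | h | h
    exacts [Or.inl h, Or.inr h.2, absurd h.1 hbx]
  · rcases h with h | h
    exacts [Or.inl h, Or.inr (Or.inl ⟨rfl, h⟩)]

/-- The preimage of a vertex set under the contraction of `y` into `x`. -/
def lift (x y : V) (A : Set V) : Set V := A ∪ {z | z = y ∧ x ∈ A}

lemma lift_sub {x y : V} {A U : Set V} (hA : A ⊆ U) : lift x y A ⊆ insert y U := by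
  rintro z (hz | hz)
  exacts [Or.inr (hA hz), Or.inl hz.1]

lemma lift_disjoint {x y : V} {A B : Set V} (hA : y ∉ A) (hB : y ∉ B) (h : Disjoint A B) :
    Disjoint (lift x y A) (lift x y B) := by
  rw [Set.disjoint_left] at h ⊢
  rintro z (hz | ⟨rfl, hz⟩) (hz' | ⟨he, hz'⟩)
  exacts [h hz hz', hA (he ▸ hz), hB hz', h hz hz']

lemma lift_cn {x y : V} {A : Set V} (hxy : G.Adj x y) (hy : y ∉ A) (h : Cn (con G x y) A) :
    Cn G (lift x y A) := by
  refine ⟨h.1.mono Set.subset_union_left, fun X hX hne hcl => ?_⟩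
  have hyx : y ∈ X → x ∈ X := fun h' => by
    rcases hX h' with h1 | h1
    · exact absurd h1 hy
    · exact hcl y h' x (Or.inl h1.2) hxy.symm
  have hxy' : x ∈ A → x ∈ X → y ∈ X := fun hA h' => hcl x h' y (Or.inr ⟨rfl, hA⟩) hxy
  have hne' : (X ∩ A).Nonempty := by
    obtain ⟨z, hz⟩ := hne
    rcases hX hz with h1 | ⟨rfl, h1⟩
    · exact ⟨z, hz, h1⟩
    · exact ⟨x, hyx hz, h1⟩
  have hAX : A ⊆ X := by
    refine (h.2 (X ∩ A) Set.inter_subset_right hne' fun a ha b hb hab => ⟨?_, hb⟩).trans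
      Set.inter_subset_left
    rcases hab.2.2.2 with h1 | ⟨rfl, h1⟩ | ⟨rfl, h1⟩
    · exact hcl a ha.1 b (Or.inl hb) h1
    · exact hcl y (hxy' ha.2 ha.1) b (Or.inl hb) h1
    · exact hyx (hcl a ha.1 y (Or.inr ⟨rfl, hb⟩) h1.symm)
  rintro z (hz | ⟨rfl, hz⟩)
  exacts [hAX hz, hxy' hz (hAX hz)]

lemma lift_tch {x y : V} {A B : Set V} (hA : y ∉ A) (hB : y ∉ B)
    (hd : Disjoint A B) : Tch G (lift x y A) (lift x y B) ↔ Tch (con G x y) A B := by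
  rw [Set.disjoint_left] at hd
  constructor
  · rintro ⟨a, ha, b, hb, hab⟩
    rcases ha with ha | ⟨rfl, ha⟩ <;> rcases hb with hb | ⟨rfl, hb⟩
    · exact ⟨a, ha, b, hb, fun e => hd ha (e ▸ hb), fun e => hA (e ▸ ha), fun e => hB (e ▸ hb),
        Or.inl hab⟩
    · exact ⟨a, ha, x, hb, fun e => hd ha (e ▸ hb), fun e => hA (e ▸ ha), fun e => hB (e ▸ hb),
        Or.inr (Or.inr ⟨rfl, hab.symm⟩)⟩
    · exact ⟨x, ha, b, hb, fun e => hd ha (e ▸ hb), fun e => hA (e ▸ ha), fun e => hB (e ▸ hb),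
        Or.inr (Or.inl ⟨rfl, hab⟩)⟩
    · exact absurd rfl hab.ne
  · rintro ⟨a, ha, b, hb, -, -, -, h | ⟨rfl, h⟩ | ⟨rfl, h⟩⟩
    · exact ⟨a, Or.inl ha, b, Or.inl hb, h⟩
    · exact ⟨y, Or.inr ⟨rfl, ha⟩, b, Or.inl hb, h⟩
    · exact ⟨a, Or.inl ha, y, Or.inr ⟨rfl, hb⟩, h.symm⟩

lemma lift_k4f {x y : V} {A : Fin 4 → Set V} (hxy : G.Adj x y) (hy : ∀ i, y ∉ A i)
    (h : K4F (con G x y) A) : K4F G fun i => lift x y (A i) :=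
  ⟨fun i => lift_cn hxy (hy i) (h.1 i), fun i j hij => ⟨lift_disjoint (hy i) (hy j) (h.2 i j hij).1,
    (lift_tch (hy i) (hy j) (h.2 i j hij).1).2 (h.2 i j hij).2⟩⟩

lemma NoHat.con {x y : V} {U : Set V} (hxy : G.Adj x y) (hy : y ∉ U)
    (h : NoHat G (insert y U)) : NoHat (con G x y) U := by
  intro A hA hAU E hEU hE hd i j hij hi hj
  have hyA : ∀ i, y ∉ A i := fun i hi => hy (hAU i hi)
  have hyE : y ∉ E := fun h => hy (hEU h)
  obtain ⟨k, hki, hkj, hk⟩ := h _ (lift_k4f hxy hyA hA) (fun i => lift_sub (hAU i)) (lift x y E)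
    (lift_sub hEU) (lift_cn hxy hyE hE) (fun i => lift_disjoint hyE (hyA i) (hd i)) i j hij
    ((lift_tch hyE (hyA i) (hd i)).2 hi) ((lift_tch hyE (hyA j) (hd j)).2 hj)
  exact ⟨k, hki, hkj, (lift_tch hyE (hyA k) (hd k)).1 hk⟩

lemma HasK4.of_con {x y : V} {U : Set V} (hxy : G.Adj x y) (hy : y ∉ U)
    (h : HasK4 (con G x y) U) : HasK4 G (insert y U) := by
  obtain ⟨A, hAU, hA⟩ := h
  exact ⟨_, fun i => lift_sub (hAU i), lift_k4f hxy (fun i hi => hy (hAU i hi)) hA⟩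

lemma Cn.con {x y : V} {A : Set V} (hxy : x ≠ y) (hyx : y ∈ A → x ∈ A) (hne : ∃ a ∈ A, a ≠ y)
    (h : Cn G A) : Cn (con G x y) (A \ {y}) := by
  refine ⟨hne, fun X hX hXne hcl => ?_⟩
  have hAX : A ⊆ X ∪ {z | z = y ∧ y ∈ A ∧ x ∈ X} := by
    refine h.2 _ ?_ (hXne.mono Set.subset_union_left) ?_
    · rintro z (hz | ⟨rfl, hz, -⟩)
      exacts [(hX hz).1, hz]
    · rintro a (ha | ⟨rfl, ha, hxX⟩) b hb hab
      · by_cases hby : b = y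
        · subst hby
          refine Or.inr ⟨rfl, hb, ?_⟩
          by_cases hax : a = x
          · exact hax ▸ ha
          · exact hcl a ha x ⟨hyx hb, hxy⟩ ((con_adj_left hxy hax hab.ne).2 (Or.inr hab.symm)).symm
        · exact Or.inl (hcl a ha b ⟨hb, hby⟩ ⟨hab.ne, (hX ha).2, hby, Or.inl hab⟩)
      · by_cases hbx : b = x
        · exact Or.inl (hbx ▸ hxX)
        · exact Or.inl (hcl x hxX b ⟨hb, hab.ne.symm⟩
            ((con_adj_left hxy hbx hab.ne.symm).2 (Or.inr hab)))
  intro z hz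
  rcases hAX hz.1 with h | h
  exacts [h, absurd h.1 hz.2]

lemma Tch.con {x y : V} {A B : Set V} (hA : y ∈ A → x ∈ A) (hB : y ∈ B → x ∈ B)
    (hd : Disjoint A B) (h : Tch G A B) (hxy : x ≠ y) : Tch (con G x y) (A \ {y}) (B \ {y}) := by
  rw [Set.disjoint_left] at hd
  obtain ⟨a, ha, b, hb, hab⟩ := h
  by_cases hay : a = y
  · subst hay
    have hxA := hA ha
    have hbx : b ≠ x := fun e => hd hxA (e ▸ hb)
    exact ⟨x, ⟨hxA, hxy⟩, b, ⟨hb, hab.ne.symm⟩,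
      (con_adj_left hxy hbx hab.ne.symm).2 (Or.inr hab)⟩
  · by_cases hby : b = y
    · subst hby
      have hxB := hB hb
      have hax : a ≠ x := fun e => hd ha (e ▸ hxB)
      exact ⟨a, ⟨ha, hay⟩, x, ⟨hxB, hxy⟩,
        ((con_adj_left hxy hax hay).2 (Or.inr hab.symm)).symm⟩
    · exact ⟨a, ⟨ha, hay⟩, b, ⟨hb, hby⟩, hab.ne, hay, hby, Or.inl hab⟩

/-- No model of `K₄` in `W` avoids two vertices, and `W` contains no hat over a `K₄`. -/
structure Base (G : SimpleGraph V) (W : Set V) : Prop where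
  hat : NoHat G W
  noK4 : ∀ x ∈ W, ∀ y ∈ W, x ≠ y → ¬ HasK4 G (W \ {x, y})

/-- `S` carries a model of `K₄`, `v` has two neighbours in `S` and `insert v S` is `Base`. -/
structure Hy (G : SimpleGraph V) (S : Set V) (v : V) : Prop where
  base : Base G (insert v S)
  k4 : HasK4 G S
  notMem : v ∉ S
  two : ∃ x ∈ S, ∃ y ∈ S, x ≠ y ∧ G.Adj v x ∧ G.Adj v y

lemma Hy.crit {S : Set V} {v : V} (h : Hy G S v) : Crit G S := by
  refine ⟨h.k4, fun u hu h4 => h.base.noK4 v (Or.inl rfl) u (Or.inr hu)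
    (fun e => h.notMem (e ▸ hu)) (h4.mono fun z hz => ⟨Or.inr hz.1, ?_⟩)⟩
  rintro (rfl | hzu)
  exacts [h.notMem hz.1, hz.2 hzu]

lemma Hy.three [Finite V] {S : Set V} {v : V} (h : Hy G S v) : Three G S v := by
  obtain ⟨x, hx, y, hy, hxy, hvx, hvy⟩ := h.two
  by_contra hno
  refine hat_split h.base.hat (B := S) (E := {v}) (Set.subset_insert _ _) (by simp) h.crit.noCut
    h.k4 (cn_singleton v) (by simpa using h.notMem) hx hy hxy fun b hb => ?_
  constructor
  · intro hvb
    obtain ⟨w, hw, hwb⟩ := tch_singleton_right.1 hvb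
    rw [Set.mem_singleton_iff.1 hw] at hwb
    by_contra hne
    push Not at hne
    exact hno ⟨x, hx, y, hy, b, hb, hxy, hne.1.symm, hne.2.symm, hvx, hvy, hwb⟩
  · rintro (rfl | rfl)
    exacts [tch_singleton_right.2 ⟨v, rfl, hvx⟩, tch_singleton_right.2 ⟨v, rfl, hvy⟩]

lemma Base.con {x y : V} {U : Set V} (hxy : G.Adj x y) (hy : y ∉ U) (h : Base G (insert y U)) :
    Base (con G x y) U where
  hat := h.hat.con hxy hy
  noK4 p hp q hq hpq h4 := by
    refine h.noK4 p (Or.inr hp) q (Or.inr hq) hpq ((h4.of_con hxy fun hyU => hy hyU.1).mono ?_)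
    rintro z (rfl | hz)
    · refine ⟨Or.inl rfl, ?_⟩
      rintro (rfl | rfl)
      exacts [hy hp, hy hq]
    · exact ⟨Or.inr hz.1, hz.2⟩

/-- Either `S` is a clique on four vertices or an edge of `S` can be contracted. -/
lemma Hy.step [Finite V] {S : Set V} {v : V} (h : Hy G S v) :
    (∃ x ∈ S, ∃ y ∈ S, G.Adj x y ∧ Hy (con G x y) (S \ {y}) v) ∨
      ∃ a b c d, S = {a, b, c, d} ∧ G.Adj a b ∧ G.Adj a c ∧ G.Adj a d ∧ G.Adj b c ∧ G.Adj b d ∧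
        G.Adj c d := by
  obtain ⟨A, hA, hAS, hcov⟩ := h.k4.exists_spanning h.crit.noCut.cn
  by_cases hbig : ∃ i, ∃ p ∈ A i, ∃ q ∈ A i, q ≠ p
  · left
    obtain ⟨i, x, hp, q, hq, hqx⟩ := hbig
    obtain ⟨p, hpx, y, hy, hyx, hpy⟩ := (hA.1 i).exists_adj (X := {x})
      (Set.singleton_subset_iff.2 hp) ⟨x, rfl⟩ hq hqx
    rw [Set.mem_singleton_iff.1 hpx] at hpy
    refine ⟨x, hAS i hp, y, hAS i hy, hpy, ?_⟩
    have hvy : v ≠ y := fun e => h.notMem (e ▸ hAS i hy)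
    have hvx : v ≠ x := fun e => h.notMem (e ▸ hAS i hp)
    have hW : insert v S = insert y (insert v (S \ {y})) := by
      ext z
      have : y ∈ S := hAS i hy
      simp only [Set.mem_insert_iff, Set.mem_sdiff, Set.mem_singleton_iff]
      by_cases hz : z = y
      · simp [hz, this]
      · simp [hz]
    have hin : ∀ j, y ∈ A j → x ∈ A j := fun j hj => by
      by_cases hij : j = i
      · exact hij ▸ hp
      · exact absurd hy (Set.disjoint_left.1 (hA.2 j i hij).1 hj)
    refine ⟨(hW ▸ h.base).con hpy (by simp [hvy.symm]), ⟨fun j => A j \ {y}, fun j =>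
      Set.sdiff_subset_sdiff_left (hAS j), fun j => (hA.1 j).con hpy.ne (hin j) ?_, fun j k hjk =>
      ⟨(hA.2 j k hjk).1.mono Set.sdiff_subset Set.sdiff_subset,
        (hA.2 j k hjk).2.con (hin j) (hin k) (hA.2 j k hjk).1 hpy.ne⟩⟩,
      fun hv => h.notMem hv.1, ?_⟩
    · by_cases hyj : y ∈ A j
      · exact ⟨x, hin j hyj, hpy.ne⟩
      · obtain ⟨z, hz⟩ := (hA.1 j).nonempty
        exact ⟨z, hz, fun e => hyj (e ▸ hz)⟩
    · obtain ⟨a, ha, b, hb, c, hc, hab, hac, hbc, hva, hvb, hvc⟩ := h.three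
      have key : ∀ w ∈ S, G.Adj v w → w ≠ y → (con G x y).Adj v w := fun w hw hvw hwy =>
        ⟨hvw.ne, hvy, hwy, Or.inl hvw⟩
      by_cases hay : a = y
      · subst hay
        exact ⟨b, ⟨hb, hab.symm⟩, c, ⟨hc, hac.symm⟩, hbc, key b hb hvb hab.symm,
          key c hc hvc hac.symm⟩
      · by_cases hby : b = y
        · subst hby
          exact ⟨a, ⟨ha, hab⟩, c, ⟨hc, hbc.symm⟩, hac, key a ha hva hab, key c hc hvc hbc.symm⟩
        · exact ⟨a, ⟨ha, hay⟩, b, ⟨hb, hby⟩, hab, key a ha hva hay, key b hb hvb hby⟩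
  · right
    push Not at hbig
    choose s hs using fun i => (hA.1 i).nonempty
    have hadj : ∀ i j, i ≠ j → G.Adj (s i) (s j) := fun i j hij => by
      obtain ⟨p, hp, q, hq, hpq⟩ := (hA.2 i j hij).2
      rwa [hbig i _ hp _ (hs i), hbig j _ hq _ (hs j)]
    refine ⟨s 0, s 1, s 2, s 3, ?_, hadj _ _ (by decide), hadj _ _ (by decide),
      hadj _ _ (by decide), hadj _ _ (by decide), hadj _ _ (by decide), hadj _ _ (by decide)⟩
    ext z
    constructor
    · intro hz
      obtain ⟨i, hi⟩ := hcov z hz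
      have hzi := hbig i _ (hs i) _ hi
      fin_cases i <;> simp_all
    · rintro (rfl | rfl | rfl | rfl)
      exacts [hAS _ (hs 0), hAS _ (hs 1), hAS _ (hs 2), hAS _ (hs 3)]

end Contraction

section BaseOutcomes

variable {V : Type} {G : SimpleGraph V}

lemma Base.pairs {U : Set V} {a b c c' d d' e e' : V} (h : Base G U)
    (hU : a ∈ U ∧ b ∈ U ∧ c ∈ U ∧ c' ∈ U ∧ d ∈ U ∧ d' ∈ U ∧ e ∈ U ∧ e' ∈ U)
    (hab : G.Adj a b) (hc : c = c' ∨ G.Adj c c')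
    (hd : d = d' ∨ G.Adj d d') (hac : G.Adj a c ∨ G.Adj a c') (had : G.Adj a d ∨ G.Adj a d')
    (hbc : G.Adj b c ∨ G.Adj b c') (hbd : G.Adj b d ∨ G.Adj b d')
    (hcd : (G.Adj c d ∨ G.Adj c d') ∨ G.Adj c' d ∨ G.Adj c' d')
    (na : a ≠ c ∧ a ≠ c' ∧ a ≠ d ∧ a ≠ d') (nb : b ≠ c ∧ b ≠ c' ∧ b ≠ d ∧ b ≠ d')
    (nc : c ≠ d ∧ c ≠ d' ∧ c' ≠ d ∧ c' ≠ d')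
    (ne : e ≠ e' ∧ ∀ z, z = e ∨ z = e' → a ≠ z ∧ b ≠ z ∧ c ≠ z ∧ c' ≠ z ∧ d ≠ z ∧ d' ≠ z) :
    False := by
  obtain ⟨ua, ub, uc, uc', ud, ud', ue, ue'⟩ := hU
  obtain ⟨n1, n2, n3, n4, n5, n6⟩ := ne.2 e (Or.inl rfl)
  obtain ⟨m1, m2, m3, m4, m5, m6⟩ := ne.2 e' (Or.inr rfl)
  refine h.noK4 e ue e' ue' ne.1
    ((k4m_pairs hab hc hd hac had hbc hbd hcd na nb nc).hasK4 ?_ ?_ ?_ ?_)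
  all_goals simp [Set.insert_subset_iff, *]

/-- `W` induces the octahedron. -/
def O222 (G : SimpleGraph V) (W : Set V) : Prop :=
  ∃ a a' b b' c c', [a, a', b, b', c, c'].Nodup ∧
    (∀ z, z ∈ W ↔ z = a ∨ z = a' ∨ z = b ∨ z = b' ∨ z = c ∨ z = c') ∧
    (¬ G.Adj a a' ∧ ¬ G.Adj b b' ∧ ¬ G.Adj c c') ∧
    (G.Adj a b ∧ G.Adj a b' ∧ G.Adj a' b ∧ G.Adj a' b') ∧
    (G.Adj a c ∧ G.Adj a c' ∧ G.Adj a' c ∧ G.Adj a' c') ∧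
    (G.Adj b c ∧ G.Adj b c' ∧ G.Adj b' c ∧ G.Adj b' c')

/-- `W` induces `K₃,₃` with one or two edges added on one side. -/
def O33 (G : SimpleGraph V) (W : Set V) : Prop :=
  ∃ s t u p q w, [s, t, u, p, q, w].Nodup ∧
    (∀ z, z ∈ W ↔ z = s ∨ z = t ∨ z = u ∨ z = p ∨ z = q ∨ z = w) ∧
    (¬ G.Adj p q ∧ ¬ G.Adj p w ∧ ¬ G.Adj q w) ∧ (G.Adj s t ∧ ¬ G.Adj t u) ∧
    (G.Adj s p ∧ G.Adj s q ∧ G.Adj s w) ∧ (G.Adj t p ∧ G.Adj t q ∧ G.Adj t w) ∧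
    (G.Adj u p ∧ G.Adj u q ∧ G.Adj u w)

/-- `W` induces `K₃,₄`. -/
def O34 (G : SimpleGraph V) (W : Set V) : Prop :=
  ∃ s t u p q w y, [s, t, u, p, q, w, y].Nodup ∧
    (∀ z, z ∈ W ↔ z = s ∨ z = t ∨ z = u ∨ z = p ∨ z = q ∨ z = w ∨ z = y) ∧
    (¬ G.Adj p q ∧ ¬ G.Adj p w ∧ ¬ G.Adj q w ∧ ¬ G.Adj p y ∧ ¬ G.Adj q y ∧ ¬ G.Adj w y) ∧
    (¬ G.Adj s t ∧ ¬ G.Adj s u ∧ ¬ G.Adj t u) ∧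
    (G.Adj s p ∧ G.Adj s q ∧ G.Adj s w ∧ G.Adj s y) ∧
    (G.Adj t p ∧ G.Adj t q ∧ G.Adj t w ∧ G.Adj t y) ∧
    (G.Adj u p ∧ G.Adj u q ∧ G.Adj u w ∧ G.Adj u y)

/-! ### Uncontracting a vertex of `K₄` -/

lemma uncontract_K4_of_two {W : Set V} (hB : Base G W) {x y a b c v : V}
    (hd : [x, y, a, b, c, v].Nodup)
    (hW : ∀ z, z ∈ W ↔ z = x ∨ z = y ∨ z = a ∨ z = b ∨ z = c ∨ z = v)
    (hab : G.Adj a b ∧ G.Adj a c ∧ G.Adj b c ∧ G.Adj v a ∧ G.Adj v b ∧ ¬ G.Adj v c)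
    (hxy : G.Adj x y) (hxa : G.Adj x a) (hxb : G.Adj x b)
    (hc : G.Adj x c ∨ G.Adj y c) (hv : G.Adj x v ∨ G.Adj y v) : O33 G W := by
  have hs : ∀ x y, G.Adj x y → G.Adj y x := fun _ _ h => h.symm
  simp only [List.nodup_cons, List.mem_cons, List.not_mem_nil, not_or] at hd
  have hxc : ¬ G.Adj x c := fun h => hB.pairs (a := a) (b := b) (c := x) (c' := x) (d := c)
    (d' := c) (e := y) (e' := v) (by simp [hW]) (by grind) (by grind) (by grind) (by grind)
    (by grind) (by grind) (by grind) (by grind) (by grind) (by grind) (by grind) (by grind)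
  have hxv : ¬ G.Adj x v := fun h => hB.pairs (a := a) (b := b) (c := x) (c' := x) (d := v)
    (d' := v) (e := y) (e' := c) (by simp [hW]) (by grind) (by grind) (by grind) (by grind)
    (by grind) (by grind) (by grind) (by grind) (by grind) (by grind) (by grind) (by grind)
  have hyab : ¬ (G.Adj y a ∧ G.Adj y b) := fun h => hB.pairs (a := a) (b := b) (c := y) (c' := y)
    (d := v) (d' := v) (e := x) (e' := c) (by simp [hW]) (by grind) (by grind) (by grind)
    (by grind) (by grind) (by grind) (by grind) (by grind) (by grind) (by grind) (by grind)
    (by grind)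
  have fin : ∀ s t, (s = a ∧ t = b ∨ s = b ∧ t = a) → ¬ G.Adj t y → O33 G W := by
    intro s t hst hty
    refine ⟨s, t, y, x, c, v, ?_, ?_, ?_, ?_, ?_, ?_, ?_⟩
    · simp only [List.nodup_cons, List.mem_cons, List.not_mem_nil, not_or]
      grind
    all_goals grind
  by_cases hy : G.Adj y b
  · exact fin b a (by simp) fun h => hyab ⟨h.symm, hy⟩
  · exact fin a b (by simp) fun h => hy h.symm

lemma uncontract_K4_of_one {W : Set V} (hB : Base G W) {x y a b c v : V}
    (hd : [x, y, a, b, c, v].Nodup)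
    (hW : ∀ z, z ∈ W ↔ z = x ∨ z = y ∨ z = a ∨ z = b ∨ z = c ∨ z = v)
    (hab : G.Adj a b ∧ G.Adj a c ∧ G.Adj b c ∧ G.Adj v a ∧ G.Adj v b ∧ ¬ G.Adj v c)
    (hxy : G.Adj x y) (hxa : G.Adj x a) (hya : ¬ G.Adj y a)
    (hyb : G.Adj y b) (hc : G.Adj x c ∨ G.Adj y c) (hv : G.Adj x v ∨ G.Adj y v) :
    G.Adj y c ∧ G.Adj y v := by
  have hs : ∀ x y, G.Adj x y → G.Adj y x := fun _ _ h => h.symm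
  simp only [List.nodup_cons, List.mem_cons, List.not_mem_nil, not_or] at hd
  by_cases hyv : G.Adj y v <;> by_cases hyc : G.Adj y c
  · exact ⟨hyc, hyv⟩
  · have := hB.hat.pairs (a := b) (b := y) (c := a) (c' := x) (d := v) (d' := v) (e := c)
      (by simp [hW]) (by grind) (by grind) (by grind) (by grind) (by grind) (by grind) (by grind)
      (by grind) (by grind) (by grind) (by grind) (by grind)
    simp only [NotTwo] at this
    grind
  · have := hB.hat.pairs (a := b) (b := y) (c := a) (c' := x) (d := c) (d' := c) (e := v)
      (by simp [hW]) (by grind) (by grind) (by grind) (by grind) (by grind) (by grind) (by grind)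
      (by grind) (by grind) (by grind) (by grind) (by grind)
    simp only [NotTwo] at this
    grind
  · have := hB.hat.pairs (a := a) (b := b) (c := x) (c' := v) (d := c) (d' := c) (e := y)
      (by simp [hW]) (by grind) (by grind) (by grind) (by grind) (by grind) (by grind) (by grind)
      (by grind) (by grind) (by grind) (by grind) (by grind)
    simp only [NotTwo] at this
    grind

lemma uncontract_K4 {W : Set V} (hB : Base G W) {x y a b c v : V}
    (hd : [x, y, a, b, c, v].Nodup)
    (hW : ∀ z, z ∈ W ↔ z = x ∨ z = y ∨ z = a ∨ z = b ∨ z = c ∨ z = v)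
    (hab : G.Adj a b ∧ G.Adj a c ∧ G.Adj b c ∧ G.Adj v a ∧ G.Adj v b ∧ ¬ G.Adj v c)
    (hxy : G.Adj x y) (ha : G.Adj x a ∨ G.Adj y a) (hb : G.Adj x b ∨ G.Adj y b)
    (hc : G.Adj x c ∨ G.Adj y c) (hv : G.Adj x v ∨ G.Adj y v) : O222 G W ∨ O33 G W := by
  have hs : ∀ x y, G.Adj x y → G.Adj y x := fun _ _ h => h.symm
  have hd' : [y, x, a, b, c, v].Nodup := by
    simp only [List.nodup_cons, List.mem_cons, List.not_mem_nil, not_or] at hd ⊢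
    grind
  have hW' : ∀ z, z ∈ W ↔ z = y ∨ z = x ∨ z = a ∨ z = b ∨ z = c ∨ z = v := by grind
  by_cases h1 : G.Adj x a ∧ G.Adj x b
  · exact Or.inr (uncontract_K4_of_two hB hd hW hab hxy h1.1 h1.2 hc hv)
  by_cases h2 : G.Adj y a ∧ G.Adj y b
  · exact Or.inr (uncontract_K4_of_two hB hd' hW' hab hxy.symm h2.1 h2.2 hc.symm hv.symm)
  refine Or.inl ?_
  have key : ∀ x y, [x, y, a, b, c, v].Nodup →
      (∀ z, z ∈ W ↔ z = x ∨ z = y ∨ z = a ∨ z = b ∨ z = c ∨ z = v) → G.Adj x y →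
      (G.Adj x c ∨ G.Adj y c) → (G.Adj x v ∨ G.Adj y v) → G.Adj x a → ¬ G.Adj x b →
      ¬ G.Adj y a → G.Adj y b → O222 G W := by
    intro x y hd hW hxy hc hv hxa hxb hya hyb
    obtain ⟨hyc, hyv⟩ := uncontract_K4_of_one hB hd hW hab hxy hxa hya hyb hc hv
    obtain ⟨hxc, hxv⟩ := uncontract_K4_of_one hB (x := y) (y := x) (a := b) (b := a) (c := c)
      (v := v) (by simp only [List.nodup_cons, List.mem_cons, List.not_mem_nil, not_or] at hd ⊢
                   grind) (by grind) (by grind) hxy.symm hyb hxb hxa hc.symm hv.symm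
    refine ⟨a, y, b, x, c, v, ?_, ?_, ?_, ?_, ?_, ?_⟩
    · simp only [List.nodup_cons, List.mem_cons, List.not_mem_nil, not_or] at hd ⊢
      grind
    all_goals grind
  by_cases hxa : G.Adj x a
  · exact key x y hd hW hxy hc hv hxa (by grind) (by grind) (by grind)
  · exact key y x hd' hW' hxy.symm hc.symm hv.symm (by grind) (by grind) (by grind) (by grind)

/-! ### Uncontracting a vertex of `K₃,₃` with additional edges -/

lemma uncontract_O33_of_one {W : Set V} (hB : Base G W) {x y t t' p q w : V}
    (hd : [x, y, t, t', p, q, w].Nodup)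
    (hW : ∀ z, z ∈ W ↔ z = x ∨ z = y ∨ z = t ∨ z = t' ∨ z = p ∨ z = q ∨ z = w)
    (hpq : ¬ G.Adj p q ∧ ¬ G.Adj p w ∧ ¬ G.Adj q w)
    (ht : G.Adj t p ∧ G.Adj t q ∧ G.Adj t w) (ht' : G.Adj t' p ∧ G.Adj t' q ∧ G.Adj t' w)
    (hxy : G.Adj x y) (hx : G.Adj x p ∧ G.Adj x q)
    (hy : ¬ G.Adj y p ∧ ¬ G.Adj y q ∧ G.Adj y w) (hyt : G.Adj y t) : False := by
  have hs : ∀ x y, G.Adj x y → G.Adj y x := fun _ _ h => h.symm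
  simp only [List.nodup_cons, List.mem_cons, List.not_mem_nil, not_or] at hd
  by_cases hyt' : G.Adj y t'
  · have := hB.hat.pairs (a := y) (b := w) (c := t) (c' := t) (d := t') (d' := q) (e := p)
      (by simp [hW]) (by grind) (by grind) (by grind) (by grind) (by grind) (by grind) (by grind)
      (by grind) (by grind) (by grind) (by grind) (by grind)
    simp only [NotTwo] at this
    grind
  by_cases hwx : G.Adj w x
  · have := hB.hat.pairs (a := w) (b := y) (c := x) (c' := p) (d := t) (d' := t) (e := q)
      (by simp [hW]) (by grind) (by grind) (by grind) (by grind) (by grind) (by grind) (by grind)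
      (by grind) (by grind) (by grind) (by grind) (by grind)
    simp only [NotTwo] at this
    grind
  · have := hB.hat.pairs (a := x) (b := p) (c := t) (c' := y) (d := q) (d' := t') (e := w)
      (by simp [hW]) (by grind) (by grind) (by grind) (by grind) (by grind) (by grind) (by grind)
      (by grind) (by grind) (by grind) (by grind) (by grind)
    simp only [NotTwo] at this
    grind

lemma uncontract_O33_of_adj {W : Set V} (hB : Base G W) {x y t t' p q w : V}
    (hd : [x, y, t, t', p, q, w].Nodup)
    (hW : ∀ z, z ∈ W ↔ z = x ∨ z = y ∨ z = t ∨ z = t' ∨ z = p ∨ z = q ∨ z = w)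
    (hpq : ¬ G.Adj p q ∧ ¬ G.Adj p w ∧ ¬ G.Adj q w)
    (ht : G.Adj t p ∧ G.Adj t q ∧ G.Adj t w) (ht' : G.Adj t' p ∧ G.Adj t' q ∧ G.Adj t' w)
    (hxy : G.Adj x y) (hx : G.Adj x p ∧ G.Adj x q) (hw : G.Adj x w ∨ G.Adj y w)
    (htt : ¬ G.Adj t t' ∧ ¬ G.Adj x t ∧ ¬ G.Adj x t') (hyt : G.Adj y t) : O34 G W := by
  have hs : ∀ x y, G.Adj x y → G.Adj y x := fun _ _ h => h.symm
  have hd0 := hd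
  simp only [List.nodup_cons, List.mem_cons, List.not_mem_nil, not_or] at hd
  have two : ∀ α β γ, (α = p ∧ β = q ∧ γ = w ∨ α = p ∧ β = w ∧ γ = q ∨ α = q ∧ β = w ∧ γ = p) →
      G.Adj y α → G.Adj y β → False := by
    intro α β γ h hα hβ
    exact hB.pairs (a := y) (b := t) (c := α) (c' := α) (d := β) (d' := t') (e := x) (e' := γ)
      (by grind) (by grind) (by grind) (by grind) (by grind)
      (by grind) (by grind) (by grind) (by grind) (by grind) (by grind) (by grind) (by grind)
  have h1 := two p q w (by simp)
  have h2 := two p w q (by simp)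
  have h3 := two q w p (by simp)
  by_cases hyp : G.Adj y p
  · refine (uncontract_O33_of_one hB (x := x) (y := y) (t := t) (t' := t') (p := w) (q := q)
      (w := p) ?_ ?_ ?_ ?_ ?_ hxy ?_ ?_ hyt).elim
    · simp only [List.nodup_cons, List.mem_cons, List.not_mem_nil, not_or]
      grind
    all_goals grind
  by_cases hyq : G.Adj y q
  · refine (uncontract_O33_of_one hB (x := x) (y := y) (t := t) (t' := t') (p := w) (q := p)
      (w := q) ?_ ?_ ?_ ?_ ?_ hxy ?_ ?_ hyt).elim
    · simp only [List.nodup_cons, List.mem_cons, List.not_mem_nil, not_or]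
      grind
    all_goals grind
  by_cases hyw : G.Adj y w
  · exact (uncontract_O33_of_one hB hd0 hW hpq ht ht' hxy hx ⟨hyp, hyq, hyw⟩ hyt).elim
  by_cases hyt' : G.Adj y t'
  · refine ⟨x, t, t', p, q, w, y, ?_, ?_, ?_, ?_, ?_, ?_, ?_⟩
    · simp only [List.nodup_cons, List.mem_cons, List.not_mem_nil, not_or]
      grind
    all_goals grind
  · have := hB.hat.pairs (a := x) (b := p) (c := t) (c' := q) (d := t') (d' := w) (e := y)
      (by simp [hW]) (by grind) (by grind) (by grind) (by grind) (by grind) (by grind) (by grind)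
      (by grind) (by grind) (by grind) (by grind) (by grind)
    simp only [NotTwo] at this
    grind

lemma uncontract_O33_of_two {W : Set V} (hB : Base G W) {x y t t' p q w : V}
    (hd : [x, y, t, t', p, q, w].Nodup)
    (hW : ∀ z, z ∈ W ↔ z = x ∨ z = y ∨ z = t ∨ z = t' ∨ z = p ∨ z = q ∨ z = w)
    (hpq : ¬ G.Adj p q ∧ ¬ G.Adj p w ∧ ¬ G.Adj q w)
    (ht : G.Adj t p ∧ G.Adj t q ∧ G.Adj t w) (ht' : G.Adj t' p ∧ G.Adj t' q ∧ G.Adj t' w)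
    (hxy : G.Adj x y) (hx : G.Adj x p ∧ G.Adj x q) (hw : G.Adj x w ∨ G.Adj y w)
    (he : G.Adj t t' ∨ (G.Adj x t ∨ G.Adj y t) ∨ G.Adj x t' ∨ G.Adj y t') : O34 G W := by
  have hs : ∀ x y, G.Adj x y → G.Adj y x := fun _ _ h => h.symm
  have hd0 := hd
  simp only [List.nodup_cons, List.mem_cons, List.not_mem_nil, not_or] at hd
  have htt : ¬ G.Adj t t' := fun h => hB.pairs (a := t) (b := t') (c := p) (c' := p) (d := x)
    (d' := q) (e := y) (e' := w) (by simp [hW]) (by grind) (by grind) (by grind) (by grind)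
    (by grind) (by grind) (by grind) (by grind) (by grind) (by grind) (by grind) (by grind)
  have hxt : ¬ G.Adj x t := fun h => hB.pairs (a := x) (b := t) (c := p) (c' := p) (d := q)
    (d' := t') (e := y) (e' := w) (by simp [hW]) (by grind) (by grind) (by grind) (by grind)
    (by grind) (by grind) (by grind) (by grind) (by grind) (by grind) (by grind) (by grind)
  have hxt' : ¬ G.Adj x t' := fun h => hB.pairs (a := x) (b := t') (c := p) (c' := p) (d := q)
    (d' := t) (e := y) (e' := w) (by simp [hW]) (by grind) (by grind) (by grind) (by grind)
    (by grind) (by grind) (by grind) (by grind) (by grind) (by grind) (by grind) (by grind)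
  by_cases hyt : G.Adj y t
  · exact uncontract_O33_of_adj hB hd0 hW hpq ht ht' hxy hx hw ⟨htt, hxt, hxt'⟩ hyt
  · refine uncontract_O33_of_adj hB (x := x) (y := y) (t := t') (t' := t) (p := p) (q := q)
      (w := w) ?_ ?_ hpq ht' ht hxy hx hw ⟨fun h => htt h.symm, hxt', hxt⟩ (by grind)
    · simp only [List.nodup_cons, List.mem_cons, List.not_mem_nil, not_or]
      grind
    · grind

lemma uncontract_O33_side {W : Set V} (hB : Base G W) {x y t t' p q w : V}
    (hd : [x, y, t, t', p, q, w].Nodup)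
    (hW : ∀ z, z ∈ W ↔ z = x ∨ z = y ∨ z = t ∨ z = t' ∨ z = p ∨ z = q ∨ z = w)
    (hpq : ¬ G.Adj p q ∧ ¬ G.Adj p w ∧ ¬ G.Adj q w)
    (ht : G.Adj t p ∧ G.Adj t q ∧ G.Adj t w) (ht' : G.Adj t' p ∧ G.Adj t' q ∧ G.Adj t' w)
    (hxy : G.Adj x y) (hp : G.Adj x p ∨ G.Adj y p) (hq : G.Adj x q ∨ G.Adj y q)
    (hw : G.Adj x w ∨ G.Adj y w)
    (he : G.Adj t t' ∨ (G.Adj x t ∨ G.Adj y t) ∨ G.Adj x t' ∨ G.Adj y t') : O34 G W := by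
  have hs : ∀ x y, G.Adj x y → G.Adj y x := fun _ _ h => h.symm
  simp only [List.nodup_cons, List.mem_cons, List.not_mem_nil, not_or] at hd
  have key : ∀ x' y' α β γ, (x' = x ∧ y' = y ∨ x' = y ∧ y' = x) →
      (α = p ∧ β = q ∧ γ = w ∨ α = p ∧ β = w ∧ γ = q ∨ α = q ∧ β = w ∧ γ = p) →
      G.Adj x' α → G.Adj x' β → O34 G W := by
    intro x' y' α β γ h h' hα hβ
    refine uncontract_O33_of_two hB (x := x') (y := y') (t := t) (t' := t') (p := α) (q := β)
      (w := γ) ?_ ?_ ?_ ?_ ?_ ?_ ⟨hα, hβ⟩ ?_ ?_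
    · simp only [List.nodup_cons, List.mem_cons, List.not_mem_nil, not_or]
      rcases h with ⟨rfl, rfl⟩ | ⟨rfl, rfl⟩ <;>
        rcases h' with ⟨rfl, rfl, rfl⟩ | ⟨rfl, rfl, rfl⟩ | ⟨rfl, rfl, rfl⟩ <;>
        grind
    all_goals
      rcases h with ⟨rfl, rfl⟩ | ⟨rfl, rfl⟩ <;>
        rcases h' with ⟨rfl, rfl, rfl⟩ | ⟨rfl, rfl, rfl⟩ | ⟨rfl, rfl, rfl⟩ <;> grind
  by_cases h1 : G.Adj x p
  · by_cases h2 : G.Adj x q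
    · exact key x y p q w (by simp) (by simp) h1 h2
    by_cases h3 : G.Adj x w
    · exact key x y p w q (by simp) (by simp) h1 h3
    · exact key y x q w p (by simp) (by simp) (by grind) (by grind)
  · by_cases h2 : G.Adj y q
    · exact key y x p q w (by simp) (by simp) (by grind) h2
    by_cases h3 : G.Adj y w
    · exact key y x p w q (by simp) (by simp) (by grind) h3
    · exact key x y q w p (by simp) (by simp) (by grind) (by grind)

end BaseOutcomes

section BaseInduction

variable {V : Type} {G : SimpleGraph V}

lemma not_uncontract_O34_side {W : Set V} (hB : Base G W) {x y t t' p q w u : V}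
    (hd : [x, y, t, t', p, q, w, u].Nodup)
    (hW : ∀ z, z ∈ W ↔ z = x ∨ z = y ∨ z = t ∨ z = t' ∨ z = p ∨ z = q ∨ z = w ∨ z = u)
    (ht : G.Adj t p ∧ G.Adj t q ∧ G.Adj t w) (ht' : G.Adj t' p ∧ G.Adj t' q ∧ G.Adj t' w)
    (hp : G.Adj x p ∨ G.Adj y p) (hq : G.Adj x q ∨ G.Adj y q) (hw : G.Adj x w ∨ G.Adj y w) :
    False := by
  have hs : ∀ x y, G.Adj x y → G.Adj y x := fun _ _ h => h.symm
  simp only [List.nodup_cons, List.mem_cons, List.not_mem_nil, not_or] at hd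
  have key : ∀ x' y' α β γ, (x' = x ∧ y' = y ∨ x' = y ∧ y' = x) →
      (α = p ∧ β = q ∧ γ = w ∨ α = p ∧ β = w ∧ γ = q ∨ α = q ∧ β = w ∧ γ = p) →
      G.Adj x' α → G.Adj x' β → False := by
    intro x' y' α β γ h h' hα hβ
    refine hB.pairs (a := t) (b := α) (c := t') (c' := γ) (d := β) (d' := x') (e := y')
      (e' := u) ?_ ?_ ?_ ?_ ?_ ?_ ?_ ?_ ?_ ?_ ?_ ?_ ?_
    all_goals
      rcases h with ⟨rfl, rfl⟩ | ⟨rfl, rfl⟩ <;>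
        rcases h' with ⟨rfl, rfl, rfl⟩ | ⟨rfl, rfl, rfl⟩ | ⟨rfl, rfl, rfl⟩ <;> grind
  by_cases h1 : G.Adj x p
  · by_cases h2 : G.Adj x q
    · exact key x y p q w (by simp) (by simp) h1 h2
    by_cases h3 : G.Adj x w
    · exact key x y p w q (by simp) (by simp) h1 h3
    · exact key y x q w p (by simp) (by simp) (by grind) (by grind)
  · by_cases h2 : G.Adj y q
    · exact key y x p q w (by simp) (by simp) (by grind) h2
    by_cases h3 : G.Adj y w
    · exact key y x p w q (by simp) (by simp) (by grind) h3
    · exact key x y q w p (by simp) (by simp) (by grind) (by grind)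

lemma O222.not_uncontract {W : Set V} {x y : V} (h : O222 (con G x y) W) (hx : x ∈ W)
    (hy : y ∉ W) (hxy : G.Adj x y) (hB : Base G (insert y W)) : False := by
  obtain ⟨a, a', b, b', c, c', hd, hW, hn, h1, h2, h3⟩ := h
  have hs : ∀ x y, G.Adj x y → G.Adj y x := fun _ _ h => h.symm
  have hc : ∀ a b, a ≠ x → a ≠ y → b ≠ x → b ≠ y → (con G x y).Adj a b → G.Adj a b :=
    fun a b h1 h2 h3 h4 => (con_adj_iff h1 h2 h3 h4).1
  have hsc : ∀ a b, (con G x y).Adj a b → (con G x y).Adj b a := fun _ _ h => h.symm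
  have hym : y ∈ insert y W := Or.inl rfl
  have hm : ∀ z, z ∈ W → z ∈ insert y W := fun z hz => Or.inr hz
  simp only [List.nodup_cons, List.mem_cons, List.not_mem_nil, not_or] at hd
  have key : ∀ a' b b' c c' : V,
      (a' ∈ W ∧ a' ≠ x) ∧ (b ∈ W ∧ b ≠ x) ∧ (b' ∈ W ∧ b' ≠ x) ∧ (c ∈ W ∧ c ≠ x) ∧
        (c' ∈ W ∧ c' ≠ x) →
      (con G x y).Adj a' b ∧ (con G x y).Adj a' b' ∧ (con G x y).Adj a' c →
      (con G x y).Adj b c ∧ (con G x y).Adj b c' ∧ (con G x y).Adj b' c ∧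
        (con G x y).Adj b' c' →
      b ≠ b' ∧ c ≠ c' ∧ a' ≠ c' → False := by
    intro a' b b' c c' hmem hA hA' hne
    have hne' : ∀ z ∈ W, z ≠ y := fun z hz e => hy (e ▸ hz)
    have n1 := hne' a' hmem.1.1
    have n2 := hne' b hmem.2.1.1
    have n3 := hne' b' hmem.2.2.1.1
    have n4 := hne' c hmem.2.2.2.1.1
    have n5 := hne' c' hmem.2.2.2.2.1
    have a1 := hc a' b (by grind) n1 (by grind) n2 hA.1
    have a2 := hc a' b' (by grind) n1 (by grind) n3 hA.2.1
    have a3 := hc a' c (by grind) n1 (by grind) n4 hA.2.2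
    have a4 := hc b c (by grind) n2 (by grind) n4 hA'.1
    have a5 := hc b c' (by grind) n2 (by grind) n5 hA'.2.1
    have a6 := hc b' c (by grind) n3 (by grind) n4 hA'.2.2.1
    have a7 := hc b' c' (by grind) n3 (by grind) n5 hA'.2.2.2
    clear hc hsc hn h1 h2 h3 hd hA hA'
    have e1 := a1.ne
    have e2 := a2.ne
    have e3 := a3.ne
    have e4 := a4.ne
    have e5 := a5.ne
    have e6 := a6.ne
    have e7 := a7.ne
    exact hB.pairs (a := a') (b := b) (c := c) (c' := c) (d := b') (d' := c') (e := x) (e' := y)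
      (by grind) (by grind) (by grind) (by grind) (by grind) (by grind) (by grind) (by grind)
      (by grind) (by grind) (by grind) (by grind) ⟨hxy.ne, by grind⟩
  have hmW : a ∈ W ∧ a' ∈ W ∧ b ∈ W ∧ b' ∈ W ∧ c ∈ W ∧ c' ∈ W := by simp [hW]
  clear hc
  rcases (hW x).1 hx with rfl | rfl | rfl | rfl | rfl | rfl
  · exact key a' b b' c c' (by grind) (by grind) (by grind) (by grind)
  · exact key a b b' c c' (by grind) (by grind) (by grind) (by grind)
  · exact key b' a a' c c' (by grind) (by grind) (by grind) (by grind)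
  · exact key b a a' c c' (by grind) (by grind) (by grind) (by grind)
  · exact key c' b b' a a' (by grind) (by grind) (by grind) (by grind)
  · exact key c b b' a a' (by grind) (by grind) (by grind) (by grind)

lemma O33.uncontract {W : Set V} {x y : V} (h : O33 (con G x y) W) (hx : x ∈ W)
    (hy : y ∉ W) (hxy : G.Adj x y) (hB : Base G (insert y W)) : O34 G (insert y W) := by
  obtain ⟨s, t, u, p, q, w, hd, hW, hn, he, h1, h2, h3⟩ := h
  have hs : ∀ x y, G.Adj x y → G.Adj y x := fun _ _ h => h.symm
  have hc : ∀ a b, a ≠ x → a ≠ y → b ≠ x → b ≠ y → ((con G x y).Adj a b ↔ G.Adj a b) :=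
    fun a b h1 h2 h3 h4 => con_adj_iff h1 h2 h3 h4
  have hl : ∀ b, b ≠ x → b ≠ y → ((con G x y).Adj x b ↔ G.Adj x b ∨ G.Adj y b) :=
    fun b h1 h2 => con_adj_left hxy.ne h1 h2
  have hsc : ∀ a b, (con G x y).Adj a b → (con G x y).Adj b a := fun _ _ h => h.symm
  have hym : y ∈ insert y W := Or.inl rfl
  have hm : ∀ z, z ∈ W → z ∈ insert y W := fun z hz => Or.inr hz
  have hne' : ∀ z ∈ W, z ≠ y := fun z hz e => hy (e ▸ hz)
  have hmW : s ∈ W ∧ t ∈ W ∧ u ∈ W ∧ p ∈ W ∧ q ∈ W ∧ w ∈ W := by simp [hW]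
  have hney : s ≠ y ∧ t ≠ y ∧ u ≠ y ∧ p ≠ y ∧ q ≠ y ∧ w ≠ y := by grind
  simp only [List.nodup_cons, List.mem_cons, List.not_mem_nil, not_or] at hd
  have key : ∀ q w : V, q ∈ W ∧ q ≠ x → w ∈ W ∧ w ≠ x → q ≠ w → x ≠ s ∧ x ≠ t ∧ x ≠ u →
      (con G x y).Adj s q ∧ (con G x y).Adj t q ∧ (con G x y).Adj u q →
      (con G x y).Adj s w ∧ (con G x y).Adj t w ∧ (con G x y).Adj u w → False := by
    intro q w hq hw hqw hxs hAq hAw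
    have a0 := (hc s t (by grind) (by grind) (by grind) (by grind)).1 he.1
    have a1 := (hc s q (by grind) (by grind) (by grind) (by grind)).1 hAq.1
    have a2 := (hc t q (by grind) (by grind) (by grind) (by grind)).1 hAq.2.1
    have a3 := (hc u q (by grind) (by grind) (by grind) (by grind)).1 hAq.2.2
    have a4 := (hc s w (by grind) (by grind) (by grind) (by grind)).1 hAw.1
    have a5 := (hc t w (by grind) (by grind) (by grind) (by grind)).1 hAw.2.1
    have a6 := (hc u w (by grind) (by grind) (by grind) (by grind)).1 hAw.2.2
    have e1 := a1.ne
    have e2 := a2.ne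
    have e3 := a3.ne
    have e4 := a4.ne
    have e5 := a5.ne
    clear hc hl hsc hn h1 h2 h3 hAq hAw
    exact hB.pairs (a := s) (b := t) (c := q) (c' := q) (d := u) (d' := w) (e := x) (e' := y)
      (by grind) (by grind) (by grind) (by grind) (by grind) (by grind) (by grind) (by grind)
      (by grind) (by grind) (by grind) (by grind) ⟨hxy.ne, by grind⟩
  have side : ∀ t' t'' : V, t' ≠ x ∧ t' ∈ W → t'' ≠ x ∧ t'' ∈ W →
      x ≠ p ∧ x ≠ q ∧ x ≠ w →
      [x, t', t'', p, q, w].Nodup →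
      (∀ z, z ∈ W ↔ z = x ∨ z = t' ∨ z = t'' ∨ z = p ∨ z = q ∨ z = w) →
      ((con G x y).Adj x p ∧ (con G x y).Adj x q ∧ (con G x y).Adj x w) →
      ((con G x y).Adj t' p ∧ (con G x y).Adj t' q ∧ (con G x y).Adj t' w) →
      ((con G x y).Adj t'' p ∧ (con G x y).Adj t'' q ∧ (con G x y).Adj t'' w) →
      ((con G x y).Adj t' t'' ∨ (con G x y).Adj x t' ∨ (con G x y).Adj x t'') →
      O34 G (insert y W) := by
    intro t' t'' ht' ht'' hxp hd' hW' hA hA' hA'' hE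
    simp only [List.nodup_cons, List.mem_cons, List.not_mem_nil, not_or] at hd'
    have m1 := hne' t' ht'.2
    have m2 := hne' t'' ht''.2
    rw [hl p (by grind) (by grind), hl q (by grind) (by grind), hl w (by grind) (by grind)] at hA
    rw [hc t' p (by grind) (by grind) (by grind) (by grind),
      hc t' q (by grind) (by grind) (by grind) (by grind),
      hc t' w (by grind) (by grind) (by grind) (by grind)] at hA'
    rw [hc t'' p (by grind) (by grind) (by grind) (by grind),
      hc t'' q (by grind) (by grind) (by grind) (by grind),
      hc t'' w (by grind) (by grind) (by grind) (by grind)] at hA''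
    rw [hc t' t'' (by grind) (by grind) (by grind) (by grind), hl t' (by grind) (by grind),
      hl t'' (by grind) (by grind)] at hE
    rw [hc p q (by grind) (by grind) (by grind) (by grind),
      hc p w (by grind) (by grind) (by grind) (by grind),
      hc q w (by grind) (by grind) (by grind) (by grind)] at hn
    refine uncontract_O33_side hB (x := x) (y := y) (t := t') (t' := t'') (p := p) (q := q)
      (w := w) ?_ ?_ hn hA' hA'' hxy hA.1 hA.2.1 hA.2.2 hE
    · simp only [List.nodup_cons, List.mem_cons, List.not_mem_nil, not_or]
      grind
    · intro z
      rw [Set.mem_insert_iff, hW' z]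
      grind
  have hnd : ∀ a b c : V, a = s ∧ b = t ∧ c = u ∨ a = t ∧ b = s ∧ c = u ∨
      a = u ∧ b = s ∧ c = t → [a, b, c, p, q, w].Nodup := by
    intro a b c h
    simp only [List.nodup_cons, List.mem_cons, List.not_mem_nil, not_or]
    rcases h with ⟨rfl, rfl, rfl⟩ | ⟨rfl, rfl, rfl⟩ | ⟨rfl, rfl, rfl⟩ <;> grind
  rcases (hW x).1 hx with rfl | rfl | rfl | rfl | rfl | rfl
  · exact side t u (by grind) (by grind) (by grind) (hnd _ _ _ (by simp)) (by grind) (by grind)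
      (by grind) (by grind) (by grind)
  · exact side s u (by grind) (by grind) (by grind) (hnd _ _ _ (by simp)) (by grind) (by grind)
      (by grind) (by grind) (by grind)
  · exact side s t (by grind) (by grind) (by grind) (hnd _ _ _ (by simp)) (by grind) (by grind)
      (by grind) (by grind) (by grind)
  · exact (key q w (by grind) (by grind) (by grind) (by grind) (by grind) (by grind)).elim
  · exact (key p w (by grind) (by grind) (by grind) (by grind) (by grind) (by grind)).elim
  · exact (key p q (by grind) (by grind) (by grind) (by grind) (by grind) (by grind)).elim

lemma O34.not_uncontract {W : Set V} {x y : V} (h : O34 (con G x y) W) (hx : x ∈ W)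
    (hy : y ∉ W) (hxy : G.Adj x y) (hB : Base G (insert y W)) : False := by
  obtain ⟨s, t, u, p, q, w, v, hd, hW, hn, he, h1, h2, h3⟩ := h
  have hs : ∀ x y, G.Adj x y → G.Adj y x := fun _ _ h => h.symm
  have hc : ∀ a b, a ≠ x → a ≠ y → b ≠ x → b ≠ y → ((con G x y).Adj a b ↔ G.Adj a b) :=
    fun a b h1 h2 h3 h4 => con_adj_iff h1 h2 h3 h4
  have hl : ∀ b, b ≠ x → b ≠ y → ((con G x y).Adj x b ↔ G.Adj x b ∨ G.Adj y b) :=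
    fun b h1 h2 => con_adj_left hxy.ne h1 h2
  have hym : y ∈ insert y W := Or.inl rfl
  have hm : ∀ z, z ∈ W → z ∈ insert y W := fun z hz => Or.inr hz
  have hne' : ∀ z ∈ W, z ≠ y := fun z hz e => hy (e ▸ hz)
  have hmW : s ∈ W ∧ t ∈ W ∧ u ∈ W ∧ p ∈ W ∧ q ∈ W ∧ w ∈ W ∧ v ∈ W := by simp [hW]
  have hney : s ≠ y ∧ t ≠ y ∧ u ≠ y ∧ p ≠ y ∧ q ≠ y ∧ w ≠ y ∧ v ≠ y := by grind
  simp only [List.nodup_cons, List.mem_cons, List.not_mem_nil, not_or] at hd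
  have key : ∀ q w v : V, q ∈ W ∧ q ≠ x → w ∈ W ∧ w ≠ x → v ∈ W ∧ v ≠ x →
      q ≠ w ∧ q ≠ v ∧ w ≠ v → x ≠ s ∧ x ≠ t ∧ x ≠ u →
      (con G x y).Adj s q ∧ (con G x y).Adj t q ∧ (con G x y).Adj u q →
      (con G x y).Adj s w ∧ (con G x y).Adj t w ∧ (con G x y).Adj u w →
      (con G x y).Adj s v ∧ (con G x y).Adj t v ∧ (con G x y).Adj u v → False := by
    intro q w v hq hw hv hqw hxs hAq hAw hAv
    have a1 := (hc s q (by grind) (by grind) (by grind) (by grind)).1 hAq.1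
    have a2 := (hc t q (by grind) (by grind) (by grind) (by grind)).1 hAq.2.1
    have a3 := (hc u q (by grind) (by grind) (by grind) (by grind)).1 hAq.2.2
    have a4 := (hc s w (by grind) (by grind) (by grind) (by grind)).1 hAw.1
    have a5 := (hc t w (by grind) (by grind) (by grind) (by grind)).1 hAw.2.1
    have a6 := (hc u w (by grind) (by grind) (by grind) (by grind)).1 hAw.2.2
    have a7 := (hc s v (by grind) (by grind) (by grind) (by grind)).1 hAv.1
    have a8 := (hc t v (by grind) (by grind) (by grind) (by grind)).1 hAv.2.1
    have a9 := (hc u v (by grind) (by grind) (by grind) (by grind)).1 hAv.2.2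
    have e1 := a1.ne
    have e2 := a2.ne
    have e3 := a3.ne
    have e4 := a4.ne
    have e5 := a5.ne
    have e6 := a6.ne
    have e7 := a7.ne
    have e8 := a8.ne
    have e9 := a9.ne
    clear hc hl hn h1 h2 h3 hAq hAw hAv
    exact hB.pairs (a := s) (b := q) (c := t) (c' := w) (d := u) (d' := v) (e := x) (e' := y)
      (by grind) (by grind) (by grind) (by grind) (by grind) (by grind) (by grind) (by grind)
      (by grind) (by grind) (by grind) (by grind) ⟨hxy.ne, by grind⟩
  have side : ∀ t' t'' : V, t' ≠ x ∧ t' ∈ W → t'' ≠ x ∧ t'' ∈ W →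
      x ≠ p ∧ x ≠ q ∧ x ≠ w →
      [x, t', t'', p, q, w, v].Nodup →
      (∀ z, z ∈ W ↔ z = x ∨ z = t' ∨ z = t'' ∨ z = p ∨ z = q ∨ z = w ∨ z = v) →
      ((con G x y).Adj x p ∧ (con G x y).Adj x q ∧ (con G x y).Adj x w) →
      ((con G x y).Adj t' p ∧ (con G x y).Adj t' q ∧ (con G x y).Adj t' w) →
      ((con G x y).Adj t'' p ∧ (con G x y).Adj t'' q ∧ (con G x y).Adj t'' w) → False := by
    intro t' t'' ht' ht'' hxp hd' hW' hA hA' hA''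
    simp only [List.nodup_cons, List.mem_cons, List.not_mem_nil, not_or] at hd'
    have m1 := hne' t' ht'.2
    have m2 := hne' t'' ht''.2
    rw [hl p (by grind) (by grind), hl q (by grind) (by grind), hl w (by grind) (by grind)] at hA
    rw [hc t' p (by grind) (by grind) (by grind) (by grind),
      hc t' q (by grind) (by grind) (by grind) (by grind),
      hc t' w (by grind) (by grind) (by grind) (by grind)] at hA'
    rw [hc t'' p (by grind) (by grind) (by grind) (by grind),
      hc t'' q (by grind) (by grind) (by grind) (by grind),
      hc t'' w (by grind) (by grind) (by grind) (by grind)] at hA''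
    refine not_uncontract_O34_side hB (x := x) (y := y) (t := t') (t' := t'') (p := p) (q := q)
      (w := w) (u := v) ?_ ?_ hA' hA'' hA.1 hA.2.1 hA.2.2
    · simp only [List.nodup_cons, List.mem_cons, List.not_mem_nil, not_or]
      grind
    · intro z
      rw [Set.mem_insert_iff, hW' z]
      grind
  have hnd : ∀ a b c : V, a = s ∧ b = t ∧ c = u ∨ a = t ∧ b = s ∧ c = u ∨
      a = u ∧ b = s ∧ c = t → [a, b, c, p, q, w, v].Nodup := by
    intro a b c h
    simp only [List.nodup_cons, List.mem_cons, List.not_mem_nil, not_or]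
    rcases h with ⟨rfl, rfl, rfl⟩ | ⟨rfl, rfl, rfl⟩ | ⟨rfl, rfl, rfl⟩ <;> grind
  rcases (hW x).1 hx with rfl | rfl | rfl | rfl | rfl | rfl | rfl
  · exact side t u (by grind) (by grind) (by grind) (hnd _ _ _ (by simp)) (by grind) (by grind)
      (by grind) (by grind)
  · exact side s u (by grind) (by grind) (by grind) (hnd _ _ _ (by simp)) (by grind) (by grind)
      (by grind) (by grind)
  · exact side s t (by grind) (by grind) (by grind) (hnd _ _ _ (by simp)) (by grind) (by grind)
      (by grind) (by grind)
  · exact key q w v (by grind) (by grind) (by grind) (by grind) (by grind) (by grind) (by grind)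
      (by grind)
  · exact key p w v (by grind) (by grind) (by grind) (by grind) (by grind) (by grind) (by grind)
      (by grind)
  · exact key p q v (by grind) (by grind) (by grind) (by grind) (by grind) (by grind) (by grind)
      (by grind)
  · exact key p q w (by grind) (by grind) (by grind) (by grind) (by grind) (by grind) (by grind)
      (by grind)

end BaseInduction

section NonCritical

variable {V : Type} {G : SimpleGraph V}

/-- `S` consists of four pairwise adjacent vertices. -/
def O4 (G : SimpleGraph V) (S : Set V) : Prop :=
  ∃ a b c d, (∀ z, z ∈ S ↔ z = a ∨ z = b ∨ z = c ∨ z = d) ∧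
    (G.Adj a b ∧ G.Adj a c ∧ G.Adj a d ∧ G.Adj b c ∧ G.Adj b d ∧ G.Adj c d)

lemma O4.uncontract [Finite V] {S : Set V} {x y v : V} (h : O4 (con G x y) (S \ {y}))
    (hx : x ∈ S) (hy : y ∈ S) (hxy : G.Adj x y) (hH : Hy (con G x y) (S \ {y}) v)
    (hB : Base G (insert v S)) (hvS : v ∉ S) :
    O222 G (insert v S) ∨ O33 G (insert v S) := by
  obtain ⟨p, q, r, s, hS, hA⟩ := h
  have hsc : ∀ a b, (con G x y).Adj a b → (con G x y).Adj b a := fun _ _ h => h.symm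
  have key : ∀ a b c : V, (∀ z, z ∈ S \ {y} ↔ z = x ∨ z = a ∨ z = b ∨ z = c) →
      ((con G x y).Adj x a ∧ (con G x y).Adj x b ∧ (con G x y).Adj x c ∧
      (con G x y).Adj a b ∧ (con G x y).Adj a c ∧ (con G x y).Adj b c) →
      O222 G (insert v S) ∨ O33 G (insert v S) := by
    clear hS hA hsc
    intro a b c hS hA
    have hs : ∀ x y, G.Adj x y → G.Adj y x := fun _ _ h => h.symm
    have hmS : ∀ z ∈ S \ {y}, z ∈ S ∧ z ≠ y ∧ z ≠ v := fun z hz =>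
      ⟨hz.1, hz.2, fun e => hvS (e ▸ hz.1)⟩
    have ma := hmS a ((hS a).2 (by simp))
    have mb := hmS b ((hS b).2 (by simp))
    have mc := hmS c ((hS c).2 (by simp))
    have hvx : v ≠ x := fun e => hvS (e ▸ hx)
    have hvy : v ≠ y := fun e => hvS (e ▸ hy)
    have hxy' := hxy.ne
    have nxa := hA.1.ne
    have nxb := hA.2.1.ne
    have nxc := hA.2.2.1.ne
    have nab := hA.2.2.2.1.ne
    have nac := hA.2.2.2.2.1.ne
    have nbc := hA.2.2.2.2.2.ne
    have hW : ∀ z, z ∈ insert v S ↔ z = x ∨ z = y ∨ z = a ∨ z = b ∨ z = c ∨ z = v := by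
      intro z
      have := hS z
      simp only [Set.mem_sdiff, Set.mem_singleton_iff] at this
      rw [Set.mem_insert_iff]
      grind
    have h3 := hH.three
    obtain ⟨p, hp, q, hq, r, hr, hpq, hpr, hqr, hvp, hvq, hvr⟩ := h3
    rw [hS] at hp hq hr
    have hvx' := con_adj_left (G := G) hxy' hvx hvy
    have hva' := con_adj_iff (G := G) hvx hvy nxa.symm ma.2.1
    have hvb' := con_adj_iff (G := G) hvx hvy nxb.symm mb.2.1
    have hvc' := con_adj_iff (G := G) hvx hvy nxc.symm mc.2.1
    rw [con_adj_left hxy' nxa.symm ma.2.1, con_adj_left hxy' nxb.symm mb.2.1,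
      con_adj_left hxy' nxc.symm mc.2.1, con_adj_iff nxa.symm ma.2.1 nxb.symm mb.2.1,
      con_adj_iff nxa.symm ma.2.1 nxc.symm mc.2.1, con_adj_iff nxb.symm mb.2.1 nxc.symm mc.2.1]
      at hA
    have hall : ¬ (G.Adj v a ∧ G.Adj v b ∧ G.Adj v c) := fun h =>
      hB.pairs (a := a) (b := b) (c := c) (c' := c) (d := v) (d' := v) (e := x) (e' := y)
      (by simp [hW]) (by grind) (by grind) (by grind) (by grind) (by grind) (by grind) (by grind)
      (by grind) (by grind) (by grind) (by grind) (by grind)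
    have hall' : ¬ ((con G x y).Adj v a ∧ (con G x y).Adj v b ∧ (con G x y).Adj v c) := by
      rwa [hva', hvb', hvc']
    have hcase : ((con G x y).Adj v x ∧ (con G x y).Adj v a ∧ (con G x y).Adj v b) ∨
        ((con G x y).Adj v x ∧ (con G x y).Adj v a ∧ (con G x y).Adj v c) ∨
        ((con G x y).Adj v x ∧ (con G x y).Adj v b ∧ (con G x y).Adj v c) := by
      rcases hp with rfl | rfl | rfl | rfl <;> rcases hq with rfl | rfl | rfl | rfl <;>
        rcases hr with rfl | rfl | rfl | rfl <;> first
          | contradiction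
          | exact (hall' ⟨by assumption, by assumption, by assumption⟩).elim
          | simp [*]
    have hcomm : (con G x y).Adj v x ↔ (con G x y).Adj x v := ⟨fun h => h.symm, fun h => h.symm⟩
    rw [hcomm, hvx', hva', hvb', hvc'] at hcase
    clear hcomm hvx' hva' hvb' hvc' hvp hvq hvr hp hq hr hS hmS hall'
    rcases hcase with ⟨h1, h2, h3⟩ | ⟨h1, h2, h3⟩ | ⟨h1, h2, h3⟩
    · refine uncontract_K4 hB (x := x) (y := y) (a := a) (b := b) (c := c) (v := v) ?_ hW ?_ hxy
        ?_ ?_ ?_ h1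
      · simp only [List.nodup_cons, List.mem_cons, List.not_mem_nil, not_or]
        grind
      all_goals grind
    · refine uncontract_K4 hB (x := x) (y := y) (a := a) (b := c) (c := b) (v := v) ?_ ?_ ?_ hxy
        ?_ ?_ ?_ h1
      · simp only [List.nodup_cons, List.mem_cons, List.not_mem_nil, not_or]
        grind
      all_goals grind
    · refine uncontract_K4 hB (x := x) (y := y) (a := b) (b := c) (c := a) (v := v) ?_ ?_ ?_ hxy
        ?_ ?_ ?_ h1
      · simp only [List.nodup_cons, List.mem_cons, List.not_mem_nil, not_or]
        grind
      all_goals grind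
  clear hH hB
  rcases (hS x).1 ⟨hx, hxy.ne⟩ with rfl | rfl | rfl | rfl
  · exact key q r s (by grind) (by grind)
  · exact key p r s (by grind) (by grind)
  · exact key p q s (by grind) (by grind)
  · exact key p q r (by grind) (by grind)

lemma Hy.outcome [Finite V] {S : Set V} {v : V} (h : Hy G S v) :
    O4 G S ∨ O222 G (insert v S) ∨ O33 G (insert v S) ∨ O34 G (insert v S) := by
  induction hn : S.ncard using Nat.strong_induction_on generalizing G S with
  | _ n ih =>
    rcases h.step with ⟨x, hx, y, hy, hxy, hH⟩ | ⟨a, b, c, d, rfl, hA⟩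
    · have hvy : v ≠ y := fun e => h.notMem (e ▸ hy)
      have hxW : x ∈ insert v (S \ {y}) := Or.inr ⟨hx, hxy.ne⟩
      have hyW : y ∉ insert v (S \ {y}) := by
        rintro (e | e)
        exacts [hvy e.symm, e.2 rfl]
      have hins : insert y (insert v (S \ {y})) = insert v S := by
        rw [Set.insert_comm, Set.insert_sdiff_singleton, Set.insert_eq_of_mem hy]
      have hB : Base G (insert y (insert v (S \ {y}))) := by
        rw [hins]
        exact h.base
      have hlt : (S \ {y}).ncard < n := hn ▸ Set.ncard_sdiff_singleton_lt_of_mem hy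
      rcases ih _ hlt hH rfl with h4 | h2 | h3 | h34
      · rcases h4.uncontract hx hy hxy hH h.base h.notMem with h | h
        · exact Or.inr (Or.inl h)
        · exact Or.inr (Or.inr (Or.inl h))
      · exact (h2.not_uncontract hxW hyW hxy hB).elim
      · have := h3.uncontract hxW hyW hxy hB
        rw [hins] at this
        exact Or.inr (Or.inr (Or.inr this))
      · exact (h34.not_uncontract hxW hyW hxy hB).elim
    · exact Or.inl ⟨a, b, c, d, by simp, hA⟩

lemma O4.good {S : Set V} {v : V} (h : O4 G S) (hv : v ∉ S) (h3 : Three G S v)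
    (hN : NoHat G (insert v S)) : Good G (insert v S) := by
  obtain ⟨a, b, c, d, hS, hA⟩ := h
  have hs : ∀ x y, G.Adj x y → G.Adj y x := fun _ _ h => h.symm
  have hCM : CM G S := by
    intro x hx y hy z hz
    rw [hS] at hx hy hz
    rcases hx with rfl | rfl | rfl | rfl <;> rcases hy with rfl | rfl | rfl | rfl <;>
      rcases hz with rfl | rfl | rfl | rfl <;> simp [hA, hA.1.symm, hA.2.1.symm, hA.2.2.1.symm,
        hA.2.2.2.1.symm, hA.2.2.2.2.1.symm, hA.2.2.2.2.2.symm]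
  have hT : ∀ x ∈ S, Three G S x := by
    have ha := (hS a).2 (by simp)
    have hb := (hS b).2 (by simp)
    have hc := (hS c).2 (by simp)
    have hd := (hS d).2 (by simp)
    have e1 := hA.1.ne
    have e2 := hA.2.1.ne
    have e3 := hA.2.2.1.ne
    have e4 := hA.2.2.2.1.ne
    have e5 := hA.2.2.2.2.1.ne
    have e6 := hA.2.2.2.2.2.ne
    intro x hx
    rcases (hS x).1 hx with rfl | rfl | rfl | rfl
    · exact ⟨b, hb, c, hc, d, hd, by grind⟩
    · exact ⟨a, ha, c, hc, d, hd, by grind⟩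
    · exact ⟨a, ha, b, hb, d, hd, by grind⟩
    · exact ⟨a, ha, b, hb, c, hc, by grind⟩
  have hg : Good G S := Or.inl ⟨hCM, hT⟩
  exact hg.insert_vertex hv h3 hN

lemma O222.good {W : Set V} (h : O222 G W) : Good G W := by
  obtain ⟨a, a', b, b', c, c', hd, hW, hn, h1, h2, h3⟩ := h
  have hs : ∀ x y, G.Adj x y → G.Adj y x := fun _ _ h => h.symm
  have hi : ∀ x, ¬ G.Adj x x := fun _ => G.irrefl
  simp only [List.nodup_cons, List.mem_cons, List.not_mem_nil, not_or] at hd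
  refine Or.inl ⟨?_, ?_⟩
  · intro x hx y hy z hz hxy hyz hxz
    rw [hW] at hx hy hz
    rcases hx with rfl | rfl | rfl | rfl | rfl | rfl <;>
      rcases hy with rfl | rfl | rfl | rfl | rfl | rfl <;> grind
  · intro x hx
    have ma := (hW a).2 (by simp)
    have ma' := (hW a').2 (by simp)
    have mb := (hW b).2 (by simp)
    have mb' := (hW b').2 (by simp)
    have mc := (hW c).2 (by simp)
    have mc' := (hW c').2 (by simp)
    rcases (hW x).1 hx with rfl | rfl | rfl | rfl | rfl | rfl
    · exact ⟨b, mb, b', mb', c, mc, by grind⟩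
    · exact ⟨b, mb, b', mb', c, mc, by grind⟩
    · exact ⟨a, ma, a', ma', c, mc, by grind⟩
    · exact ⟨a, ma, a', ma', c, mc, by grind⟩
    · exact ⟨a, ma, a', ma', b, mb, by grind⟩
    · exact ⟨a, ma, a', ma', b, mb, by grind⟩

lemma O34.good {W : Set V} (h : O34 G W) : Good G W := by
  obtain ⟨s, t, u, p, q, w, y, hd, hW, hn, he, h1, h2, h3⟩ := h
  have hs : ∀ x y, G.Adj x y → G.Adj y x := fun _ _ h => h.symm
  have hi : ∀ x, ¬ G.Adj x x := fun _ => G.irrefl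
  simp only [List.nodup_cons, List.mem_cons, List.not_mem_nil, not_or] at hd
  refine Or.inl ⟨?_, ?_⟩
  · intro x hx y hy z hz hxy hyz hxz
    rw [hW] at hx hy hz
    rcases hx with rfl | rfl | rfl | rfl | rfl | rfl | rfl <;>
      rcases hy with rfl | rfl | rfl | rfl | rfl | rfl | rfl <;> grind
  · intro x hx
    have ms := (hW s).2 (by simp)
    have mt := (hW t).2 (by simp)
    have mu := (hW u).2 (by simp)
    have mp := (hW p).2 (by simp)
    have mq := (hW q).2 (by simp)
    have mw := (hW w).2 (by simp)
    rcases (hW x).1 hx with rfl | rfl | rfl | rfl | rfl | rfl | rfl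
    · exact ⟨p, mp, q, mq, w, mw, by grind⟩
    · exact ⟨p, mp, q, mq, w, mw, by grind⟩
    · exact ⟨p, mp, q, mq, w, mw, by grind⟩
    · exact ⟨s, ms, t, mt, u, mu, by grind⟩
    · exact ⟨s, ms, t, mt, u, mu, by grind⟩
    · exact ⟨s, ms, t, mt, u, mu, by grind⟩
    · exact ⟨s, ms, t, mt, u, mu, by grind⟩

lemma O33.good {W : Set V} (h : O33 G W) : Good G W := by
  obtain ⟨s, t, u, p, q, w, hd, hW, hn, he, h1, h2, h3⟩ := h
  have hs : ∀ x y, G.Adj x y → G.Adj y x := fun _ _ h => h.symm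
  have hi : ∀ x, ¬ G.Adj x x := fun _ => G.irrefl
  simp only [List.nodup_cons, List.mem_cons, List.not_mem_nil, not_or] at hd
  have ms := (hW s).2 (by simp)
  have mt := (hW t).2 (by simp)
  have mu := (hW u).2 (by simp)
  have mp := (hW p).2 (by simp)
  have mq := (hW q).2 (by simp)
  have mw := (hW w).2 (by simp)
  by_cases hsu : G.Adj s u
  · refine Or.inl ⟨?_, ?_⟩
    · intro x hx y hy z hz hxy hyz hxz
      rw [hW] at hx hy hz
      rcases hx with rfl | rfl | rfl | rfl | rfl | rfl <;>
        rcases hy with rfl | rfl | rfl | rfl | rfl | rfl <;> grind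
    · intro x hx
      rcases (hW x).1 hx with rfl | rfl | rfl | rfl | rfl | rfl
      · exact ⟨p, mp, q, mq, w, mw, by grind⟩
      · exact ⟨p, mp, q, mq, w, mw, by grind⟩
      · exact ⟨p, mp, q, mq, w, mw, by grind⟩
      · exact ⟨s, ms, t, mt, u, mu, by grind⟩
      · exact ⟨s, ms, t, mt, u, mu, by grind⟩
      · exact ⟨s, ms, t, mt, u, mu, by grind⟩
  · refine Or.inr ⟨s, t, u, ms, mt, mu, he.1, by grind, by grind, by grind, by grind, ?_, ?_,
      p, mp, q, mq, w, mw, by grind⟩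
    · intro z hz z1 z2 z3
      rcases (hW z).1 hz with rfl | rfl | rfl | rfl | rfl | rfl <;> grind
    · intro z hz z1 z2 z3 z' hz' z1' z2' z3'
      rcases (hW z).1 hz with rfl | rfl | rfl | rfl | rfl | rfl <;>
        rcases (hW z').1 hz' with rfl | rfl | rfl | rfl | rfl | rfl <;> grind

lemma Hy.good [Finite V] {S : Set V} {v : V} (h : Hy G S v) : Good G (insert v S) := by
  rcases h.outcome with h4 | h2 | h3 | h34
  exacts [h4.good h.notMem h.three h.base.hat, h2.good, h3.good, h34.good]

/-- A graph without cut vertices that contains `K₄` properly is either complete multipartite or of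
the form described by `EG`. -/
theorem good_of_not_crit [Finite V] {U : Set V} (hU : NoCut G U) (hN : NoHat G U)
    (h4 : HasK4 G U) (hc : ¬ Crit G U) : Good G U := by
  obtain ⟨S, ⟨hSU, hS4⟩, hmin⟩ := Set.exists_min_image
    {S | S ⊆ U ∧ HasK4 G S} Set.ncard (Set.toFinite _) ⟨U, subset_rfl, h4⟩
  have hcrit : Crit G S := ⟨hS4, fun u hu h => (hmin _ ⟨Set.sdiff_subset.trans hSU, h⟩).not_gt
    (Set.ncard_sdiff_singleton_lt_of_mem hu)⟩
  obtain ⟨v, hvU, hvS, hv3⟩ := exists_three hcrit.noCut hU hSU (fun e => hc (e ▸ hcrit)) hS4 hN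
  have hvSU : insert v S ⊆ U := Set.insert_subset hvU hSU
  have hHy : Hy G S v := by
    refine ⟨⟨hN.mono hvSU, fun x hx y hy hxy h => ?_⟩, hS4, hvS, ?_⟩
    · refine (hmin _ ⟨Set.sdiff_subset.trans hvSU, h⟩).not_gt ?_
      have h1 : ({x, y} : Set V) ⊆ insert v S := by
        rintro z (rfl | rfl)
        exacts [hx, hy]
      have h2 := Set.ncard_sdiff_add_ncard_of_subset h1
      rw [Set.ncard_pair hxy, Set.ncard_insert_of_notMem hvS] at h2
      lia
    · obtain ⟨a, ha, b, hb, -, -, hab, -, -, hva, hvb, -⟩ := hv3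
      exact ⟨a, ha, b, hb, hab, hva, hvb⟩
  have hcut : ∀ W v, NoCut G W → v ∉ W → Three G W v → NoCut G (insert v W) := by
    rintro W v hW hv ⟨a, ha, b, hb, -, -, hab, -, -, hva, hvb, -⟩
    exact noCut_insert hW hv ha hb hab hva hvb
  obtain ⟨W, -, hW⟩ := ((Set.toFinite {W | W ⊆ U ∧ S ⊆ W ∧ NoCut G W ∧ Good G W})).exists_le_maximal
    (a := insert v S) ⟨hvSU, Set.subset_insert _ _, hcut S v hcrit.noCut hvS hv3, hHy.good⟩
  obtain ⟨⟨hWU, hSW, hWc, hWg⟩, hmax⟩ := hW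
  by_cases hne : W = U
  · exact hne ▸ hWg
  obtain ⟨u, huU, huW, hu3⟩ := exists_three hWc hU hWU hne (hS4.mono hSW) hN
  have hins : insert u W ⊆ U := Set.insert_subset huU hWU
  exact (huW (hmax ⟨hins, hSW.trans (Set.subset_insert _ _), hcut W u hWc huW hu3,
    hWg.insert_vertex huW hu3 (hN.mono hins)⟩ (Set.subset_insert _ _) (Or.inl rfl))).elim

end NonCritical

section GoodPwo

universe u

variable {Q : Type u} {r : Q → Q → Prop} {V : Type}

/-- Label increasing induced subgraph embeddings are induced minor models. -/
lemma ple_of_embedding {P P' : Piece Q 0} (φ : P.K → P'.V) (hφ : ∀ a, φ a ∈ P'.K)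
    (hinj : Function.Injective φ)
    (hadj : ∀ a c, a ≠ c → (P'.G.Adj (φ a) (φ c) ↔ P.G.Adj a c))
    (hlab : ∀ a : P.K, r (P.lab a) (P'.lab (φ a))) : PLE r false P P' := by
  have hK : P.K ∪ Set.range P.τ = P.K := by
    rw [Set.range_eq_empty, Set.union_empty]
  have hμ : ∀ a (ha : a ∈ P.K), {z | ∃ h : a ∈ P.K, z = φ ⟨a, h⟩} = {φ ⟨a, ha⟩} := by
    intro a ha
    ext z
    exact ⟨fun ⟨_, hz⟩ => hz, fun hz => ⟨ha, hz⟩⟩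
  refine ⟨fun a => {z | ∃ h : a ∈ P.K, z = φ ⟨a, h⟩}, ?_⟩
  constructor
  · rintro a - z ⟨h, rfl⟩
    exact hφ _
  · exact fun i => i.elim0
  · exact fun i => i.elim0
  · rw [hK]
    intro a ha
    rw [hμ a ha]
    exact cn_singleton _
  · rw [hK]
    intro a ha c hc hne
    rw [hμ a ha, hμ c hc]
    simpa using fun e => hne (congrArg Subtype.val (hinj e))
  · rw [hK]
    intro a ha c hc hne
    rw [hμ a ha, hμ c hc, ← hadj ⟨a, ha⟩ ⟨c, hc⟩ fun e => hne (congrArg Subtype.val e)]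
    simp [Tch]
  · exact fun _ i => i.elim0
  · exact fun a ha => ⟨_, ⟨ha, rfl⟩, hlab ⟨a, ha⟩⟩

/-- The vertices of `P` not adjacent to `x`. -/
def Piece.cls (P : Piece Q 0) (x : P.V) : Set P.V := {z ∈ P.K | ¬ P.G.Adj x z}

/-- The family of the families of labels of the classes of `P`. -/
def Piece.classes (P : Piece Q 0) : Fam (Fam Q) where
  I := {A : Set P.V // ∃ x ∈ P.K, A = P.cls x}
  fin := by
    have := P.fin
    infer_instance
  g A := ⟨A.1, by
    have := P.fin
    infer_instance, fun z => P.lab z⟩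

lemma Piece.cls_eq_iff {P : Piece Q 0} (h : CM P.G P.K) {x z : P.V} (hx : x ∈ P.K) (hz : z ∈ P.K) :
    P.cls x = P.cls z ↔ ¬ P.G.Adj x z := by
  constructor
  · intro e
    have : z ∈ P.cls x := e ▸ ⟨hz, P.G.irrefl⟩
    exact this.2
  · intro hn
    ext w
    exact ⟨fun hw => ⟨hw.1, h z hz x hx w hw.1 (fun h => hn h.symm) hw.2⟩,
      fun hw => ⟨hw.1, h x hx z hz w hw.1 hn hw.2⟩⟩

lemma ple_of_classes {P P' : Piece Q 0} (h : CM P.G P.K) (h' : CM P'.G P'.K)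
    (hle : FLE (FLE r) P.classes P'.classes) : PLE r false P P' := by
  obtain ⟨φ, hφ, hψ⟩ := hle
  choose ψ hψi hψr using hψ
  have hself : ∀ x : P.K, x.1 ∈ P.cls x := fun x => ⟨x.2, P.G.irrefl⟩
  let e : P.K → P'.V := fun x => (ψ ⟨P.cls x, x, x.2, rfl⟩ ⟨x, hself x⟩).1
  have hcls : ∀ x : P.K, e x ∈ P'.K ∧ P'.cls (e x) = (φ ⟨P.cls x, x, x.2, rfl⟩).1 := by
    intro x
    obtain ⟨w, hw, hA⟩ := (φ ⟨P.cls x, x, x.2, rfl⟩).2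
    have hm : e x ∈ (φ ⟨P.cls x, x, x.2, rfl⟩).1 := Subtype.prop _
    rw [hA] at hm ⊢
    exact ⟨hm.1, (Piece.cls_eq_iff h' hm.1 hw).2 fun h => hm.2 h.symm⟩
  refine ple_of_embedding e (fun a => (hcls a).1) ?_ ?_ ?_
  · intro a c hac
    have h1 := hφ (Subtype.ext ((hcls a).2.symm.trans (hac ▸ (hcls c).2)))
    have h2 : P.cls a = P.cls c := congrArg Subtype.val h1
    have h3 : a.1 ∈ P.cls c := h2 ▸ hself a
    have h4 : ∀ (A : Set P.V) (hA : ∃ x ∈ P.K, A = P.cls x) (haA : a.1 ∈ A), A = P.cls c →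
        (ψ ⟨A, hA⟩ ⟨a, haA⟩).1 = (ψ ⟨P.cls c, c, c.2, rfl⟩ ⟨a, h3⟩).1 := by
      rintro A hA haA rfl
      rfl
    have h5 : (ψ ⟨P.cls c, c, c.2, rfl⟩ ⟨a, h3⟩).1 = (ψ ⟨P.cls c, c, c.2, rfl⟩ ⟨c, hself c⟩).1 :=
      (h4 _ _ _ h2).symm.trans hac
    have h6 := hψi _ (Subtype.ext h5)
    exact Subtype.ext (Subtype.mk.inj h6)
  · intro a c _
    rw [← not_iff_not, ← Piece.cls_eq_iff h' (hcls a).1 (hcls c).1,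
      ← Piece.cls_eq_iff h a.2 c.2, (hcls a).2, (hcls c).2]
    have h4 : ∀ (A : Set P.V) (hA : ∃ x ∈ P.K, A = P.cls x), A = P.cls c →
        (φ ⟨A, hA⟩).1 = (φ ⟨P.cls c, c, c.2, rfl⟩).1 := by
      rintro A hA rfl
      rfl
    exact ⟨fun e => congrArg Subtype.val (hφ (Subtype.ext e)), h4 _ _⟩
  · exact fun a => hψr ⟨P.cls a, a, a.2, rfl⟩ ⟨a, hself a⟩

lemma cm_pwo : LabelledPwo fun _ G K => CM G K := by
  intro Q r _ S hS
  exact pwo_of_map (r := PLE r false) Piece.classes (fam_pwo (fam_pwo hS))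
    (fun P hP A z => by
      obtain ⟨x, hx, hA⟩ := A.2
      have : z.1 ∈ P.cls x := hA ▸ z.2
      exact hP.2 _ this.1) fun P hP P' hP' => ple_of_classes hP.1 hP'.1

/-- Adjacency between distinct vertices of `W` is determined by a colouring with `4` colours. -/
def Coloured (G : SimpleGraph V) (M : Fin 4 → Fin 4 → Prop) (W : Set V) (col : V → Fin 4) : Prop :=
  ∀ p ∈ W, ∀ q ∈ W, p ≠ q → (G.Adj p q ↔ M (col p) (col q))

lemma coloured_pwo (M : Fin 4 → Fin 4 → Prop) :
    LabelledPwo fun _ G K => ∃ col, Coloured G M K col := by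
  classical
  intro Q r _ S hS
  let col : (P : Piece Q 0) → P.V → Fin 4 := fun P =>
    if h : ∃ col, Coloured P.G M P.K col then h.choose else fun _ => 0
  have hcol : ∀ P : Piece Q 0, (∃ col, Coloured P.G M P.K col) → Coloured P.G M P.K (col P) := by
    intro P h
    simp only [col, dif_pos h]
    exact h.choose_spec
  let R : Q × Fin 4 → Q × Fin 4 → Prop := fun x y => r x.1 y.1 ∧ x.2 = y.2
  have : IsPreorder (Q × Fin 4) R :=
    { refl := fun x => ⟨refl_of r _, rfl⟩
      trans := fun x y z h h' => ⟨trans_of r h.1 h'.1, h.2.trans h'.2⟩ }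
  have hT : (S ×ˢ (Set.univ : Set (Fin 4))).PartiallyWellOrderedOn R :=
    hS.prod (r' := Eq) Set.finite_univ.partiallyWellOrderedOn
  refine pwo_of_map (r := PLE r false) (fun P : Piece Q 0 => (⟨P.K, by
    have := P.fin
    infer_instance, fun x => (P.lab x, col P x)⟩ : Fam (Q × Fin 4))) (fam_pwo hT)
    (fun P hP x => ⟨hP.2 _ x.2, trivial⟩) ?_
  rintro P hP P' hP' ⟨φ, hφ, hle⟩
  refine ple_of_embedding (fun a => (φ a).1) (fun a => (φ a).2)
    (fun a c h => hφ (Subtype.ext h)) (fun a c hac => ?_) fun a => (hle a).1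
  have h1 : col P a = col P' (φ a).1 := (hle a).2
  have h2 : col P c = col P' (φ c).1 := (hle c).2
  rw [hcol P hP.1 a a.2 c c.2 fun h => hac (Subtype.ext h), h1, h2]
  exact hcol P' hP'.1 _ (φ a).2 _ (φ c).2 fun h => hac (hφ (Subtype.ext h))

/-- The adjacency of colours in the exceptional graphs `EG`. -/
def egAdj (i j : Fin 4) : Prop :=
  (i = 0 ∧ j = 1) ∨ (i = 1 ∧ j = 0) ∨ (i = 3 ∧ j ≠ 3) ∨ (i ≠ 3 ∧ j = 3)

lemma EG.coloured {G : SimpleGraph V} {W : Set V} {a b y : V} (h : EG G W a b y) :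
    ∃ col, Coloured G egAdj W col := by
  classical
  let col : V → Fin 4 := fun p => if p = a then 0 else if p = b then 1 else if p = y then 2 else 3
  obtain ⟨-, -, -, ab, ya, yb, nya, nyb, join, indep, -⟩ := h
  have hab := ab.ne
  have ca : col a = 0 := if_pos rfl
  have cb : col b = 1 := (if_neg hab.symm).trans (if_pos rfl)
  have cy : col y = 2 := (if_neg nya).trans ((if_neg nyb).trans (if_pos rfl))
  have cp : ∀ p, p ≠ a → p ≠ b → p ≠ y → col p = 3 := fun p h1 h2 h3 =>
    (if_neg h1).trans ((if_neg h2).trans (if_neg h3))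
  have four : ∀ p, p = a ∨ p = b ∨ p = y ∨ (p ≠ a ∧ p ≠ b ∧ p ≠ y) := fun p => by tauto
  refine ⟨col, fun p hp q hq hpq => ?_⟩
  rcases four p with rfl | rfl | rfl | ⟨p1, p2, p3⟩ <;>
  rcases four q with rfl | rfl | rfl | ⟨q1, q2, q3⟩
  · exact (hpq rfl).elim
  · simp [ca, cb, egAdj, ab]
  · simp [ca, cy, egAdj, G.adj_comm p, ya]
  · simp [ca, cp q q1 q2 q3, egAdj, (join q hq q1 q2 q3).1.symm]
  · simp [ca, cb, egAdj, ab.symm]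
  · exact (hpq rfl).elim
  · simp [cb, cy, egAdj, G.adj_comm p, yb]
  · simp [cb, cp q q1 q2 q3, egAdj, (join q hq q1 q2 q3).2.1.symm]
  · simp [ca, cy, egAdj, ya]
  · simp [cb, cy, egAdj, yb]
  · exact (hpq rfl).elim
  · simp [cy, cp q q1 q2 q3, egAdj, (join q hq q1 q2 q3).2.2.symm]
  · simp [ca, cp p p1 p2 p3, egAdj, (join p hp p1 p2 p3).1]
  · simp [cb, cp p p1 p2 p3, egAdj, (join p hp p1 p2 p3).2.1]
  · simp [cy, cp p p1 p2 p3, egAdj, (join p hp p1 p2 p3).2.2]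
  · simp [cp p p1 p2 p3, cp q q1 q2 q3, egAdj, indep p hp p1 p2 p3 q hq q1 q2 q3]

lemma eg_pwo : LabelledPwo fun _ G K => ∃ a b y, EG G K a b y := by
  intro Q r _ S hS
  exact (coloured_pwo egAdj Q r S hS).mono fun P hP =>
    ⟨hP.1.elim fun _ h => h.elim fun _ h => h.elim fun _ h => h.coloured, hP.2⟩

end GoodPwo

section Assembly

lemma noCut_noHat_pwo : LabelledPwo fun _ G K => NoCut G K ∧ NoHat G K := by
  intro Q r _ S hS
  refine ((((k4free_block_pwo Q r S hS).union (critical_pwo Q r S hS)).union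
    (cm_pwo Q r S hS)).union (eg_pwo Q r S hS)).mono ?_
  rintro P ⟨⟨h1, h2⟩, hl⟩
  have := P.fin
  by_cases h4 : HasK4 P.G P.K
  · by_cases hc : Crit P.G P.K
    · exact Or.inl (Or.inl (Or.inr ⟨⟨h1, hc⟩, hl⟩))
    · rcases good_of_not_crit h1 h2 h4 hc with h | h
      · exact Or.inl (Or.inr ⟨h.1, hl⟩)
      · exact Or.inr ⟨h, hl⟩
  · exact Or.inl (Or.inl (Or.inl ⟨⟨h1, h4⟩, hl⟩))

lemma noHat_univ {V : Type} {G : SimpleGraph V} (h : ¬ IsInducedMinor hatK4 G) :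
    NoHat G Set.univ := by
  intro A hA _ E _ hE hEA i j hij hi hj
  by_contra! hk
  obtain ⟨σ, hσ0, hσ1⟩ : ∃ σ : Equiv.Perm (Fin 4), σ 0 = i ∧ σ 1 = j := by
    have : ∀ i j : Fin 4, i ≠ j → ∃ σ : Equiv.Perm (Fin 4), σ 0 = i ∧ σ 1 = j := by decide
    exact this i j hij
  have hT : ∀ a : Fin 4, Tch G E (A (σ a)) ↔ a = 0 ∨ a = 1 := by
    intro a
    constructor
    · intro ht
      by_contra! hne
      refine hk (σ a) ?_ ?_ ht
      · rw [← hσ0]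
        exact fun e => hne.1 (σ.injective e)
      · rw [← hσ1]
        exact fun e => hne.2 (σ.injective e)
    · rintro (rfl | rfl)
      · rwa [hσ0]
      · rwa [hσ1]
  let μ : Fin 5 → Set V := Fin.lastCases E fun a => A (σ a)
  have hl : μ (Fin.last 4) = E := Fin.lastCases_last
  have hc : ∀ a : Fin 4, μ a.castSucc = A (σ a) := fun a => Fin.lastCases_castSucc a
  have hcn : ∀ a, Cn G (μ a) := fun a => by
    induction a using Fin.lastCases with
    | last => rwa [hl]
    | cast a => rw [hc]; exact hA.1 _
  refine h ⟨μ, fun a => (hcn a).1, fun a b hab => ?_, fun a => (hcn a).connected,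
    fun a b hab => ?_⟩
  · induction a using Fin.lastCases with
    | last => induction b using Fin.lastCases with
      | last => exact (hab rfl).elim
      | cast b => rw [hl, hc]; exact hEA _
    | cast a => induction b using Fin.lastCases with
      | last => rw [hl, hc]; exact (hEA _).symm
      | cast b =>
        rw [hc, hc]
        exact (hA.2 _ _ fun e => hab (congrArg _ (σ.injective e))).1
  · change Tch G (μ a) (μ b) ↔ _
    induction a using Fin.lastCases with
    | last => induction b using Fin.lastCases with
      | last => exact (hab rfl).elim
      | cast b =>
        rw [hl, hc, hT]
        revert b
        simp only [hatK4, fromRel_adj]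
        decide
    | cast a => induction b using Fin.lastCases with
      | last =>
        rw [hl, hc, tch_comm, hT]
        revert a
        simp only [hatK4, fromRel_adj]
        decide
      | cast b =>
        rw [hc, hc]
        refine iff_of_true (hA.2 _ _ fun e => hab (congrArg _ (σ.injective e))).2 ?_
        rw [hatK4, fromRel_adj]
        exact ⟨hab, Or.inl (Or.inl ⟨a.2, b.2⟩)⟩

/-- The family of the components of a finite graph. -/
def components (G : FinGraph) : Fam (Piece PUnit.{2} 0) where
  I := {L : Set (Fin G.1) // IsComp G.2 Set.univ L}
  fin := inferInstance
  g L := ⟨Fin G.1, inferInstance, G.2, fun _ => ⟨⟩, L.1, fun i => i.elim0, fun i => i.elim0,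
    fun i => i.elim0⟩

lemma isInducedMinor_of_components {r : PUnit.{2} → PUnit.{2} → Prop} {H G : FinGraph}
    (h : FLE (PLE r false) (components H) (components G)) : FinGraph.IM H G := by
  obtain ⟨φ, hφ, hμ⟩ := h
  obtain ⟨μ, hμ⟩ : ∃ μ : (components H).I → Fin H.1 → Set (Fin G.1), ∀ i,
      Mod r false H.2 (fun _ => ⟨⟩) i.1 (fun i : Fin 0 => i.elim0) G.2 (fun _ => ⟨⟩) (φ i).1
        (fun i => i.elim0) (μ i) := by
    choose μ hμ using hμ
    exact ⟨μ, hμ⟩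
  have hL : ∀ a : Fin H.1, ∃ L : (components H).I, a ∈ L.1 := fun a => by
    obtain ⟨L, hL, ha⟩ := exists_isComp (G := H.2) (Set.mem_univ a)
    exact ⟨⟨L, hL⟩, ha⟩
  choose L hL using hL
  have hsub : ∀ a, μ (L a) a ⊆ (φ (L a)).1 := fun a => (hμ (L a)).sub a (hL a)
  have hcn : ∀ a, Cn G.2 (μ (L a) a) := fun a => (hμ (L a)).cn a (Or.inl (hL a))
  have hne : ∀ a b, L a ≠ L b → (φ (L a)).1 ≠ (φ (L b)).1 :=
    fun a b h e => h (hφ (Subtype.ext e))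
  refine ⟨fun a => μ (L a) a, fun a => (hcn a).1, fun a b hab => ?_, fun a => (hcn a).connected,
    fun a b hab => ?_⟩
  · by_cases h : L a = L b
    · have hb : b ∈ (L a).1 := h ▸ hL b
      beta_reduce
      rw [← h]
      exact (hμ (L a)).disj a (Or.inl (hL a)) b (Or.inl hb) hab
    · exact ((φ (L a)).2.disjoint (φ (L b)).2 (hne a b h)).mono (hsub a) (hsub b)
  · by_cases h : L a = L b
    · have hb : b ∈ (L a).1 := h ▸ hL b
      beta_reduce
      rw [← h]
      exact (hμ (L a)).adj a (hL a) b (Or.inl hb) hab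
    · refine iff_of_false (fun ht => (φ (L a)).2.not_tch (φ (L b)).2 (hne a b h) ?_) fun ht => ?_
      · exact Tch.mono ht (hsub a) (hsub b)
      · exact (L a).2.not_tch (L b).2 (fun e => h (Subtype.ext e)) ⟨a, hL a, b, hL b, ht⟩

end Assembly

/-- The class of `K̂₄`-induced minor-free finite graphs is well-quasi-ordered
by the induced minor relation. -/
theorem hatK4_free_wqo :
    WqoClass (fun G => ¬ IsInducedMinor hatK4 G.2) := by
  intro f hf
  have : IsPreorder PUnit.{2} fun _ _ => True :=
    { refl := fun _ => trivial, trans := fun _ _ _ _ _ => trivial }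
  obtain ⟨i, j, hij, h⟩ := pwo_good (fam_pwo (connected_pwo_of_blocks noCut_noHat_pwo PUnit.{2}
    (fun _ _ => True) Set.univ Set.finite_univ.partiallyWellOrderedOn))
    (fun i => components (f i)) fun i L => ⟨⟨L.2.cn, fun B _ hB =>
      ⟨hB, (noHat_univ (hf i)).mono (Set.subset_univ _)⟩⟩, fun _ _ => trivial⟩
  exact ⟨i, j, hij, isInducedMinor_of_components h⟩

end IMWQO
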